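/- Unconditionally, for every ε > 0 and every T > 0 there exists ρ' ∈ ℂ with ζ'(ρ') = 0, Re(ρ') > 1, Im(ρ') > T and |L(ρ',χ)|·log(log(Im ρ')) ≤ (π²·e^{−C₀}/6)·∏_{p prime, p ∣ q} (p+1)/p + ε. (Equivalently, liminf over critical points ρ' of ζ with Re(ρ') > 1 and Im(ρ') → ∞ of |L(ρ',χ)|·log log Im(ρ') is at most (π²e^{−C₀}/6)·∏_{p∣q}(p+1)/p.) -/

import Mathlib

section NumberTheory

/-- `log n / n` supported on primes. -/
noncomputable def logPrimeDiv (n : ℕ) : ℝ := if n.Prime then Real.log n / n else 0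

lemma logPrimeDiv_nonneg (n : ℕ) : 0 ≤ logPrimeDiv n := by
  unfold logPrimeDiv
  split_ifs
  · positivity
  · exact le_rfl

/-- Summation by parts. -/
lemma sum_Ico_mul_eq_add_sum_sub_mul {R : Type*} [CommRing R] (f z : ℕ → R) {a b : ℕ}
    (hab : a ≤ b) :
    ∑ n ∈ Finset.Ico a (b + 1), f n * z n =
      f b * ∑ n ∈ Finset.Ico a (b + 1), z n +
        ∑ n ∈ Finset.Ico a b, (f n - f (n + 1)) * ∑ k ∈ Finset.Ico a (n + 1), z k := by
  induction b, hab using Nat.le_induction with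
  | base => simp
  | succ b hab ih =>
    have h1 := Finset.sum_Ico_succ_top (show a ≤ b + 1 by omega) z
    rw [Finset.sum_Ico_succ_top (show a ≤ b + 1 by omega), ih, h1,
      Finset.sum_Ico_succ_top hab fun n => (f n - f (n + 1)) * ∑ k ∈ Finset.Ico a (n + 1), z k]
    ring

/-- Abel's inequality. -/
lemma norm_sum_Ico_mul_le (f : ℕ → ℝ) (z : ℕ → ℂ) {C : ℝ} {a b : ℕ} (hab : a < b)
    (hf : ∀ n, a ≤ n → n + 1 < b → f (n + 1) ≤ f n) (hf0 : 0 ≤ f (b - 1))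
    (hz : ∀ m, m ≤ b → ‖∑ n ∈ Finset.Ico a m, z n‖ ≤ C) :
    ‖∑ n ∈ Finset.Ico a b, (f n : ℂ) * z n‖ ≤ C * f a := by
  obtain ⟨c, rfl⟩ : ∃ c, b = c + 1 := ⟨b - 1, by omega⟩
  have hac : a ≤ c := by omega
  rw [sum_Ico_mul_eq_add_sum_sub_mul _ _ hac]
  simp only [Nat.add_sub_cancel] at hf0
  have h1 : ‖(f c : ℂ) * ∑ n ∈ Finset.Ico a (c + 1), z n‖ ≤ f c * C := by
    rw [norm_mul, Complex.norm_real, Real.norm_of_nonneg hf0]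
    exact mul_le_mul_of_nonneg_left (hz _ le_rfl) hf0
  have h2 : ‖∑ n ∈ Finset.Ico a c, ((f n : ℂ) - f (n + 1 : ℕ)) *
      ∑ k ∈ Finset.Ico a (n + 1), z k‖ ≤ ∑ n ∈ Finset.Ico a c, (f n - f (n + 1)) * C := by
    refine norm_sum_le_of_le _ fun n hn => ?_
    rw [Finset.mem_Ico] at hn
    have h3 := hf n hn.1 (by omega)
    rw [norm_mul, ← Complex.ofReal_sub, Complex.norm_real, Real.norm_of_nonneg (by linarith)]
    exact mul_le_mul_of_nonneg_left (hz _ (by omega)) (by linarith)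
  have h3 : ∑ n ∈ Finset.Ico a c, (f n - f (n + 1)) = f a - f c := by
    have := Finset.sum_Ico_sub f hac
    rw [← neg_inj, ← Finset.sum_neg_distrib]
    simp only [neg_sub]
    exact this
  rw [← Finset.sum_mul, h3] at h2
  calc _ ≤ f c * C + (f a - f c) * C := (norm_add_le _ _).trans (add_le_add h1 h2)
    _ = C * f a := by ring

lemma exists_sum_vonMangoldt_not_prime_le :
    ∃ C : ℝ, 0 ≤ C ∧ ∀ s : Finset ℕ,
      ∑ n ∈ s, (if n.Prime then 0 else ArithmeticFunction.vonMangoldt n) / (n : ℝ) ≤ C := by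
  have h := ArithmeticFunction.vonMangoldt.summable_residueClass_non_primes_div (1 : ZMod 1)
  have h1 : ∀ n : ℕ, ArithmeticFunction.vonMangoldt.residueClass (1 : ZMod 1) n =
      ArithmeticFunction.vonMangoldt n := fun n => by
    simp [ArithmeticFunction.vonMangoldt.residueClass, Subsingleton.elim (_ : ZMod 1) 1]
  simp only [h1] at h
  have h0 : ∀ n : ℕ, 0 ≤ (if n.Prime then 0 else ArithmeticFunction.vonMangoldt n) / (n : ℝ) :=
    fun n => by split_ifs <;> positivity [ArithmeticFunction.vonMangoldt_nonneg (n := n)]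
  exact ⟨_, tsum_nonneg h0, fun s => h.sum_le_tsum s fun n _ => h0 n⟩

lemma vonMangoldt_div_eq (n : ℕ) : ArithmeticFunction.vonMangoldt n / (n : ℝ) =
    logPrimeDiv n + (if n.Prime then 0 else ArithmeticFunction.vonMangoldt n) / (n : ℝ) := by
  unfold logPrimeDiv
  split_ifs with h
  · simp [ArithmeticFunction.vonMangoldt_apply_prime h]
  · simp

lemma abs_sum_vonMangoldt_div_sub_log_le : ∃ C : ℝ, ∀ N : ℕ, 1 ≤ N →
    |∑ n ∈ Finset.Ioc 0 N, ArithmeticFunction.vonMangoldt n / (n : ℝ) - Real.log N| ≤ C := by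
  refine ⟨Real.log 4 + 5, fun N hN => ?_⟩
  have hN0 : (0 : ℝ) < N := by exact_mod_cast hN
  have h1 : ∑ n ∈ Finset.Ioc 0 N, ArithmeticFunction.vonMangoldt n * ((N / n : ℕ) : ℝ) =
      Real.log (N.factorial : ℝ) := by
    rw [← ArithmeticFunction.sum_Ioc_mul_zeta_eq_sum]
    simp only [ArithmeticFunction.vonMangoldt_mul_zeta, ArithmeticFunction.log_apply]
    clear hN0 hN
    induction N with
    | zero => simp
    | succ n ih =>
      rw [Finset.sum_Ioc_succ_top (by omega), ih, Nat.factorial_succ, Nat.cast_mul,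
        Real.log_mul (by positivity) (by positivity), add_comm]
  have h2 : Real.log (N.factorial : ℝ) ≤ N * Real.log N := by
    rw [← Real.log_pow]
    exact Real.log_le_log (by positivity) (by exact_mod_cast Nat.factorial_le_pow N)
  have h3 : N * Real.log N - N ≤ Real.log (N.factorial : ℝ) := by
    have h := Stirling.le_log_factorial_stirling (n := N) (by omega)
    have h5 : 0 ≤ Real.log N := Real.log_natCast_nonneg N
    have h6 : 0 ≤ Real.log (2 * Real.pi) := Real.log_nonneg (by nlinarith [Real.pi_gt_three])
    linarith
  have hpsi : ∑ n ∈ Finset.Ioc 0 N, ArithmeticFunction.vonMangoldt n ≤ (Real.log 4 + 4) * N := by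
    have := Chebyshev.psi_le_const_mul_self (x := N) (by positivity)
    simpa [Chebyshev.psi] using this
  have h4 : ∀ n ∈ Finset.Ioc 0 N, ArithmeticFunction.vonMangoldt n * ((N / n : ℕ) : ℝ) ≤
      N * (ArithmeticFunction.vonMangoldt n / (n : ℝ)) := fun n hn => by
    have : ((N / n : ℕ) : ℝ) ≤ N / n := Nat.cast_div_le
    calc _ ≤ ArithmeticFunction.vonMangoldt n * ((N : ℝ) / n) :=
          mul_le_mul_of_nonneg_left this ArithmeticFunction.vonMangoldt_nonneg
      _ = _ := by ring
  have h5 : ∀ n ∈ Finset.Ioc 0 N, N * (ArithmeticFunction.vonMangoldt n / (n : ℝ)) ≤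
      ArithmeticFunction.vonMangoldt n * ((N / n : ℕ) : ℝ) +
        ArithmeticFunction.vonMangoldt n := fun n hn => by
    have : (N : ℝ) / n ≤ ((N / n : ℕ) : ℝ) + 1 := by
      rw [← Nat.floor_div_eq_div (K := ℝ)]; exact (Nat.lt_floor_add_one _).le
    calc _ = ArithmeticFunction.vonMangoldt n * ((N : ℝ) / n) := by ring
      _ ≤ ArithmeticFunction.vonMangoldt n * (((N / n : ℕ) : ℝ) + 1) :=
          mul_le_mul_of_nonneg_left this ArithmeticFunction.vonMangoldt_nonneg
      _ = _ := by ring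
  have h6 := Finset.sum_le_sum h4
  have h7 := Finset.sum_le_sum h5
  rw [Finset.sum_add_distrib] at h7
  rw [← Finset.mul_sum] at h6 h7
  set S := ∑ n ∈ Finset.Ioc 0 N, ArithmeticFunction.vonMangoldt n / (n : ℝ)
  rw [h1] at h6 h7
  have h8 : N * (S - Real.log N) ≤ N * (Real.log 4 + 5) := by linarith
  have h9 : N * (-(Real.log 4 + 5)) ≤ N * (S - Real.log N) := by
    have : 0 ≤ Real.log 4 := Real.log_nonneg (by norm_num)
    nlinarith
  rw [abs_le]
  exact ⟨le_of_mul_le_mul_left h9 hN0, le_of_mul_le_mul_left h8 hN0⟩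

lemma abs_sum_logPrimeDiv_sub_log_le : ∃ C : ℝ, ∀ N : ℕ, 1 ≤ N →
    |∑ n ∈ Finset.Ioc 0 N, logPrimeDiv n - Real.log N| ≤ C := by
  obtain ⟨C₁, h₁⟩ := abs_sum_vonMangoldt_div_sub_log_le
  obtain ⟨C₂, h₂, h₃⟩ := exists_sum_vonMangoldt_not_prime_le
  refine ⟨C₁ + C₂, fun N hN => ?_⟩
  have h4 := h₁ N hN
  have h5 := h₃ (Finset.Ioc 0 N)
  have h6 : 0 ≤ ∑ n ∈ Finset.Ioc 0 N,
      (if n.Prime then 0 else ArithmeticFunction.vonMangoldt n) / (n : ℝ) :=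
    Finset.sum_nonneg fun n _ => by
      split_ifs <;> positivity [ArithmeticFunction.vonMangoldt_nonneg (n := n)]
  simp only [vonMangoldt_div_eq, Finset.sum_add_distrib] at h4
  rw [abs_le] at h4 ⊢
  constructor <;> linarith

/-- **Mertens' first theorem**, in logarithmic scale. -/
lemma abs_sum_logPrimeDiv_exp_sub_le : ∃ C : ℝ, 0 ≤ C ∧ ∀ U : ℝ, 0 ≤ U →
    |∑ n ∈ Finset.Ioc 0 ⌊Real.exp U⌋₊, logPrimeDiv n - U| ≤ C := by
  obtain ⟨C, hC⟩ := abs_sum_logPrimeDiv_sub_log_le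
  have hC0 : 0 ≤ C := (abs_nonneg _).trans (hC 1 le_rfl)
  refine ⟨C + 1, by linarith, fun U hU => ?_⟩
  have h1 : 1 ≤ Real.exp U := Real.one_le_exp hU
  have h2 : 1 ≤ ⌊Real.exp U⌋₊ := Nat.le_floor (by simpa using h1)
  have h3 := hC _ h2
  have hpos : (0 : ℝ) < ⌊Real.exp U⌋₊ := by exact_mod_cast h2
  have h4 : Real.log ⌊Real.exp U⌋₊ ≤ U := by
    rw [Real.log_le_iff_le_exp hpos]; exact Nat.floor_le (by positivity)
  have h5 : U - 1 ≤ Real.log ⌊Real.exp U⌋₊ := by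
    rw [Real.le_log_iff_exp_le hpos, Real.exp_sub]
    have h6 := Nat.lt_floor_add_one (Real.exp U)
    have h7 : (1 : ℝ) ≤ ⌊Real.exp U⌋₊ := by exact_mod_cast h2
    have h8 : (2 : ℝ) ≤ Real.exp 1 := by linarith [Real.add_one_le_exp 1]
    rw [div_le_iff₀ (by positivity)]
    nlinarith
  rw [abs_le] at h3 ⊢
  constructor <;> linarith

end NumberTheory

section CharacterSums

variable {q : ℕ} [NeZero q]

lemma norm_sum_range_dirichletCharacter_le {χ : DirichletCharacter ℂ q} (hχ : χ ≠ 1) (m : ℕ) :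
    ‖∑ n ∈ Finset.range m, χ n‖ ≤ q := by
  have h0 : ∑ n ∈ Finset.range q, χ n = 0 := by
    rw [← MulChar.sum_eq_zero_of_ne_one hχ]
    obtain ⟨k, rfl⟩ : ∃ k, q = k + 1 := ⟨q - 1, by have := NeZero.pos q; omega⟩
    rw [← Fin.sum_univ_eq_sum_range (fun n : ℕ => χ n) (k + 1)]
    refine Finset.sum_congr rfl fun a _ => ?_
    congr 1
    exact Fin.cast_val_eq_self a
  induction m using Nat.strong_induction_on with
  | _ m ih =>
    rcases lt_or_ge m q with h | h
    · calc _ ≤ ∑ n ∈ Finset.range m, (1 : ℝ) := norm_sum_le_of_le _ fun n _ => χ.norm_le_one _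
        _ ≤ q := by simpa using h.le
    · obtain ⟨k, rfl⟩ := Nat.exists_eq_add_of_le h
      rw [Finset.sum_range_add, h0, zero_add]
      have h2 := ih k (by have := NeZero.pos q; omega)
      simpa using h2

lemma norm_sum_Ico_dirichletCharacter_le {χ : DirichletCharacter ℂ q} (hχ : χ ≠ 1) (a b : ℕ) :
    ‖∑ n ∈ Finset.Ico a b, χ n‖ ≤ 2 * q := by
  rcases le_or_gt a b with h | h
  · rw [Finset.sum_Ico_eq_sub _ h]
    have h1 := norm_sum_range_dirichletCharacter_le hχ a
    have h2 := norm_sum_range_dirichletCharacter_le hχ b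
    exact (norm_sub_le _ _).trans (by linarith)
  · simp [Finset.Ico_eq_empty_of_le h.le]

lemma norm_LFunction_sub_sum_le_of_one_lt {χ : DirichletCharacter ℂ q} (hχ : χ ≠ 1) (N : ℕ) {σ : ℝ}
    (hσ : 1 < σ) :
    ‖χ.LFunction σ - ∑ n ∈ Finset.range (N + 1), χ n * (n : ℂ) ^ (-(σ : ℂ))‖ ≤
      2 * q / (N + 1) := by
  have hs : 1 < (σ : ℂ).re := by simpa using hσ
  have h1 : HasSum (fun n : ℕ => χ n * (n : ℂ) ^ (-(σ : ℂ))) (χ.LFunction σ) := by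
    rw [DirichletCharacter.LFunction_eq_LSeries χ hs]
    have := (DirichletCharacter.LSeriesSummable_of_one_lt_re χ hs).LSeriesHasSum
    refine this.congr_fun ?_ |> fun h => h
    intro n
    rcases eq_or_ne n 0 with rfl | hn
    · have : (-(σ : ℂ)) ≠ 0 := by
        rw [neg_ne_zero]; exact_mod_cast (by linarith : σ ≠ 0)
      simp [Complex.zero_cpow this]
    · rw [LSeries.term_of_ne_zero hn, Complex.cpow_neg, div_eq_mul_inv]
  have h2 := (h1.tendsto_sum_nat.sub_const
    (∑ n ∈ Finset.range (N + 1), χ n * (n : ℂ) ^ (-(σ : ℂ)))).norm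
  refine le_of_tendsto h2 ?_
  filter_upwards [Filter.eventually_gt_atTop (N + 1)] with b hb
  rw [← Finset.sum_Ico_eq_sub _ hb.le]
  have h3 := norm_sum_Ico_mul_le (fun n => (n : ℝ) ^ (-σ)) (fun n => χ n) hb
    (fun n hn _ => Real.rpow_le_rpow_of_nonpos (by have : 0 < n := by omega
                                                   positivity) (by push_cast; linarith)
      (by linarith)) (by positivity) (fun m _ => norm_sum_Ico_dirichletCharacter_le hχ _ _)
  have h4 : ((N + 1 : ℕ) : ℝ) ^ (-σ) ≤ 1 / (N + 1) := by
    calc ((N + 1 : ℕ) : ℝ) ^ (-σ) ≤ ((N + 1 : ℕ) : ℝ) ^ (-1 : ℝ) :=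
          Real.rpow_le_rpow_of_exponent_le (by simp) (by linarith)
      _ = _ := by rw [Real.rpow_neg_one]; simp
  have h5 : ∑ n ∈ Finset.Ico (N + 1) b, χ n * (n : ℂ) ^ (-(σ : ℂ)) =
      ∑ n ∈ Finset.Ico (N + 1) b, (((n : ℝ) ^ (-σ) : ℝ) : ℂ) * χ n := by
    refine Finset.sum_congr rfl fun n _ => ?_
    rw [Complex.ofReal_cpow (by positivity)]
    push_cast
    ring
  rw [h5]
  calc _ ≤ _ := h3
    _ ≤ 2 * q * (1 / (N + 1)) := mul_le_mul_of_nonneg_left h4 (by positivity)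
    _ = _ := by ring

lemma norm_LFunction_one_sub_sum_le {χ : DirichletCharacter ℂ q} (hχ : χ ≠ 1) (N : ℕ) :
    ‖χ.LFunction 1 - ∑ n ∈ Finset.Ioc 0 N, χ n / (n : ℂ)‖ ≤ 2 * q / (N + 1) := by
  have hc : Continuous fun σ : ℝ => ‖χ.LFunction σ -
      ∑ n ∈ Finset.Ioc 0 N, χ n * (n : ℂ) ^ (-(σ : ℂ))‖ := by
    refine (((DirichletCharacter.differentiable_LFunction hχ).continuous.comp
      Complex.continuous_ofReal).sub (continuous_finsetSum _ fun n hn => ?_)).norm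
    refine continuous_const.mul ?_
    have hn0 : (n : ℂ) ≠ 0 := by
      have := (Finset.mem_Ioc.mp hn).1
      exact_mod_cast this.ne'
    exact Complex.continuous_ofReal.neg.const_cpow (Or.inl hn0)
  have h1 : Filter.Tendsto (fun σ : ℝ => ‖χ.LFunction σ -
      ∑ n ∈ Finset.Ioc 0 N, χ n * (n : ℂ) ^ (-(σ : ℂ))‖) (nhdsWithin 1 (Set.Ioi 1))
      (nhds ‖χ.LFunction 1 - ∑ n ∈ Finset.Ioc 0 N, χ n / (n : ℂ)‖) := by
    have := (hc.tendsto 1).mono_left (nhdsWithin_le_nhds (s := Set.Ioi 1))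
    simpa [Complex.cpow_neg_one, div_eq_mul_inv] using this
  refine le_of_tendsto h1 ?_
  filter_upwards [self_mem_nhdsWithin] with σ hσ
  have h2 := norm_LFunction_sub_sum_le_of_one_lt hχ N hσ
  have hσ0 : (-(σ : ℂ)) ≠ 0 := by
    rw [neg_ne_zero]; exact_mod_cast (by have : 1 < σ := hσ
                                         linarith : σ ≠ 0)
  rwa [Finset.sum_range_eq_add_Ico _ (by omega), Nat.cast_zero (R := ℂ), Complex.zero_cpow hσ0, mul_zero,
    zero_add, show Finset.Ico 1 (N + 1) = Finset.Ioc 0 N from by ext; simp; omega] at h2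

lemma norm_sum_dirichletCharacter_mul_log_div_le {χ : DirichletCharacter ℂ q} (hχ : χ ≠ 1)
    (N : ℕ) : ‖∑ n ∈ Finset.Ioc 0 N, χ n * Real.log n / (n : ℂ)‖ ≤ 2 * q + 1 := by
  have hq : (0 : ℝ) ≤ q := by positivity
  have hterm : ∀ n : ℕ, ‖χ n * Real.log n / (n : ℂ)‖ ≤ Real.log n / n := fun n => by
    rw [norm_div, norm_mul, Complex.norm_real, Complex.norm_natCast,
      Real.norm_of_nonneg (Real.log_natCast_nonneg n)]
    gcongr
    exact mul_le_of_le_one_left (Real.log_natCast_nonneg n) (χ.norm_le_one _)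
  have hl2 : Real.log 2 / 2 ≤ 1 := by linarith [Real.log_two_lt_d9]
  have hl3 : Real.log 3 / 3 ≤ 1 := by
    have := Real.log_le_sub_one_of_pos (show (0 : ℝ) < 3 by norm_num)
    linarith
  rcases le_or_gt N 2 with h | h
  · refine (norm_sum_le_of_le _ fun n _ => hterm n).trans ?_
    interval_cases N
    · simp; positivity
    · simp; positivity
    · rw [Finset.sum_Ioc_succ_top (by omega), Finset.sum_Ioc_succ_top (by omega)]
      norm_num
      linarith
  · rw [← Finset.sum_Ioc_consecutive _ (show 0 ≤ 2 by omega) h.le]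
    have h1 : ‖∑ n ∈ Finset.Ioc (0 : ℕ) 2, χ n * Real.log n / (n : ℂ)‖ ≤ 1 := by
      refine (norm_sum_le_of_le _ fun n _ => hterm n).trans ?_
      rw [Finset.sum_Ioc_succ_top (by omega), Finset.sum_Ioc_succ_top (by omega)]
      norm_num
      linarith
    have h2 := norm_sum_Ico_mul_le (fun n => Real.log n / n) (fun n => χ n)
      (show 3 < N + 1 by omega) (fun n hn _ => by
        have he : Real.exp 1 ≤ 3 := (Real.exp_one_lt_d9.trans (by norm_num)).le
        have h3 : (3 : ℝ) ≤ n := by exact_mod_cast hn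
        exact Real.log_div_self_antitoneOn (show Real.exp 1 ≤ (n : ℝ) by linarith)
          (show Real.exp 1 ≤ ((n + 1 : ℕ) : ℝ) by push_cast; linarith) (by push_cast; linarith))
      (div_nonneg (Real.log_natCast_nonneg _) (by positivity))
      (fun m _ => norm_sum_Ico_dirichletCharacter_le hχ _ _)
    have h4 : ∑ n ∈ Finset.Ioc 2 N, χ n * Real.log n / (n : ℂ) =
        ∑ n ∈ Finset.Ico 3 (N + 1), ((Real.log n / n : ℝ) : ℂ) * χ n := by
      rw [show Finset.Ico 3 (N + 1) = Finset.Ioc 2 N from by ext; simp; omega]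
      refine Finset.sum_congr rfl fun n _ => ?_
      push_cast
      ring
    rw [h4]
    refine (norm_add_le _ _).trans ?_
    have : 2 * (q : ℝ) * (Real.log (3 : ℕ) / (3 : ℕ)) ≤ 2 * q * 1 :=
      mul_le_mul_of_nonneg_left (by simpa using hl3) (by positivity)
    linarith

lemma exists_norm_sum_dirichletCharacter_mul_vonMangoldt_div_le {χ : DirichletCharacter ℂ q}
    (hχ : χ ≠ 1) : ∃ C : ℝ, ∀ N : ℕ,
      ‖∑ n ∈ Finset.Ioc 0 N, χ n * ArithmeticFunction.vonMangoldt n / (n : ℂ)‖ ≤ C := by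
  have hL : 0 < ‖χ.LFunction 1‖ :=
    norm_pos_iff.mpr (DirichletCharacter.LFunction_apply_one_ne_zero hχ)
  refine ⟨(2 * q + 1 + 2 * q * (Real.log 4 + 4)) / ‖χ.LFunction 1‖, fun N => ?_⟩
  rw [le_div_iff₀' hL, ← norm_mul]
  let f : ArithmeticFunction ℂ := ⟨fun n => χ n * ArithmeticFunction.vonMangoldt n / (n : ℂ),
    by simp⟩
  let g : ArithmeticFunction ℂ := ⟨fun n => χ n / (n : ℂ), by simp⟩
  have hfg : ∀ n, (f * g) n = χ n * Real.log n / (n : ℂ) := fun n => by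
    rw [ArithmeticFunction.mul_apply, ← ArithmeticFunction.vonMangoldt_sum,
      ← Nat.sum_divisorsAntidiagonal (fun i _ => ArithmeticFunction.vonMangoldt i)]
    push_cast
    rw [Finset.mul_sum, Finset.sum_div]
    refine Finset.sum_congr rfl fun x hx => ?_
    rw [← (Nat.mem_divisorsAntidiagonal.mp hx).1]
    simp only [f, g, ArithmeticFunction.coe_mk]
    push_cast
    rw [map_mul, div_mul_div_comm]
    ring
  have h1 := ArithmeticFunction.sum_Ioc_mul_eq_sum_sum f g N
  simp only [hfg] at h1
  have h2 : χ.LFunction 1 *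
      ∑ n ∈ Finset.Ioc 0 N, χ n * ArithmeticFunction.vonMangoldt n / (n : ℂ) =
      ∑ n ∈ Finset.Ioc 0 N, χ n * Real.log n / (n : ℂ) +
      ∑ n ∈ Finset.Ioc 0 N, f n * (χ.LFunction 1 - ∑ m ∈ Finset.Ioc 0 (N / n), g m) := by
    rw [h1, ← Finset.sum_add_distrib, Finset.mul_sum]
    refine Finset.sum_congr rfl fun n _ => ?_
    simp only [f, ArithmeticFunction.coe_mk]
    ring
  rw [h2]
  refine (norm_add_le _ _).trans
    (add_le_add (norm_sum_dirichletCharacter_mul_log_div_le hχ N) ?_)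
  rcases Nat.eq_zero_or_pos N with rfl | hN
  · simp
    have : 0 ≤ Real.log 4 := Real.log_nonneg (by norm_num)
    positivity
  have hN0 : (0 : ℝ) < N := by exact_mod_cast hN
  have hpsi : ∑ n ∈ Finset.Ioc 0 N, ArithmeticFunction.vonMangoldt n ≤ (Real.log 4 + 4) * N := by
    have := Chebyshev.psi_le_const_mul_self (x := N) (by positivity)
    simpa [Chebyshev.psi] using this
  calc _ ≤ ∑ n ∈ Finset.Ioc 0 N, ArithmeticFunction.vonMangoldt n * (2 * q / N) := by
        refine norm_sum_le_of_le _ fun n hn => ?_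
        have hn0 : (0 : ℝ) < n := by exact_mod_cast (Finset.mem_Ioc.mp hn).1
        have h3 := norm_LFunction_one_sub_sum_le hχ (N / n)
        have h4 : ‖f n‖ ≤ ArithmeticFunction.vonMangoldt n / n := by
          simp only [f, ArithmeticFunction.coe_mk]
          rw [norm_div, norm_mul, Complex.norm_real, Complex.norm_natCast,
            Real.norm_of_nonneg ArithmeticFunction.vonMangoldt_nonneg]
          gcongr
          exact mul_le_of_le_one_left ArithmeticFunction.vonMangoldt_nonneg (χ.norm_le_one _)
        have h5 : 2 * q / (((N / n : ℕ) : ℝ) + 1) ≤ 2 * q / ((N : ℝ) / n) := by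
          have : (N : ℝ) / n ≤ ((N / n : ℕ) : ℝ) + 1 := by
            rw [← Nat.floor_div_eq_div (K := ℝ)]; exact (Nat.lt_floor_add_one _).le
          gcongr
        rw [norm_mul]
        calc _ ≤ ArithmeticFunction.vonMangoldt n / n * (2 * q / ((N : ℝ) / n)) :=
              mul_le_mul h4 (h3.trans h5) (norm_nonneg _)
                (div_nonneg ArithmeticFunction.vonMangoldt_nonneg hn0.le)
          _ = _ := by field_simp
    _ ≤ (Real.log 4 + 4) * N * (2 * q / N) := by
        rw [← Finset.sum_mul]
        exact mul_le_mul_of_nonneg_right hpsi (by positivity)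
    _ = _ := by field_simp

lemma exists_norm_sum_dirichletCharacter_mul_logPrimeDiv_le {χ : DirichletCharacter ℂ q}
    (hχ : χ ≠ 1) : ∃ C : ℝ, 0 ≤ C ∧ ∀ N : ℕ,
      ‖∑ n ∈ Finset.Ioc 0 N, χ n * logPrimeDiv n‖ ≤ C := by
  obtain ⟨C₁, h₁⟩ := exists_norm_sum_dirichletCharacter_mul_vonMangoldt_div_le hχ
  obtain ⟨C₂, h₂, h₃⟩ := exists_sum_vonMangoldt_not_prime_le
  have hC₁ : 0 ≤ C₁ := (norm_nonneg _).trans (h₁ 0)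
  refine ⟨C₁ + C₂, by positivity, fun N => ?_⟩
  have h4 : ∑ n ∈ Finset.Ioc 0 N, χ n * logPrimeDiv n =
      ∑ n ∈ Finset.Ioc 0 N, χ n * ArithmeticFunction.vonMangoldt n / (n : ℂ) -
      ∑ n ∈ Finset.Ioc 0 N, χ n *
        (((if n.Prime then 0 else ArithmeticFunction.vonMangoldt n) / (n : ℝ) : ℝ) : ℂ) := by
    rw [← Finset.sum_sub_distrib]
    refine Finset.sum_congr rfl fun n _ => ?_
    have := vonMangoldt_div_eq n
    rw [mul_div_assoc, ← mul_sub]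
    congr 1
    rw [eq_sub_iff_add_eq]
    exact_mod_cast this.symm
  rw [h4]
  refine (norm_sub_le _ _).trans (add_le_add (h₁ N) ?_)
  refine (norm_sum_le_of_le _ fun n _ => ?_).trans (h₃ (Finset.Ioc 0 N))
  have h0 : 0 ≤ (if n.Prime then 0 else ArithmeticFunction.vonMangoldt n) / (n : ℝ) := by
    split_ifs <;> positivity [ArithmeticFunction.vonMangoldt_nonneg (n := n)]
  rw [norm_mul, Complex.norm_real, Real.norm_of_nonneg h0]
  exact mul_le_of_le_one_left h0 (χ.norm_le_one _)

end CharacterSums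

section MertensThird

/-- The sum of `f n` over `0 < n ≤ exp U`. -/
noncomputable def expSum (f : ℕ → ℝ) (U : ℝ) : ℝ := ∑ n ∈ Finset.Ioc 0 ⌊Real.exp U⌋₊, f n

lemma expSum_sub {f : ℕ → ℝ} {U V : ℝ} (h : U ≤ V) :
    expSum f V - expSum f U = ∑ n ∈ Finset.Ioc ⌊Real.exp U⌋₊ ⌊Real.exp V⌋₊, f n := by
  have h1 : ⌊Real.exp U⌋₊ ≤ ⌊Real.exp V⌋₊ := Nat.floor_mono (Real.exp_le_exp.mpr h)
  rw [expSum, expSum, ← Finset.sum_Ioc_consecutive f (Nat.zero_le _) h1]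
  ring

lemma mem_Ioc_floor_exp {U V : ℝ} {n : ℕ} :
    n ∈ Finset.Ioc ⌊Real.exp U⌋₊ ⌊Real.exp V⌋₊ ↔ n ≠ 0 ∧ U < Real.log n ∧ Real.log n ≤ V := by
  rw [Finset.mem_Ioc, Nat.floor_lt (Real.exp_pos _).le, Nat.le_floor_iff (Real.exp_pos _).le]
  rcases eq_or_ne n 0 with rfl | hn
  · simp [(Real.exp_pos U).not_gt]
  · have h0 : (0 : ℝ) < n := by positivity
    rw [Real.lt_log_iff_exp_lt h0, Real.log_le_iff_le_exp h0]
    simp [hn]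

lemma mem_Ioc_zero_floor_exp {V : ℝ} {n : ℕ} :
    n ∈ Finset.Ioc 0 ⌊Real.exp V⌋₊ ↔ n ≠ 0 ∧ Real.log n ≤ V := by
  rw [Finset.mem_Ioc, Nat.le_floor_iff (Real.exp_pos _).le]
  rcases eq_or_ne n 0 with rfl | hn
  · simp
  · have h0 : (0 : ℝ) < n := by positivity
    rw [Real.log_le_iff_le_exp h0]
    simp [hn, Nat.pos_iff_ne_zero]

/-- `-log (1 - 1 / p)` at primes `p`. -/
noncomputable def negLogOneSubInv (n : ℕ) : ℝ :=
  if n.Prime then -Real.log (1 - 1 / n) else 0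

lemma logPrimeDiv_le_log_mul (n : ℕ) :
    logPrimeDiv n ≤ Real.log n * negLogOneSubInv n := by
  unfold logPrimeDiv negLogOneSubInv
  split_ifs with h
  · have h2 : (2 : ℝ) ≤ n := by exact_mod_cast h.two_le
    have h3 : 0 < 1 - 1 / (n : ℝ) := by
      rw [sub_pos, div_lt_one (by linarith)]; linarith
    have h4 := Real.log_le_sub_one_of_pos h3
    rw [div_eq_mul_one_div]
    exact mul_le_mul_of_nonneg_left (by linarith) (Real.log_natCast_nonneg n)
  · simp

lemma negLogOneSubInv_nonneg (n : ℕ) : 0 ≤ negLogOneSubInv n := by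
  unfold negLogOneSubInv
  split_ifs with h
  · have h2 : (2 : ℝ) ≤ n := by exact_mod_cast h.two_le
    have h4 := Real.log_nonpos (x := 1 - 1 / (n : ℝ)) (by
      rw [sub_nonneg, div_le_one (by linarith)]; linarith) (by
      have : 0 ≤ 1 / (n : ℝ) := by positivity
      linarith)
    linarith
  · exact le_rfl

lemma log_mul_negLogOneSubInv_le (n : ℕ) :
    negLogOneSubInv n ≤ (if n.Prime then 1 / (n : ℝ) else 0) + 2 / (n : ℝ) ^ 2 := by
  unfold negLogOneSubInv
  split_ifs with h
  · have h2 : (2 : ℝ) ≤ n := by exact_mod_cast h.two_le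
    have h0 : (0 : ℝ) < n := by linarith
    have h3 : 0 < 1 - 1 / (n : ℝ) := by
      rw [sub_pos, div_lt_one (by linarith)]; linarith
    have h4 := Real.one_sub_inv_le_log_of_pos h3
    have h5 : (1 - 1 / (n : ℝ))⁻¹ - 1 ≤ 1 / n + 2 / (n : ℝ) ^ 2 := by
      have h6 : (1 - 1 / (n : ℝ))⁻¹ = n / (n - 1) := by
        field_simp
      rw [h6, div_sub_one (by linarith), div_add_div _ _ h0.ne' (by positivity),
        div_le_div_iff₀ (by linarith) (by positivity)]
      nlinarith [mul_nonneg h0.le (sub_nonneg.mpr h2)]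
    linarith
  · positivity

lemma summable_two_div_sq : Summable fun n : ℕ => 2 / (n : ℝ) ^ 2 := by
  have := (Real.summable_one_div_nat_pow (p := 2)).mpr (by norm_num)
  refine (this.mul_left 2).congr fun n => ?_
  ring

/-- The sum of `-log (1 - 1 / p)` over primes `p ≤ exp K`, minus the harmonic number, converges. -/
lemma exists_tendsto_expSum_negLogOneSubInv : ∃ l : ℝ,
    Filter.Tendsto (fun K : ℕ => ∑ j ∈ Finset.range K,
      (expSum negLogOneSubInv ((j + 1 : ℕ) : ℝ) - expSum negLogOneSubInv (j : ℝ) - 1 / (j + 1)))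
      Filter.atTop (nhds l) := by
  obtain ⟨C, hC0, hC⟩ := abs_sum_logPrimeDiv_exp_sub_le
  let L : ℕ → ℝ := fun j => expSum logPrimeDiv ((j + 1 : ℕ) : ℝ) - expSum logPrimeDiv (j : ℝ)
  let c : ℕ → ℝ := fun j =>
    expSum negLogOneSubInv ((j + 1 : ℕ) : ℝ) - expSum negLogOneSubInv (j : ℝ)
  let w : ℕ → ℝ := fun j =>
    expSum (fun n => 2 / (n : ℝ) ^ 2) ((j + 1 : ℕ) : ℝ) - expSum (fun n => 2 / (n : ℝ) ^ 2) (j : ℝ)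
  have hE : ∀ j : ℕ, |expSum logPrimeDiv j - j| ≤ C := fun j => hC j (by positivity)
  have hlow : ∀ j, 0 ≤ c j - L j / (j + 1) := fun j => by
    have hj : (j : ℝ) ≤ ((j + 1 : ℕ) : ℝ) := by push_cast; linarith
    have hj0 : (0 : ℝ) < j + 1 := by positivity
    rw [sub_nonneg, div_le_iff₀ hj0]
    simp only [c, L]
    rw [expSum_sub hj, expSum_sub hj, Finset.sum_mul]
    refine Finset.sum_le_sum fun n hn => (logPrimeDiv_le_log_mul n).trans ?_
    rw [mul_comm]
    have := (mem_Ioc_floor_exp.mp hn).2.2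
    push_cast at this
    exact mul_le_mul_of_nonneg_left this (negLogOneSubInv_nonneg n)
  have hup : ∀ j : ℕ, 1 ≤ j → c j ≤ L j / j + w j := fun j hj1 => by
    have hj : (j : ℝ) ≤ ((j + 1 : ℕ) : ℝ) := by push_cast; linarith
    have hj0 : (0 : ℝ) < j := by positivity
    simp only [c, L, w]
    rw [expSum_sub hj, expSum_sub hj, expSum_sub hj, Finset.sum_div, ← Finset.sum_add_distrib]
    refine Finset.sum_le_sum fun n hn => (log_mul_negLogOneSubInv_le n).trans ?_
    refine add_le_add_left ?_ _
    have := (mem_Ioc_floor_exp.mp hn).2.1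
    unfold logPrimeDiv
    split_ifs
    · rw [div_right_comm]
      gcongr
      rw [le_div_iff₀ hj0]
      linarith
    · simp
  have hw : Summable w := by
    refine summable_of_sum_range_le (c := ∑' n : ℕ, 2 / (n : ℝ) ^ 2) (fun j => ?_) fun J => ?_
    · simp only [w]
      rw [expSum_sub (by push_cast; linarith)]
      positivity
    · simp only [w]
      rw [Finset.sum_range_sub (fun j : ℕ => expSum (fun n => 2 / (n : ℝ) ^ 2) (j : ℝ))]
      have h1 : expSum (fun n => 2 / (n : ℝ) ^ 2) (J : ℝ) ≤ ∑' n : ℕ, 2 / (n : ℝ) ^ 2 :=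
        summable_two_div_sq.sum_le_tsum _ fun _ _ => by positivity
      have h2 : 0 ≤ expSum (fun n => 2 / (n : ℝ) ^ 2) ((0 : ℕ) : ℝ) :=
        Finset.sum_nonneg fun _ _ => by positivity
      linarith
  have hL : ∀ j, L j ≤ 1 + 2 * C := fun j => by
    have h1 := abs_le.mp (hE (j + 1))
    have h2 := abs_le.mp (hE j)
    simp only [L]
    push_cast at h1 ⊢
    linarith [h1.2, h2.1]
  have hu : Summable fun j => c j - L j / (j + 1) := by
    rw [← summable_nat_add_iff 1]
    have hs : Summable fun j : ℕ => (1 + 2 * C) * (1 / ((j + 1 : ℕ) : ℝ) ^ 2) + w (j + 1) := by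
      refine Summable.add (Summable.mul_left _ ?_) ((summable_nat_add_iff 1).mpr hw)
      exact (summable_nat_add_iff 1).mpr ((Real.summable_one_div_nat_pow (p := 2)).mpr (by norm_num))
    refine Summable.of_nonneg_of_le (fun j => hlow _) (fun j => ?_) hs
    have h1 := hup (j + 1) (by omega)
    have hj0 : (0 : ℝ) < ((j + 1 : ℕ) : ℝ) := by positivity
    generalize ((j + 1 : ℕ) : ℝ) = x at *
    have h2 : L (j + 1) / x - L (j + 1) / (x + 1) ≤ (1 + 2 * C) * (1 / x ^ 2) := by
      calc _ = L (j + 1) * (1 / (x * (x + 1))) := by field_simp; ring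
        _ ≤ (1 + 2 * C) * (1 / (x * (x + 1))) :=
          mul_le_mul_of_nonneg_right (hL _) (by positivity)
        _ ≤ _ := by
          refine mul_le_mul_of_nonneg_left (one_div_le_one_div_of_le (by positivity) ?_)
            (by positivity)
          nlinarith
    linarith
  have hv : CauchySeq fun K => ∑ j ∈ Finset.range K, (1 / ((j : ℝ) + 1)) • (L j - 1) := by
    refine Antitone.cauchySeq_series_mul_of_tendsto_zero_of_bounded (b := 2 * C) ?_
      tendsto_one_div_add_atTop_nhds_zero_nat fun K => ?_
    · intro a b hab
      have : (a : ℝ) ≤ b := by exact_mod_cast hab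
      simp only
      gcongr
    · have h1 : ∀ j : ℕ, L j - 1 = (expSum logPrimeDiv ((j + 1 : ℕ) : ℝ) - ((j + 1 : ℕ) : ℝ)) -
          (expSum logPrimeDiv (j : ℝ) - j) := fun j => by
        simp only [L]; push_cast; ring
      simp only [h1]
      rw [Finset.sum_range_sub (fun j : ℕ => expSum logPrimeDiv (j : ℝ) - (j : ℝ))]
      refine (norm_sub_le _ _).trans ?_
      have h1 := hE K
      have h2 := hE 0
      rw [Real.norm_eq_abs, Real.norm_eq_abs]
      linarith
  obtain ⟨l, hl⟩ := cauchySeq_tendsto_of_complete hv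
  refine ⟨_, (hu.hasSum.tendsto_sum_nat.add hl).congr fun K => ?_⟩
  rw [← Finset.sum_add_distrib]
  refine Finset.sum_congr rfl fun j _ => ?_
  simp only [c, smul_eq_mul]
  field_simp
  ring

end MertensThird

section MertensThirdLower

lemma negLog_one_sub_rpow_le {n : ℕ} (hn : n.Prime) {δ : ℝ} (hδ : 0 ≤ δ) :
    -Real.log (1 - (n : ℝ) ^ (-(1 + δ))) ≤ negLogOneSubInv n * (n : ℝ) ^ (-δ) := by
  have h2 : (2 : ℝ) ≤ n := by exact_mod_cast hn.two_le
  have h0 : (0 : ℝ) < n := by linarith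
  have h3 : 0 < 1 - 1 / (n : ℝ) := by
    rw [sub_pos, div_lt_one (by linarith)]; linarith
  have ht0 : 0 ≤ (n : ℝ) ^ (-δ) := by positivity
  have ht1 : (n : ℝ) ^ (-δ) ≤ 1 :=
    Real.rpow_le_one_of_one_le_of_nonpos (by linarith) (by linarith)
  have h4 : (n : ℝ) ^ (-(1 + δ)) = (n : ℝ) ^ (-δ) * (1 / n) := by
    rw [show -(1 + δ) = -δ - 1 by ring, Real.rpow_sub h0, Real.rpow_one]; ring
  rw [h4, negLogOneSubInv, if_pos hn]
  have h5 := rpow_one_add_le_one_add_mul_self (s := -(1 / (n : ℝ))) (by linarith) ht0 ht1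
  rw [← sub_eq_add_neg] at h5
  have h6 := Real.log_le_log (Real.rpow_pos_of_pos h3 _) h5
  rw [Real.log_rpow h3] at h6
  have h7 : 1 + (n : ℝ) ^ (-δ) * -(1 / (n : ℝ)) = 1 - (n : ℝ) ^ (-δ) * (1 / n) := by ring
  rw [h7] at h6
  linarith

lemma expSum_mul_rpow_le {δ : ℝ} (hδ : 0 ≤ δ) (K : ℕ) :
    ∑ n ∈ Finset.Ioc 0 ⌊Real.exp K⌋₊, negLogOneSubInv n * (n : ℝ) ^ (-δ) ≤
      ∑ j ∈ Finset.range K, (expSum negLogOneSubInv ((j + 1 : ℕ) : ℝ) -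
        expSum negLogOneSubInv (j : ℝ)) * Real.exp (-δ) ^ j := by
  induction K with
  | zero => simp [negLogOneSubInv, Nat.not_prime_one]
  | succ K ih =>
    have hK : (K : ℝ) ≤ ((K + 1 : ℕ) : ℝ) := by push_cast; linarith
    rw [Finset.sum_range_succ, ← Finset.sum_Ioc_consecutive _ (Nat.zero_le _)
      (Nat.floor_mono (Real.exp_le_exp.mpr hK))]
    refine add_le_add ih ?_
    rw [expSum_sub hK, Finset.sum_mul]
    refine Finset.sum_le_sum fun n hn => ?_
    obtain ⟨h0, h1, -⟩ := mem_Ioc_floor_exp.mp hn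
    refine mul_le_mul_of_nonneg_left ?_ (negLogOneSubInv_nonneg n)
    rw [Real.rpow_def_of_pos (by positivity), ← Real.exp_nat_mul]
    refine Real.exp_le_exp.mpr ?_
    nlinarith

lemma log_norm_riemannZeta_le {δ : ℝ} (hδ : 0 < δ) (hs : Summable fun j : ℕ =>
      (expSum negLogOneSubInv ((j + 1 : ℕ) : ℝ) - expSum negLogOneSubInv (j : ℝ)) *
        Real.exp (-δ) ^ j) :
    Real.log ‖riemannZeta ((1 + δ : ℝ) : ℂ)‖ ≤ ∑' j : ℕ,
      (expSum negLogOneSubInv ((j + 1 : ℕ) : ℝ) - expSum negLogOneSubInv (j : ℝ)) *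
        Real.exp (-δ) ^ j := by
  have hre : 1 < ((1 + δ : ℝ) : ℂ).re := by rw [Complex.ofReal_re]; linarith
  have hz : 0 < ‖riemannZeta ((1 + δ : ℝ) : ℂ)‖ :=
    norm_pos_iff.mpr (riemannZeta_ne_zero_of_one_le_re hre.le)
  rw [Real.log_le_iff_le_exp hz]
  refine le_of_tendsto (riemannZeta_eulerProduct hre).norm (Filter.Eventually.of_forall fun n => ?_)
  have hnn : ∀ j : ℕ, 0 ≤ (expSum negLogOneSubInv ((j + 1 : ℕ) : ℝ) -
      expSum negLogOneSubInv (j : ℝ)) * Real.exp (-δ) ^ j := fun j => by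
    rw [expSum_sub (by push_cast; linarith)]
    exact mul_nonneg (Finset.sum_nonneg fun n _ => negLogOneSubInv_nonneg n) (by positivity)
  have h1 : ‖∏ p ∈ n.primesBelow, (1 - (p : ℂ) ^ (-((1 + δ : ℝ) : ℂ)))⁻¹‖ =
      Real.exp (∑ p ∈ n.primesBelow, -Real.log (1 - (p : ℝ) ^ (-(1 + δ)))) := by
    rw [norm_prod, Real.exp_sum]
    refine Finset.prod_congr rfl fun p hp => ?_
    have hp' := Nat.prime_of_mem_primesBelow hp
    have h2 : (1 : ℝ) < p := by exact_mod_cast hp'.one_lt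
    have h3 : 0 < 1 - (p : ℝ) ^ (-(1 + δ)) := by
      rw [sub_pos]; exact Real.rpow_lt_one_of_one_lt_of_neg h2 (by linarith)
    rw [Real.exp_neg, Real.exp_log h3, norm_inv]
    congr 1
    rw [← Real.norm_of_nonneg h3.le, ← Complex.norm_real]
    congr 1
    push_cast [Complex.ofReal_cpow (show (0 : ℝ) ≤ p by linarith)]
    rfl
  rw [h1]
  refine Real.exp_le_exp.mpr ?_
  calc _ ≤ ∑ p ∈ n.primesBelow, negLogOneSubInv p * (p : ℝ) ^ (-δ) :=
        Finset.sum_le_sum fun p hp => negLog_one_sub_rpow_le (Nat.prime_of_mem_primesBelow hp) hδ.le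
    _ ≤ ∑ p ∈ Finset.Ioc 0 ⌊Real.exp n⌋₊, negLogOneSubInv p * (p : ℝ) ^ (-δ) := by
        refine Finset.sum_le_sum_of_subset_of_nonneg (fun p hp => ?_) fun p _ _ =>
          mul_nonneg (negLogOneSubInv_nonneg p) (by positivity)
        rw [mem_Ioc_zero_floor_exp]
        have hp0 := (Nat.prime_of_mem_primesBelow hp).pos
        refine ⟨hp0.ne', ?_⟩
        have h2 := Real.log_le_sub_one_of_pos (x := p) (by exact_mod_cast hp0)
        have h3 : (p : ℝ) ≤ n := by exact_mod_cast (Nat.lt_of_mem_primesBelow hp).le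
        linarith
    _ ≤ _ := expSum_mul_rpow_le hδ.le n
    _ ≤ _ := hs.sum_le_tsum _ fun j _ => hnn j

lemma tendsto_log_norm_riemannZeta_add_log :
    Filter.Tendsto (fun δ : ℝ => Real.log ‖riemannZeta ((1 + δ : ℝ) : ℂ)‖ + Real.log δ)
      (nhdsWithin 0 (Set.Ioi 0)) (nhds 0) := by
  have h1 : Filter.Tendsto (fun δ : ℝ => ((1 + δ : ℝ) : ℂ)) (nhdsWithin 0 (Set.Ioi 0))
      (nhdsWithin 1 {1}ᶜ) := by
    refine tendsto_nhdsWithin_iff.mpr ⟨?_, ?_⟩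
    · have : Continuous fun δ : ℝ => ((1 + δ : ℝ) : ℂ) := by fun_prop
      simpa using (this.tendsto 0).mono_left nhdsWithin_le_nhds
    · filter_upwards [self_mem_nhdsWithin] with δ hδ
      have : δ ≠ 0 := ne_of_gt hδ
      simpa using this
  have h2 := (riemannZeta_residue_one.comp h1).norm
  have h3 := (Real.continuousAt_log (x := ‖(1 : ℂ)‖) (by simp)).tendsto.comp h2
  rw [norm_one, Real.log_one] at h3
  refine h3.congr' ?_
  filter_upwards [self_mem_nhdsWithin] with δ hδ
  have hδ' : 0 < δ := hδ
  have hz : 0 < ‖riemannZeta ((1 + δ : ℝ) : ℂ)‖ :=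
    norm_pos_iff.mpr (riemannZeta_ne_zero_of_one_le_re (by rw [Complex.ofReal_re]; linarith))
  simp only [Function.comp]
  rw [norm_mul, Real.log_mul _ hz.ne', add_comm]
  · congr 2
    rw [Complex.ofReal_add, Complex.ofReal_one, add_sub_cancel_left, Complex.norm_real,
      Real.norm_of_nonneg hδ'.le]
  · rw [Complex.ofReal_add, Complex.ofReal_one, add_sub_cancel_left, Complex.norm_real]
    exact (norm_pos_iff.mpr hδ'.ne').ne'

lemma tendsto_log_one_sub_exp_neg_div_sub :
    Filter.Tendsto (fun δ : ℝ => Real.log (1 - Real.exp (-δ)) / Real.exp (-δ) - Real.log δ)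
      (nhdsWithin 0 (Set.Ioi 0)) (nhds 0) := by
  have hx : Filter.Tendsto (fun δ : ℝ => 1 - Real.exp (-δ)) (nhdsWithin 0 (Set.Ioi 0))
      (nhdsWithin 0 (Set.Ioi 0)) := by
    refine tendsto_nhdsWithin_iff.mpr ⟨?_, ?_⟩
    · have : Continuous fun δ : ℝ => 1 - Real.exp (-δ) := by fun_prop
      simpa using (this.tendsto 0).mono_left nhdsWithin_le_nhds
    · filter_upwards [self_mem_nhdsWithin] with δ hδ
      have hδ' : 0 < δ := hδ
      have : Real.exp (-δ) < 1 := Real.exp_lt_one_iff.mpr (by linarith)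
      simpa using hδ'
  have h1 : Filter.Tendsto (fun δ : ℝ => Real.log ((1 - Real.exp (-δ)) / δ))
      (nhdsWithin 0 (Set.Ioi 0)) (nhds 0) := by
    have hd : HasDerivAt (fun δ : ℝ => 1 - Real.exp (-δ)) 1 0 := by
      have := ((hasDerivAt_neg (0 : ℝ)).exp).const_sub 1
      simpa using this
    have h2 := hd.tendsto_slope_zero_right
    have h3 := (Real.continuousAt_log (x := 1) (by simp)).tendsto.comp h2
    rw [Real.log_one] at h3
    refine h3.congr fun δ => ?_
    simp [div_eq_inv_mul]
  have h2 : Filter.Tendsto (fun δ : ℝ => Real.log (1 - Real.exp (-δ)) * (1 - Real.exp (-δ)) /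
      Real.exp (-δ)) (nhdsWithin 0 (Set.Ioi 0)) (nhds 0) := by
    have h3 := (tendsto_log_mul_rpow_nhdsGT_zero (r := 1) (by norm_num)).comp hx
    have h4 : Filter.Tendsto (fun δ : ℝ => Real.exp (-δ)) (nhdsWithin 0 (Set.Ioi 0)) (nhds 1) := by
      have : Continuous fun δ : ℝ => Real.exp (-δ) := by fun_prop
      simpa using (this.tendsto 0).mono_left nhdsWithin_le_nhds
    have h5 := h3.div h4 one_ne_zero
    rw [zero_div] at h5
    refine h5.congr fun δ => ?_
    simp [Real.rpow_one]
  have h3 := h1.add h2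
  rw [add_zero] at h3
  refine h3.congr' ?_
  filter_upwards [self_mem_nhdsWithin] with δ hδ
  have hδ' : 0 < δ := hδ
  have : Real.exp (-δ) < 1 := Real.exp_lt_one_iff.mpr (by linarith)
  rw [Real.log_div (by linarith) hδ'.ne']
  have := Real.exp_pos (-δ)
  field_simp
  ring

lemma nonneg_of_tendsto_expSum_negLogOneSubInv {l : ℝ}
    (hl : Filter.Tendsto (fun K : ℕ => ∑ j ∈ Finset.range K,
      (expSum negLogOneSubInv ((j + 1 : ℕ) : ℝ) - expSum negLogOneSubInv (j : ℝ) - 1 / (j + 1)))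
      Filter.atTop (nhds l)) : 0 ≤ l := by
  have hx : Filter.Tendsto (fun δ : ℝ => Real.exp (-δ)) (nhdsWithin 0 (Set.Ioi 0))
      (nhdsWithin 1 (Set.Iio 1)) := by
    refine tendsto_nhdsWithin_iff.mpr ⟨?_, ?_⟩
    · have : Continuous fun δ : ℝ => Real.exp (-δ) := by fun_prop
      simpa using (this.tendsto 0).mono_left nhdsWithin_le_nhds
    · filter_upwards [self_mem_nhdsWithin] with δ hδ
      exact Real.exp_lt_one_iff.mpr (by simpa using hδ)
  have h1 := (Real.tendsto_tsum_powerSeries_nhdsWithin_lt hl).comp hx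
  have h2 := tendsto_log_norm_riemannZeta_add_log.add tendsto_log_one_sub_exp_neg_div_sub
  rw [add_zero] at h2
  refine le_of_tendsto_of_tendsto h2 h1 ?_
  filter_upwards [self_mem_nhdsWithin] with δ hδ
  have hδ' : 0 < δ := hδ
  have hx1 : Real.exp (-δ) < 1 := Real.exp_lt_one_iff.mpr (by linarith)
  have hx0 := Real.exp_pos (-δ)
  have hs1 : HasSum (fun j : ℕ => 1 / ((j : ℝ) + 1) * Real.exp (-δ) ^ j)
      (-Real.log (1 - Real.exp (-δ)) / Real.exp (-δ)) := by
    have := (Real.hasSum_pow_div_log_of_abs_lt_one (x := Real.exp (-δ))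
      (by rwa [abs_of_pos hx0])).div_const (Real.exp (-δ))
    refine this.congr_fun ?_ |> fun h => h
    intro j
    rw [pow_succ]
    field_simp
  have hs2 : Summable fun j : ℕ => (expSum negLogOneSubInv ((j + 1 : ℕ) : ℝ) -
      expSum negLogOneSubInv (j : ℝ) - 1 / (j + 1)) * Real.exp (-δ) ^ j := by
    have hb : Filter.Tendsto (fun j : ℕ => expSum negLogOneSubInv ((j + 1 : ℕ) : ℝ) -
      expSum negLogOneSubInv (j : ℝ) - 1 / (j + 1)) Filter.atTop (nhds 0) := by
      have := ((Filter.tendsto_add_atTop_iff_nat 1).mpr hl).sub hl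
      rw [sub_self] at this
      refine this.congr fun j => ?_
      rw [Finset.sum_range_succ]
      ring
    obtain ⟨B, hB⟩ := hb.norm.bddAbove_range
    refine Summable.of_norm_bounded ((summable_geometric_of_lt_one hx0.le hx1).mul_left B)
      fun j => ?_
    rw [norm_mul, norm_pow, Real.norm_of_nonneg hx0.le]
    gcongr
    exact hB ⟨j, rfl⟩
  have h3 : (fun j : ℕ => (expSum negLogOneSubInv ((j + 1 : ℕ) : ℝ) -
      expSum negLogOneSubInv (j : ℝ)) * Real.exp (-δ) ^ j) = fun j : ℕ =>
      (expSum negLogOneSubInv ((j + 1 : ℕ) : ℝ) -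
        expSum negLogOneSubInv (j : ℝ) - 1 / (j + 1)) * Real.exp (-δ) ^ j +
      1 / ((j : ℝ) + 1) * Real.exp (-δ) ^ j := by
    funext j; ring
  have hs3 := hs2.add hs1.summable
  rw [← h3] at hs3
  have h4 := log_norm_riemannZeta_le hδ' hs3
  rw [h3, hs2.tsum_add hs1.summable, hs1.tsum_eq] at h4
  simp only [Function.comp]
  rw [neg_div] at h4
  linarith

/-- The lower bound in **Mertens' third theorem**. -/
lemma eventually_log_add_le_expSum_negLogOneSubInv {ε : ℝ} (hε : 0 < ε) :
    ∀ᶠ Y : ℝ in Filter.atTop,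
      Real.log Y + Real.eulerMascheroniConstant - ε ≤ expSum negLogOneSubInv Y := by
  obtain ⟨l, hl⟩ := exists_tendsto_expSum_negLogOneSubInv
  have hl0 := nonneg_of_tendsto_expSum_negLogOneSubInv hl
  have h1 : Filter.Tendsto (fun K : ℕ => expSum negLogOneSubInv (K : ℝ) - Real.log K)
      Filter.atTop (nhds (l + Real.eulerMascheroniConstant)) := by
    refine (hl.add Real.tendsto_harmonic_sub_log).congr fun K => ?_
    rw [Finset.sum_sub_distrib,
      Finset.sum_range_sub (fun j : ℕ => expSum negLogOneSubInv (j : ℝ))]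
    have h2 : expSum negLogOneSubInv ((0 : ℕ) : ℝ) = 0 := by
      simp [expSum, negLogOneSubInv, Nat.not_prime_one]
    rw [h2, harmonic]
    push_cast
    simp only [one_div]
    ring
  have h2 := h1.comp tendsto_nat_floor_atTop (α := ℝ)
  have h3 : Filter.Tendsto (fun Y : ℝ => Real.log ((⌊Y⌋₊ : ℝ) / Y)) Filter.atTop (nhds 0) := by
    have := (Real.continuousAt_log (x := 1) (by simp)).tendsto.comp
      (tendsto_nat_floor_div_atTop (R := ℝ))
    rwa [Real.log_one] at this
  have h4 := h2.add h3
  filter_upwards [h4.eventually_const_lt (show Real.eulerMascheroniConstant - ε <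
    l + Real.eulerMascheroniConstant + 0 by linarith), Filter.eventually_ge_atTop 1] with Y hY hY1
  have h5 : (0 : ℝ) < ⌊Y⌋₊ := by exact_mod_cast Nat.floor_pos.mpr hY1
  simp only [Function.comp] at hY
  rw [Real.log_div h5.ne' (by linarith)] at hY
  have h6 : expSum negLogOneSubInv (⌊Y⌋₊ : ℝ) ≤ expSum negLogOneSubInv Y := by
    rw [← sub_nonneg, expSum_sub (Nat.floor_le (by linarith))]
    exact Finset.sum_nonneg fun n _ => negLogOneSubInv_nonneg n
  linarith

end MertensThirdLower

section MertensThirdCoprime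

lemma sum_neg_log_one_sub_inv_sq_le (n : ℕ) :
    ∑ p ∈ n.primesBelow, -Real.log (1 - 1 / (p : ℝ) ^ 2) ≤ Real.log (Real.pi ^ 2 / 6) := by
  have h0 := (riemannZeta_eulerProduct (s := 2) (by norm_num)).norm
  rw [riemannZeta_two] at h0
  have hpos : ∀ p : ℕ, p.Prime → 0 < 1 - 1 / (p : ℝ) ^ 2 := fun p hp => by
    have h2 : (2 : ℝ) ≤ p := by exact_mod_cast hp.two_le
    rw [sub_pos, div_lt_one (by positivity)]
    nlinarith
  have h1 : ∀ n : ℕ, ‖∏ p ∈ n.primesBelow, (1 - (p : ℂ) ^ (-2 : ℂ))⁻¹‖ =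
      Real.exp (∑ p ∈ n.primesBelow, -Real.log (1 - 1 / (p : ℝ) ^ 2)) := fun n => by
    rw [norm_prod, Real.exp_sum]
    refine Finset.prod_congr rfl fun p hp => ?_
    have h3 := hpos p (Nat.prime_of_mem_primesBelow hp)
    rw [Real.exp_neg, Real.exp_log h3, norm_inv]
    congr 1
    rw [← Real.norm_of_nonneg h3.le, ← Complex.norm_real]
    congr 1
    push_cast
    rw [Complex.cpow_neg, one_div]
    norm_cast
  simp only [h1] at h0
  have h2 : ‖(Real.pi : ℂ) ^ 2 / 6‖ = Real.pi ^ 2 / 6 := by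
    rw [norm_div, norm_pow, Complex.norm_real, Real.norm_of_nonneg Real.pi_pos.le]
    norm_num
  rw [h2] at h0
  rw [Real.le_log_iff_exp_le (by positivity)]
  refine Monotone.ge_of_tendsto (fun a b hab => Real.exp_le_exp.mpr ?_) h0 n
  refine Finset.sum_le_sum_of_subset_of_nonneg (fun p hp => ?_) fun p hp _ => ?_
  · rw [Nat.mem_primesBelow] at hp ⊢
    exact ⟨by omega, hp.2⟩
  · rw [neg_nonneg]
    have := hpos p (Nat.prime_of_mem_primesBelow hp)
    have h3 : 0 ≤ 1 / (p : ℝ) ^ 2 := by positivity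
    exact Real.log_nonpos this.le (by linarith)

lemma expSum_negLogOneSubInv_le (Y : ℝ) : expSum negLogOneSubInv Y ≤
    ∑ p ∈ (Finset.Ioc 0 ⌊Real.exp Y⌋₊).filter Nat.Prime, Real.log (1 + 1 / p) +
      Real.log (Real.pi ^ 2 / 6) := by
  have hs : (Finset.Ioc 0 ⌊Real.exp Y⌋₊).filter Nat.Prime =
      (⌊Real.exp Y⌋₊ + 1).primesBelow := by
    ext p
    rw [Finset.mem_filter, Finset.mem_Ioc, Nat.mem_primesBelow]
    refine ⟨fun h => ⟨by omega, h.2⟩, fun h => ⟨⟨h.2.pos, by omega⟩, h.2⟩⟩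
  have h1 := sum_neg_log_one_sub_inv_sq_le (⌊Real.exp Y⌋₊ + 1)
  have h2 : expSum negLogOneSubInv Y =
      ∑ p ∈ (Finset.Ioc 0 ⌊Real.exp Y⌋₊).filter Nat.Prime, -Real.log (1 - 1 / p) := by
    rw [expSum, Finset.sum_filter]
    rfl
  have h3 : ∀ p ∈ (⌊Real.exp Y⌋₊ + 1).primesBelow, -Real.log (1 - 1 / (p : ℝ)) =
      Real.log (1 + 1 / p) + -Real.log (1 - 1 / (p : ℝ) ^ 2) := fun p hp => by
    have h2 : (2 : ℝ) ≤ p := by exact_mod_cast (Nat.prime_of_mem_primesBelow hp).two_le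
    have h4 : 0 < 1 - 1 / (p : ℝ) := by
      rw [sub_pos, div_lt_one (by positivity)]; linarith
    have h5 : 0 < 1 + 1 / (p : ℝ) := by positivity
    rw [show 1 - 1 / (p : ℝ) ^ 2 = (1 - 1 / (p : ℝ)) * (1 + 1 / p) by ring,
      Real.log_mul h4.ne' h5.ne']
    ring
  rw [h2, hs, Finset.sum_congr rfl h3, Finset.sum_add_distrib]
  linarith

/-- Lower bound for the logarithm of the product of `1 + 1 / p` over primes `p ≤ exp Y` not
dividing `q`. -/
lemma eventually_le_sum_log_one_add_inv {q : ℕ} (hq : q ≠ 0) {ε : ℝ} (hε : 0 < ε) :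
    ∀ᶠ Y : ℝ in Filter.atTop,
      Real.log Y - Real.log ((Real.pi ^ 2 * Real.exp (-Real.eulerMascheroniConstant) / 6) *
        ∏ p ∈ q.primeFactors, ((p : ℝ) + 1) / p) - ε ≤
      ∑ p ∈ (Finset.Ioc 0 ⌊Real.exp Y⌋₊).filter (fun p => p.Prime ∧ ¬ p ∣ q),
        Real.log (1 + 1 / p) := by
  filter_upwards [eventually_log_add_le_expSum_negLogOneSubInv hε] with Y hY
  have h1 := expSum_negLogOneSubInv_le Y
  have hprod : 0 < ∏ p ∈ q.primeFactors, ((p : ℝ) + 1) / p :=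
    Finset.prod_pos fun p hp => by
      have : (0 : ℝ) < p := by exact_mod_cast (Nat.prime_of_mem_primeFactors hp).pos
      positivity
  have h2 : Real.log ((Real.pi ^ 2 * Real.exp (-Real.eulerMascheroniConstant) / 6) *
        ∏ p ∈ q.primeFactors, ((p : ℝ) + 1) / p) = Real.log (Real.pi ^ 2 / 6) -
        Real.eulerMascheroniConstant + ∑ p ∈ q.primeFactors, Real.log (1 + 1 / p) := by
    rw [Real.log_mul (by positivity) hprod.ne', Real.log_prod (fun p hp => by
      have : (0 : ℝ) < p := by exact_mod_cast (Nat.prime_of_mem_primeFactors hp).pos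
      positivity), show Real.pi ^ 2 * Real.exp (-Real.eulerMascheroniConstant) / 6 =
      Real.pi ^ 2 / 6 * Real.exp (-Real.eulerMascheroniConstant) by ring,
      Real.log_mul (by positivity) (by positivity), Real.log_exp]
    congr 1
    refine Finset.sum_congr rfl fun p hp => ?_
    have : (0 : ℝ) < p := by exact_mod_cast (Nat.prime_of_mem_primeFactors hp).pos
    congr 1
    field_simp
  have h3 : ∑ p ∈ (Finset.Ioc 0 ⌊Real.exp Y⌋₊).filter Nat.Prime, Real.log (1 + 1 / (p : ℝ)) ≤
      ∑ p ∈ (Finset.Ioc 0 ⌊Real.exp Y⌋₊).filter (fun p => p.Prime ∧ ¬ p ∣ q),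
        Real.log (1 + 1 / (p : ℝ)) + ∑ p ∈ q.primeFactors, Real.log (1 + 1 / (p : ℝ)) := by
    rw [← Finset.sum_filter_add_sum_filter_not ((Finset.Ioc 0 ⌊Real.exp Y⌋₊).filter Nat.Prime)
      (fun p => ¬ p ∣ q), Finset.filter_filter]
    refine add_le_add le_rfl (Finset.sum_le_sum_of_subset_of_nonneg (fun p hp => ?_)
      fun p _ _ => Real.log_nonneg ?_)
    · simp only [Finset.mem_filter, not_not] at hp
      exact Nat.mem_primeFactors.mpr ⟨hp.1.2, hp.2, hq⟩
    · have : 0 ≤ 1 / (p : ℝ) := by positivity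
      linarith
  linarith

end MertensThirdCoprime

section MeanValue

/-- The function `t ↦ n ^ (-it)`. -/
noncomputable def twist (t : ℝ) (n : ℕ) : ℂ := (n : ℂ) ^ (-((t : ℂ) * Complex.I))

lemma twist_mul (t : ℝ) (m n : ℕ) : twist t (m * n) = twist t m * twist t n := by
  rw [twist, Nat.cast_mul, Complex.natCast_mul_natCast_cpow]
  rfl

lemma twist_one (t : ℝ) : twist t 1 = 1 := by simp [twist]

lemma twist_eq_exp (t : ℝ) {n : ℕ} (hn : n ≠ 0) :
    twist t n = Complex.exp (-(Real.log n * t : ℝ) * Complex.I) := by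
  rw [twist, Complex.cpow_def_of_ne_zero (by exact_mod_cast hn), ← Complex.natCast_log]
  congr 1
  push_cast
  ring

lemma norm_twist (t : ℝ) {n : ℕ} (hn : n ≠ 0) : ‖twist t n‖ = 1 := by
  rw [twist_eq_exp t hn, ← Complex.ofReal_neg, Complex.norm_exp_ofReal_mul_I]

lemma continuous_twist {n : ℕ} (hn : n ≠ 0) : Continuous fun t => twist t n := by
  simp only [twist_eq_exp _ hn]
  fun_prop

lemma one_div_le_abs_log_sub_log {M m n : ℕ} (hm : m ≠ 0) (hn : n ≠ 0) (hmM : m ≤ M) (hnM : n ≤ M)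
    (hmn : m ≠ n) : 1 / (M : ℝ) ≤ |Real.log m - Real.log n| := by
  wlog h : n < m generalizing m n
  · rw [abs_sub_comm]
    exact this hn hm hnM hmM hmn.symm (by omega)
  have hm0 : (0 : ℝ) < m := by positivity
  have hn0 : (0 : ℝ) < n := by positivity
  refine le_trans ?_ (le_abs_self _)
  rw [← Real.log_div hm0.ne' hn0.ne']
  refine le_trans ?_ (Real.one_sub_inv_le_log_of_pos (div_pos hm0 hn0))
  rw [inv_div]
  have h1 : (n : ℝ) + 1 ≤ m := by exact_mod_cast h
  have h2 : (m : ℝ) ≤ M := by exact_mod_cast hmM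
  calc 1 / (M : ℝ) ≤ 1 / m := one_div_le_one_div_of_le hm0 h2
    _ ≤ (m - n) / m := by gcongr; linarith
    _ = _ := by field_simp

lemma norm_integral_twist_mul_conj_le {M m n : ℕ} (hm : m ≠ 0) (hn : n ≠ 0) (hmM : m ≤ M)
    (hnM : n ≤ M) (hmn : m ≠ n) (a b : ℝ) :
    ‖∫ t in a..b, twist t m * (starRingEnd ℂ) (twist t n)‖ ≤ 2 * M := by
  have hne : ((Real.log n - Real.log m : ℝ) : ℂ) * Complex.I ≠ 0 := by
    refine mul_ne_zero (Complex.ofReal_ne_zero.mpr fun h => ?_) Complex.I_ne_zero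
    have := one_div_le_abs_log_sub_log hn hm hnM hmM hmn.symm
    rw [h, abs_zero] at this
    have hM : (0 : ℝ) < M := by exact_mod_cast (Nat.pos_of_ne_zero hm).trans_le hmM
    exact absurd this (not_le.mpr (by positivity))
  have h1 : ∀ t : ℝ, twist t m * (starRingEnd ℂ) (twist t n) =
      Complex.exp (((Real.log n - Real.log m : ℝ) : ℂ) * Complex.I * t) := fun t => by
    rw [twist_eq_exp t hm, twist_eq_exp t hn, ← Complex.exp_conj, ← Complex.exp_add]
    congr 1
    simp only [map_mul, map_neg, Complex.conj_ofReal, Complex.conj_I]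
    push_cast
    ring
  simp only [h1]
  rw [integral_exp_mul_complex hne, norm_div, norm_mul, Complex.norm_I, mul_one, Complex.norm_real,
    Real.norm_eq_abs]
  have h2 := one_div_le_abs_log_sub_log hn hm hnM hmM hmn.symm
  have hM : (0 : ℝ) < M := by exact_mod_cast (Nat.pos_of_ne_zero hm).trans_le hmM
  have h3 : ∀ x : ℝ, ‖Complex.exp (((Real.log n - Real.log m : ℝ) : ℂ) * Complex.I * x)‖ = 1 :=
    fun x => by
      rw [mul_right_comm, ← Complex.ofReal_mul, Complex.norm_exp_ofReal_mul_I]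
  have h4 : ‖Complex.exp (((Real.log n - Real.log m : ℝ) : ℂ) * Complex.I * b) -
      Complex.exp (((Real.log n - Real.log m : ℝ) : ℂ) * Complex.I * a)‖ ≤ 2 := by
    refine (norm_sub_le _ _).trans ?_
    rw [h3, h3]
    norm_num
  calc _ ≤ 2 / (1 / (M : ℝ)) := by gcongr
    _ = _ := by field_simp

/-- A mean value theorem for Dirichlet polynomials. -/
lemma abs_integral_norm_sq_sub_le {ι : Type*} (s : Finset ι) (a : ι → ℂ) (ν : ι → ℕ) {M : ℕ}
    (hν0 : ∀ i ∈ s, ν i ≠ 0) (hνM : ∀ i ∈ s, ν i ≤ M) (hinj : Set.InjOn ν s) (T : ℝ) :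
    |(∫ t in T..(2 * T), ‖∑ i ∈ s, a i * twist t (ν i)‖ ^ 2) - T * ∑ i ∈ s, ‖a i‖ ^ 2| ≤
      2 * M * (∑ i ∈ s, ‖a i‖) ^ 2 := by
  classical
  have hint : ∀ i ∈ s, ∀ j ∈ s, IntervalIntegrable (fun t => a i * (starRingEnd ℂ) (a j) *
      (twist t (ν i) * (starRingEnd ℂ) (twist t (ν j)))) MeasureTheory.volume T (2 * T) :=
    fun i hi j hj => by
      refine Continuous.intervalIntegrable ?_ _ _
      exact continuous_const.mul ((continuous_twist (hν0 i hi)).mul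
        (Complex.continuous_conj.comp (continuous_twist (hν0 j hj))))
  have h1 : ∀ t : ℝ, ((‖∑ i ∈ s, a i * twist t (ν i)‖ ^ 2 : ℝ) : ℂ) =
      ∑ i ∈ s, ∑ j ∈ s, a i * (starRingEnd ℂ) (a j) *
        (twist t (ν i) * (starRingEnd ℂ) (twist t (ν j))) := fun t => by
    push_cast
    rw [← Complex.mul_conj', map_sum, Finset.sum_mul_sum]
    refine Finset.sum_congr rfl fun i _ => Finset.sum_congr rfl fun j _ => ?_
    rw [map_mul]
    ring
  have h2 : ((∫ t in T..(2 * T), ‖∑ i ∈ s, a i * twist t (ν i)‖ ^ 2 : ℝ) : ℂ) =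
      ∑ i ∈ s, ∑ j ∈ s, a i * (starRingEnd ℂ) (a j) *
        ∫ t in T..(2 * T), twist t (ν i) * (starRingEnd ℂ) (twist t (ν j)) := by
    rw [← intervalIntegral.integral_ofReal]
    simp only [h1]
    rw [intervalIntegral.integral_finsetSum fun i hi => by
      have := IntervalIntegrable.sum s fun j hj => hint i hi j hj
      simpa only [Finset.sum_fn] using this]
    refine Finset.sum_congr rfl fun i hi => ?_
    rw [intervalIntegral.integral_finsetSum fun j hj => hint i hi j hj]
    refine Finset.sum_congr rfl fun j _ => ?_
    rw [intervalIntegral.integral_const_mul]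
  have h3 : ((T * ∑ i ∈ s, ‖a i‖ ^ 2 : ℝ) : ℂ) =
      ∑ i ∈ s, ∑ j ∈ s, a i * (starRingEnd ℂ) (a j) * (if i = j then (T : ℂ) else 0) := by
    push_cast
    rw [Finset.mul_sum]
    refine Finset.sum_congr rfl fun i hi => ?_
    simp only [mul_ite, mul_zero]
    rw [Finset.sum_ite_eq, if_pos hi, Complex.mul_conj']
    ring
  rw [← Real.norm_eq_abs, ← Complex.norm_real, Complex.ofReal_sub, h2, h3,
    ← Finset.sum_sub_distrib]
  simp only [← Finset.sum_sub_distrib, ← mul_sub]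
  have h4 : 2 * M * (∑ i ∈ s, ‖a i‖) ^ 2 = ∑ i ∈ s, ∑ j ∈ s, ‖a i‖ * ‖a j‖ * (2 * M) := by
    rw [sq, Finset.sum_mul_sum, Finset.mul_sum]
    refine Finset.sum_congr rfl fun i _ => ?_
    rw [Finset.mul_sum]
    refine Finset.sum_congr rfl fun j _ => ?_
    ring
  rw [h4]
  refine norm_sum_le_of_le _ fun i hi => norm_sum_le_of_le _ fun j hj => ?_
  rw [norm_mul, norm_mul, RCLike.norm_conj]
  refine mul_le_mul_of_nonneg_left ?_ (by positivity)
  split_ifs with hij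
  · subst hij
    have h5 : ∀ t : ℝ, twist t (ν i) * (starRingEnd ℂ) (twist t (ν i)) = 1 := fun t => by
      rw [Complex.mul_conj', norm_twist t (hν0 i hi)]
      norm_num
    simp only [h5]
    rw [intervalIntegral.integral_const]
    have h6 : (2 * T - T) • (1 : ℂ) - T = 0 := by
      rw [Complex.real_smul]
      push_cast
      ring
    rw [h6, norm_zero]
    positivity
  · rw [sub_zero]
    exact norm_integral_twist_mul_conj_le (hν0 i hi) (hν0 j hj) (hνM i hi) (hνM j hj)
      (fun h => hij (hinj hi hj h)) _ _

end MeanValue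

section Resonator

/-- The completely multiplicative extension of a function on primes. -/
noncomputable def complMul (θ : ℕ → ℂ) (n : ℕ) : ℂ := n.factorization.prod fun p k => θ p ^ k

lemma complMul_mul (θ : ℕ → ℂ) {m n : ℕ} (hm : m ≠ 0) (hn : n ≠ 0) :
    complMul θ (m * n) = complMul θ m * complMul θ n := by
  rw [complMul, Nat.factorization_mul hm hn,
    Finsupp.prod_add_index' (fun p => pow_zero _) fun p a b => pow_add _ _ _]
  rfl

lemma complMul_prime_pow (θ : ℕ → ℂ) {p : ℕ} (hp : p.Prime) (k : ℕ) :
    complMul θ (p ^ k) = θ p ^ k := by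
  rw [complMul, hp.factorization_pow]
  exact Finsupp.prod_single_index (pow_zero _)

lemma norm_complMul {θ : ℕ → ℂ} (hθ : ∀ p, ‖θ p‖ = 1) (n : ℕ) : ‖complMul θ n‖ = 1 := by
  rw [complMul, Finsupp.prod, norm_prod]
  exact Finset.prod_eq_one fun p _ => by rw [norm_pow, hθ, one_pow]

lemma twist_pow (t : ℝ) (n k : ℕ) : twist t (n ^ k) = twist t n ^ k := by
  induction k with
  | zero => simp [twist_one]
  | succ k ih => rw [pow_succ, pow_succ, twist_mul, ih]

/-- A product of finite geometric series in the values `θ p * p ^ (-it)`. -/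
noncomputable def resonator (θ : ℕ → ℂ) (N : ℕ) (F : Finset ℕ) (t : ℝ) : ℂ :=
  ∏ p ∈ F, ∑ k ∈ Finset.range N, (θ p * twist t p) ^ k

lemma exists_resonator_eq_sum (θ : ℕ → ℂ) (N : ℕ) (F : Finset ℕ) (hF : ∀ p ∈ F, p.Prime) :
    ∃ S : Finset ℕ, S.card = N ^ F.card ∧
      (∀ n ∈ S, n ≠ 0 ∧ n ≤ (∏ p ∈ F, p) ^ N ∧ n.primeFactors ⊆ F) ∧
      ∀ t, resonator θ N F t = ∑ n ∈ S, complMul θ n * twist t n := by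
  classical
  induction F using Finset.induction_on with
  | empty =>
    refine ⟨{1}, by simp, by simp, fun t => ?_⟩
    simp [resonator, complMul, twist_one]
  | insert p F hp ih =>
    obtain ⟨S, hS1, hS2, hS3⟩ := ih fun p hp => hF p (Finset.mem_insert_of_mem hp)
    have hpp := hF p (Finset.mem_insert_self _ _)
    have hinj : Set.InjOn (fun x : ℕ × ℕ => p ^ x.1 * x.2)
        (Finset.range N ×ˢ S : Finset (ℕ × ℕ)) := by
      rintro ⟨k, m⟩ hx ⟨l, n⟩ hy hxy
      simp only [Finset.coe_product, Set.mem_prod, Finset.mem_coe] at hx hy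
      have hm := hS2 m hx.2
      have hn := hS2 n hy.2
      have hpm : m.factorization p = 0 := Nat.factorization_eq_zero_of_not_dvd fun h =>
        hp (hm.2.2 (Nat.mem_primeFactors.mpr ⟨hpp, h, hm.1⟩))
      have hpn : n.factorization p = 0 := Nat.factorization_eq_zero_of_not_dvd fun h =>
        hp (hn.2.2 (Nat.mem_primeFactors.mpr ⟨hpp, h, hn.1⟩))
      have h1 := congrArg (fun x => x.factorization p) hxy
      simp only [Nat.factorization_mul (pow_ne_zero _ hpp.ne_zero) hm.1,
        Nat.factorization_mul (pow_ne_zero _ hpp.ne_zero) hn.1, hpp.factorization_pow,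
        Finsupp.add_apply, Finsupp.single_eq_same, hpm, hpn, add_zero] at h1
      subst h1
      simp only at hxy
      rw [Nat.mul_right_inj (pow_ne_zero _ hpp.ne_zero)] at hxy
      rw [hxy]
    refine ⟨(Finset.range N ×ˢ S).image fun x => p ^ x.1 * x.2, ?_, ?_, fun t => ?_⟩
    · rw [Finset.card_image_of_injOn hinj, Finset.card_product, hS1, Finset.card_insert_of_notMem hp,
        Finset.card_range, pow_succ']
    · intro n hn
      obtain ⟨⟨k, m⟩, hx, rfl⟩ := Finset.mem_image.mp hn
      simp only [Finset.mem_product, Finset.mem_range] at hx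
      obtain ⟨h1, h2, h3⟩ := hS2 m hx.2
      refine ⟨mul_ne_zero (pow_ne_zero _ hpp.ne_zero) h1, ?_, ?_⟩
      · rw [Finset.prod_insert hp, mul_pow]
        exact Nat.mul_le_mul (Nat.pow_le_pow_right hpp.pos hx.1.le) h2
      · rw [Nat.primeFactors_mul (pow_ne_zero _ hpp.ne_zero) h1]
        refine Finset.union_subset ?_ (h3.trans (Finset.subset_insert _ _))
        intro r hr
        have hr1 := Nat.prime_of_mem_primeFactors hr
        have hr2 := hr1.dvd_of_dvd_pow (Nat.dvd_of_mem_primeFactors hr)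
        rw [(Nat.prime_dvd_prime_iff_eq hr1 hpp).mp hr2]
        exact Finset.mem_insert_self _ _
    · rw [resonator, Finset.prod_insert hp, Finset.sum_image hinj, Finset.sum_product]
      have := hS3 t
      rw [resonator] at this
      rw [this, Finset.sum_mul]
      refine Finset.sum_congr rfl fun k _ => ?_
      rw [Finset.mul_sum]
      refine Finset.sum_congr rfl fun n hn => ?_
      rw [complMul_mul θ (pow_ne_zero _ hpp.ne_zero) (hS2 n hn).1, complMul_prime_pow θ hpp,
        twist_mul, twist_pow, mul_pow]
      ring

lemma continuous_resonator (θ : ℕ → ℂ) (N : ℕ) {F : Finset ℕ} (hF : ∀ p ∈ F, p.Prime) :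
    Continuous (resonator θ N F) := by
  unfold resonator
  refine continuous_finsetProd _ fun p hp => continuous_finsetSum _ fun k _ => ?_
  exact (continuous_const.mul (continuous_twist (hF p hp).ne_zero)).pow _

lemma abs_integral_norm_resonator_sq_sub_le {θ : ℕ → ℂ} (hθ : ∀ p, ‖θ p‖ = 1) (N : ℕ)
    {F : Finset ℕ} (hF : ∀ p ∈ F, p.Prime) {M : ℕ} (hM : (∏ p ∈ F, p) ^ N ≤ M) (T : ℝ) :
    |(∫ t in T..(2 * T), ‖resonator θ N F t‖ ^ 2) - T * N ^ F.card| ≤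
      2 * M * ((N : ℝ) ^ F.card) ^ 2 := by
  obtain ⟨S, hS1, hS2, hS3⟩ := exists_resonator_eq_sum θ N F hF
  have h := abs_integral_norm_sq_sub_le S (complMul θ) id (fun n hn => (hS2 n hn).1)
    (fun n hn => (hS2 n hn).2.1.trans hM) (Set.injOn_id _) T
  simp only [id, ← hS3, norm_complMul hθ, one_pow, Finset.sum_const, hS1, nsmul_eq_mul, mul_one]
    at h
  push_cast at h
  exact h

lemma integral_norm_resonator_mul_sub_one_sq_le {θ : ℕ → ℂ} (hθ : ∀ p, ‖θ p‖ = 1) (N : ℕ)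
    {F : Finset ℕ} (hF : ∀ p ∈ F, p.Prime) {M : ℕ} (hM : (∏ p ∈ F, p) ^ N ≤ M) {T : ℝ}
    (hT : 0 ≤ T) {p : ℕ} (hp : p ∈ F) :
    ∫ t in T..(2 * T), ‖resonator θ N F t‖ ^ 2 * ‖θ p * twist t p - 1‖ ^ 2 ≤
      4 * (T * N ^ (F.card - 1) + 2 * M * ((N : ℝ) ^ (F.card - 1)) ^ 2) := by
  have hF' : ∀ p' ∈ F.erase p, p'.Prime := fun p' hp' => hF p' (Finset.mem_of_mem_erase hp')
  have hM' : (∏ p ∈ F.erase p, p) ^ N ≤ M := by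
    refine le_trans (Nat.pow_le_pow_left ?_ _) hM
    rw [← Finset.mul_prod_erase F _ hp]
    exact Nat.le_mul_of_pos_left _ (hF p hp).pos
  have h1 := (abs_le.mp (abs_integral_norm_resonator_sq_sub_le hθ N hF' hM' T)).2
  rw [Finset.card_erase_of_mem hp] at h1
  calc _ ≤ ∫ t in T..(2 * T), 4 * ‖resonator θ N (F.erase p) t‖ ^ 2 := by
        refine intervalIntegral.integral_mono_on (by linarith) ?_ ?_ fun t _ => ?_
        · refine Continuous.intervalIntegrable ?_ _ _
          exact ((continuous_resonator θ N hF).norm.pow 2).mul (((continuous_const.mul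
            (continuous_twist (hF p hp).ne_zero)).sub continuous_const).norm.pow 2)
        · exact (continuous_const.mul
            ((continuous_resonator θ N hF').norm.pow 2)).intervalIntegrable _ _
        · have h2 : resonator θ N F t * (θ p * twist t p - 1) =
              resonator θ N (F.erase p) t * ((θ p * twist t p) ^ N - 1) := by
            rw [resonator, ← Finset.mul_prod_erase F _ hp, ← geom_sum_mul, resonator]
            ring
          have h3 : ‖(θ p * twist t p) ^ N - 1‖ ≤ 2 := by
            refine (norm_sub_le _ _).trans ?_
            rw [norm_pow, norm_mul, hθ, norm_twist t (hF p hp).ne_zero]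
            norm_num
          rw [← mul_pow, ← norm_mul, h2, norm_mul, mul_pow, mul_comm]
          refine mul_le_mul_of_nonneg_right ?_ (by positivity)
          nlinarith [norm_nonneg ((θ p * twist t p) ^ N - 1)]
    _ ≤ _ := by
        rw [intervalIntegral.integral_const_mul]
        linarith

lemma integral_norm_resonator_mul_sum_sq_le {θ : ℕ → ℂ} (hθ : ∀ p, ‖θ p‖ = 1) (N : ℕ)
    {F : Finset ℕ} (hF : ∀ p ∈ F, p.Prime) {W : Finset ℕ} (hW : ∀ p ∈ W, p.Prime)
    (hdisj : Disjoint F W) (b : ℕ → ℂ) {M P : ℕ} (hWP : ∀ p ∈ W, p ≤ P)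
    (hM : (∏ p ∈ F, p) ^ N * P ≤ M) (T : ℝ) :
    ∫ t in T..(2 * T), ‖resonator θ N F t‖ ^ 2 * ‖∑ m ∈ W, b m * twist t m‖ ^ 2 ≤
      T * (N ^ F.card * ∑ m ∈ W, ‖b m‖ ^ 2) + 2 * M * (N ^ F.card * ∑ m ∈ W, ‖b m‖) ^ 2 := by
  classical
  obtain ⟨S, hS1, hS2, hS3⟩ := exists_resonator_eq_sum θ N F hF
  have hinj : Set.InjOn (fun x : ℕ × ℕ => x.1 * x.2) (S ×ˢ W : Finset (ℕ × ℕ)) := by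
    rintro ⟨m, u⟩ hx ⟨n, v⟩ hy hxy
    simp only [Finset.coe_product, Set.mem_prod, Finset.mem_coe] at hx hy hxy
    have hm := hS2 m hx.1
    have hn := hS2 n hy.1
    have huv : u = v := by
      have h1 : u ∣ n * v := hxy ▸ Dvd.intro_left m rfl
      rcases (hW u hx.2).dvd_mul.mp h1 with h | h
      · exact absurd hx.2 (Finset.disjoint_left.mp hdisj
          (hn.2.2 (Nat.mem_primeFactors.mpr ⟨hW u hx.2, h, hn.1⟩)))
      · exact (Nat.prime_dvd_prime_iff_eq (hW u hx.2) (hW v hy.2)).mp h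
    subst huv
    rw [Nat.mul_left_inj (hW u hx.2).ne_zero] at hxy
    rw [hxy]
  have h := abs_integral_norm_sq_sub_le (S ×ˢ W) (fun x => complMul θ x.1 * b x.2)
    (fun x => x.1 * x.2)
    (fun x hx => mul_ne_zero (hS2 _ (Finset.mem_product.mp hx).1).1
      (hW _ (Finset.mem_product.mp hx).2).ne_zero)
    (fun x hx => (Nat.mul_le_mul (hS2 _ (Finset.mem_product.mp hx).1).2.1
      (hWP _ (Finset.mem_product.mp hx).2)).trans hM) hinj T
  have h1 : ∀ t, ∑ x ∈ S ×ˢ W, complMul θ x.1 * b x.2 * twist t (x.1 * x.2) =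
      resonator θ N F t * ∑ m ∈ W, b m * twist t m := fun t => by
    rw [hS3, Finset.sum_mul_sum, Finset.sum_product]
    refine Finset.sum_congr rfl fun n _ => Finset.sum_congr rfl fun m _ => ?_
    rw [twist_mul]
    ring
  have h2 : ∑ x ∈ S ×ˢ W, ‖complMul θ x.1 * b x.2‖ ^ 2 = N ^ F.card * ∑ m ∈ W, ‖b m‖ ^ 2 := by
    rw [Finset.sum_product]
    simp [norm_complMul hθ, hS1]
  have h3 : ∑ x ∈ S ×ˢ W, ‖complMul θ x.1 * b x.2‖ = N ^ F.card * ∑ m ∈ W, ‖b m‖ := by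
    rw [Finset.sum_product]
    simp [norm_complMul hθ, hS1]
  rw [h2, h3] at h
  simp only [h1, norm_mul, mul_pow] at h
  have := (abs_le.mp h).2
  simp only [mul_pow] at this ⊢
  linarith

end Resonator

section SmallWeightedSum

lemma card_pow_le_prod_pow {F : Finset ℕ} (hF : ∀ p ∈ F, p.Prime) (N : ℕ) :
    N ^ F.card ≤ (∏ p ∈ F, p) ^ N := by
  rw [← Finset.prod_pow, ← Finset.prod_const]
  exact Finset.prod_le_prod (fun _ _ => Nat.zero_le _) fun p hp =>
    (Nat.lt_two_pow_self.le).trans (Nat.pow_le_pow_left (hF p hp).two_le N)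

/-- A quantitative Kronecker-type theorem: the values `p ^ (-it)`, `p ∈ F`, can be brought
close to prescribed unimodular numbers while keeping given Dirichlet polynomials over other primes
small. -/
lemma exists_weighted_sum_le {ι : Type*} {θ : ℕ → ℂ} (hθ : ∀ p, ‖θ p‖ = 1) {N : ℕ} (hN : 1 ≤ N)
    {F : Finset ℕ} (hF : ∀ p ∈ F, p.Prime) {M P : ℕ} (hP : 1 ≤ P)
    (hM : (∏ p ∈ F, p) ^ N * P ≤ M) (w : ℕ → ℝ) (hw : ∀ p ∈ F, 0 ≤ w p) (J : Finset ι)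
    (W : ι → Finset ℕ) (b : ι → ℕ → ℂ) (c : ι → ℝ) (hc : ∀ j ∈ J, 0 ≤ c j)
    (hW : ∀ j ∈ J, ∀ p ∈ W j, p.Prime ∧ p ≤ P ∧ ‖b j p‖ ≤ 1)
    (hdisj : ∀ j ∈ J, Disjoint F (W j)) {T : ℝ} (hT : 4 * (M : ℝ) ^ 4 ≤ T) :
    ∃ t ∈ Set.Icc T (2 * T), ∑ p ∈ F, w p * ‖θ p * twist t p - 1‖ ^ 2 +
      ∑ j ∈ J, c j * ‖∑ m ∈ W j, b j m * twist t m‖ ^ 2 ≤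
      ∑ p ∈ F, w p * (12 / N) + ∑ j ∈ J, c j * (2 * ∑ m ∈ W j, ‖b j m‖ ^ 2 + 1 / M) := by
  have hprod1 : 1 ≤ (∏ p ∈ F, p) ^ N :=
    Nat.one_le_pow _ _ (Finset.prod_pos fun p hp => (hF p hp).pos)
  have hM1 : 1 ≤ M := le_trans (Nat.mul_pos hprod1 hP) hM
  have hM1' : (1 : ℝ) ≤ M := by exact_mod_cast hM1
  have hN1 : (1 : ℝ) ≤ N := by exact_mod_cast hN
  have hP1 : (1 : ℝ) ≤ P := by exact_mod_cast hP
  have hMF : (∏ p ∈ F, p) ^ N ≤ M := le_trans (Nat.le_mul_of_pos_right _ hP) hM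
  have hX1 : (1 : ℝ) ≤ (N : ℝ) ^ F.card := one_le_pow₀ hN1
  have hXP : (N : ℝ) ^ F.card * P ≤ M := by
    exact_mod_cast le_trans (Nat.mul_le_mul_right _ (card_pow_le_prod_pow hF N)) hM
  have hT0 : 0 < T := lt_of_lt_of_le (by positivity) hT
  set X : ℝ := (N : ℝ) ^ F.card with hX
  have hXM : X ≤ M := by nlinarith
  have hM3 : (M : ℝ) * M ≤ M ^ 4 := by
    rw [← sq]
    exact pow_le_pow_right₀ hM1' (by norm_num)
  have h4 : ∀ x, 0 ≤ x → x ≤ X → 2 * M * x ^ 2 ≤ T * x / 2 := fun x hx0 hx => by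
    have h5 : 4 * M * x ≤ T := by nlinarith
    nlinarith
  have hR1 : T * X / 2 ≤ ∫ t in T..(2 * T), ‖resonator θ N F t‖ ^ 2 := by
    have h1 := (abs_le.mp (abs_integral_norm_resonator_sq_sub_le hθ N hF hMF T)).1
    have h2 := h4 X (by positivity) le_rfl
    linarith
  have hRpos : 0 < ∫ t in T..(2 * T), ‖resonator θ N F t‖ ^ 2 :=
    lt_of_lt_of_le (by positivity) hR1
  have hcR := (continuous_resonator θ N hF).norm.pow 2
  have hcp : ∀ p ∈ F, Continuous fun t => ‖θ p * twist t p - 1‖ ^ 2 := fun p hp =>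
    ((continuous_const.mul (continuous_twist (hF p hp).ne_zero)).sub continuous_const).norm.pow 2
  have hcj : ∀ j ∈ J, Continuous fun t => ‖∑ m ∈ W j, b j m * twist t m‖ ^ 2 := fun j hj =>
    (continuous_finsetSum _ fun m hm =>
      continuous_const.mul (continuous_twist (hW j hj m hm).1.ne_zero)).norm.pow 2
  set Q : ℝ → ℝ := fun t => ∑ p ∈ F, w p * ‖θ p * twist t p - 1‖ ^ 2 +
      ∑ j ∈ J, c j * ‖∑ m ∈ W j, b j m * twist t m‖ ^ 2 with hQ
  have hcQ : Continuous Q :=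
    (continuous_finsetSum _ fun p hp => continuous_const.mul (hcp p hp)).add
      (continuous_finsetSum _ fun j hj => continuous_const.mul (hcj j hj))
  obtain ⟨t₀, ht₀, hmin⟩ := (isCompact_Icc (a := T) (b := 2 * T)).exists_isMinOn
    ⟨T, le_rfl, by linarith⟩ hcQ.continuousOn
  refine ⟨t₀, ht₀, ?_⟩
  have hlow : Q t₀ * ∫ t in T..(2 * T), ‖resonator θ N F t‖ ^ 2 ≤
      ∫ t in T..(2 * T), ‖resonator θ N F t‖ ^ 2 * Q t := by
    rw [← intervalIntegral.integral_const_mul]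
    refine intervalIntegral.integral_mono_on (by linarith)
      (continuous_const.mul hcR).continuousOn.intervalIntegrable
      (hcR.mul hcQ).continuousOn.intervalIntegrable fun t ht => ?_
    rw [mul_comm]
    exact mul_le_mul_of_nonneg_left (hmin ht) (by positivity)
  have hexp : ∫ t in T..(2 * T), ‖resonator θ N F t‖ ^ 2 * Q t =
      ∑ p ∈ F, w p * (∫ t in T..(2 * T), ‖resonator θ N F t‖ ^ 2 * ‖θ p * twist t p - 1‖ ^ 2) +
      ∑ j ∈ J, c j * (∫ t in T..(2 * T),
        ‖resonator θ N F t‖ ^ 2 * ‖∑ m ∈ W j, b j m * twist t m‖ ^ 2) := by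
    have h1 : ∀ t, ‖resonator θ N F t‖ ^ 2 * Q t =
        ∑ p ∈ F, w p * (‖resonator θ N F t‖ ^ 2 * ‖θ p * twist t p - 1‖ ^ 2) +
        ∑ j ∈ J, c j * (‖resonator θ N F t‖ ^ 2 * ‖∑ m ∈ W j, b j m * twist t m‖ ^ 2) := fun t => by
      simp only [hQ]
      rw [mul_add, Finset.mul_sum, Finset.mul_sum]
      congr 1 <;> refine Finset.sum_congr rfl fun _ _ => by ring
    have hi1 : ∀ p ∈ F, Continuous fun t =>
        w p * (‖resonator θ N F t‖ ^ 2 * ‖θ p * twist t p - 1‖ ^ 2) := fun p hp =>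
      continuous_const.mul (hcR.mul (hcp p hp))
    have hi2 : ∀ j ∈ J, Continuous fun t =>
        c j * (‖resonator θ N F t‖ ^ 2 * ‖∑ m ∈ W j, b j m * twist t m‖ ^ 2) := fun j hj =>
      continuous_const.mul (hcR.mul (hcj j hj))
    simp only [h1]
    rw [intervalIntegral.integral_add
      ((continuous_finsetSum _ hi1).intervalIntegrable _ _)
      ((continuous_finsetSum _ hi2).intervalIntegrable _ _),
      intervalIntegral.integral_finsetSum fun p hp => (hi1 p hp).intervalIntegrable _ _,
      intervalIntegral.integral_finsetSum fun j hj => (hi2 j hj).intervalIntegrable _ _]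
    simp only [intervalIntegral.integral_const_mul]
  set V : ℝ := ∑ p ∈ F, w p * (12 / N) + ∑ j ∈ J, c j * (2 * ∑ m ∈ W j, ‖b j m‖ ^ 2 + 1 / M)
    with hV
  have hV0 : 0 ≤ V := add_nonneg
    (Finset.sum_nonneg fun p hp => mul_nonneg (hw p hp) (by positivity))
    (Finset.sum_nonneg fun j hj => mul_nonneg (hc j hj) (by positivity))
  have hup : ∫ t in T..(2 * T), ‖resonator θ N F t‖ ^ 2 * Q t ≤ V * (T * X / 2) := by
    rw [hexp, hV, add_mul, Finset.sum_mul, Finset.sum_mul]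
    refine add_le_add (Finset.sum_le_sum fun p hp => ?_) (Finset.sum_le_sum fun j hj => ?_)
    · rw [mul_assoc]
      refine mul_le_mul_of_nonneg_left ?_ (hw p hp)
      refine (integral_norm_resonator_mul_sub_one_sq_le hθ N hF hMF hT0.le hp).trans ?_
      have hcard : F.card ≠ 0 := Finset.card_ne_zero_of_mem hp
      have h6 : (N : ℝ) ^ (F.card - 1) = X / N := by
        rw [hX, eq_div_iff (by positivity), pow_sub_one_mul hcard]
      rw [h6]
      have h7 := h4 (X / N) (by positivity) (div_le_self (by positivity) hN1)
      calc _ ≤ 4 * (T * (X / N) + T * (X / N) / 2) := by linarith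
        _ = _ := by ring
    · rw [mul_assoc]
      refine mul_le_mul_of_nonneg_left ?_ (hc j hj)
      refine (integral_norm_resonator_mul_sum_sq_le hθ N hF (fun p hp => (hW j hj p hp).1)
        (hdisj j hj) (b j) (fun p hp => (hW j hj p hp).2.1) hM T).trans ?_
      have h6 : ∑ m ∈ W j, ‖b j m‖ ≤ P := by
        calc _ ≤ ∑ m ∈ W j, (1 : ℝ) := Finset.sum_le_sum fun m hm => (hW j hj m hm).2.2
          _ = (W j).card := by simp
          _ ≤ P := by
            have : (W j).card ≤ (Finset.Ioc 0 P).card := Finset.card_le_card fun m hm =>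
              Finset.mem_Ioc.mpr ⟨(hW j hj m hm).1.pos, (hW j hj m hm).2.1⟩
            rw [Nat.card_Ioc, Nat.sub_zero] at this
            exact_mod_cast this
      have h7 : X * ∑ m ∈ W j, ‖b j m‖ ≤ M :=
        (mul_le_mul_of_nonneg_left h6 (by positivity)).trans hXP
      have h8 : (X * ∑ m ∈ W j, ‖b j m‖) ^ 2 ≤ (M : ℝ) ^ 2 :=
        pow_le_pow_left₀ (by positivity) h7 2
      have h9 : 2 * M * (X * ∑ m ∈ W j, ‖b j m‖) ^ 2 ≤ 1 / M * (T * X / 2) := by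
        calc _ ≤ 2 * M * (M : ℝ) ^ 2 := by gcongr
          _ = 1 / M * ((4 * M ^ 4) * 1 / 2) := by field_simp; ring
          _ ≤ _ := by gcongr
      rw [← hX]
      calc _ ≤ T * (X * ∑ m ∈ W j, ‖b j m‖ ^ 2) + 1 / M * (T * X / 2) := by linarith
        _ = _ := by ring
  have := hlow.trans (hup.trans (mul_le_mul_of_nonneg_left hR1 hV0))
  exact le_of_mul_le_mul_right this hRpos

end SmallWeightedSum

section PartialSummation

lemma norm_natCast_cpow_neg_le_one {n : ℕ} (hn : n ≠ 0) {v : ℂ} (hv : 0 ≤ v.re) :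
    ‖(n : ℂ) ^ (-v)‖ ≤ 1 := by
  rw [Complex.norm_natCast_cpow_of_pos (Nat.pos_of_ne_zero hn), Complex.neg_re]
  exact Real.rpow_le_one_of_one_le_of_nonpos (by exact_mod_cast Nat.one_le_iff_ne_zero.mpr hn)
    (by linarith)

lemma natCast_cpow_neg_eq_exp {n : ℕ} (hn : n ≠ 0) (v : ℂ) :
    (n : ℂ) ^ (-v) = Complex.exp (-(v * Real.log n)) := by
  rw [Complex.cpow_def_of_ne_zero (by exact_mod_cast hn), ← Complex.natCast_log]
  congr 1
  ring

lemma norm_natCast_cpow_neg_sub_le {n : ℕ} (hn : n ≠ 0) {v : ℂ} (hv : 0 ≤ v.re) (hv1 : ‖v‖ ≤ 1) :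
    ‖(n : ℂ) ^ (-v) - ((n + 1 : ℕ) : ℂ) ^ (-v)‖ ≤ 2 / n := by
  have hn0 : (0 : ℝ) < n := by positivity
  have hn1 : (1 : ℝ) ≤ n := by exact_mod_cast Nat.one_le_iff_ne_zero.mpr hn
  set l : ℝ := Real.log ((n + 1 : ℕ) : ℝ) - Real.log n with hl
  have hl0 : 0 ≤ l := by
    rw [hl, sub_nonneg]
    exact Real.log_le_log hn0 (by push_cast; linarith)
  have hl1 : l ≤ 1 / n := by
    rw [hl, ← Real.log_div (by positivity) hn0.ne']
    refine (Real.log_le_sub_one_of_pos (by positivity)).trans (le_of_eq ?_)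
    push_cast
    field_simp
    ring
  have h1 : (n : ℂ) ^ (-v) - ((n + 1 : ℕ) : ℂ) ^ (-v) =
      -((n : ℂ) ^ (-v) * (Complex.exp (-(v * l)) - 1)) := by
    have : ((n + 1 : ℕ) : ℂ) ^ (-v) = (n : ℂ) ^ (-v) * Complex.exp (-(v * l)) := by
      rw [natCast_cpow_neg_eq_exp hn, natCast_cpow_neg_eq_exp (Nat.succ_ne_zero n),
        ← Complex.exp_add]
      congr 1
      rw [hl]
      push_cast
      ring
    rw [this]
    ring
  have h2 : ‖-(v * (l : ℂ))‖ ≤ 1 / n := by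
    rw [norm_neg, norm_mul, Complex.norm_real, Real.norm_of_nonneg hl0]
    calc _ ≤ 1 * (1 / (n : ℝ)) := mul_le_mul hv1 hl1 hl0 zero_le_one
      _ = _ := one_mul _
  have h3 := Complex.norm_exp_sub_one_le (x := -(v * (l : ℂ)))
    (h2.trans (by rw [div_le_one hn0]; exact hn1))
  rw [h1, norm_neg, norm_mul]
  calc _ ≤ 1 * (2 * (1 / (n : ℝ))) := mul_le_mul (norm_natCast_cpow_neg_le_one hn hv)
        (h3.trans (by linarith)) (norm_nonneg _) zero_le_one
    _ = _ := by ring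

lemma norm_sum_mul_cpow_le (b : ℕ → ℂ) {z P : ℕ} (hzP : z < P) {v : ℂ} (hv : 0 ≤ v.re)
    (hv1 : ‖v‖ ≤ 1) : ‖∑ m ∈ Finset.Ioc z P, b m * (m : ℂ) ^ (-v)‖ ≤
      ‖∑ m ∈ Finset.Ioc z P, b m‖ +
        2 * ∑ n ∈ Finset.Ioc z P, 1 / (n : ℝ) * ‖∑ m ∈ Finset.Ioc z n, b m‖ := by
  have hI : ∀ n, Finset.Ico (z + 1) (n + 1) = Finset.Ioc z n := fun n => by
    ext; simp
  have h1 := sum_Ico_mul_eq_add_sum_sub_mul (fun n : ℕ => (n : ℂ) ^ (-v)) b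
    (show z + 1 ≤ P by omega)
  simp only [hI] at h1
  have h2 : ∑ m ∈ Finset.Ioc z P, b m * (m : ℂ) ^ (-v) =
      ∑ m ∈ Finset.Ioc z P, (m : ℂ) ^ (-v) * b m := Finset.sum_congr rfl fun m _ => mul_comm _ _
  rw [h2, h1]
  refine (norm_add_le _ _).trans (add_le_add ?_ ?_)
  · rw [norm_mul]
    exact mul_le_of_le_one_left (norm_nonneg _) (norm_natCast_cpow_neg_le_one (by omega) hv)
  · rw [Finset.mul_sum]
    calc _ ≤ ∑ n ∈ Finset.Ico (z + 1) P, 2 * (1 / (n : ℝ) * ‖∑ m ∈ Finset.Ioc z n, b m‖) := by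
          refine norm_sum_le_of_le _ fun n hn => ?_
          rw [norm_mul, ← mul_assoc]
          refine mul_le_mul_of_nonneg_right ?_ (norm_nonneg _)
          have hn0 : n ≠ 0 := by
            have := (Finset.mem_Ico.mp hn).1
            omega
          refine (norm_natCast_cpow_neg_sub_le hn0 hv hv1).trans (le_of_eq ?_)
          ring
      _ ≤ _ := by
          refine Finset.sum_le_sum_of_subset_of_nonneg (fun n hn => ?_) fun n _ _ => by positivity
          rw [Finset.mem_Ico] at hn
          rw [Finset.mem_Ioc]
          omega

lemma sum_Ioc_one_div_le (z P : ℕ) :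
    ∑ n ∈ Finset.Ioc z P, 1 / (n : ℝ) ≤ 1 + Real.log P := by
  have h := harmonic_le_one_add_log P
  rw [harmonic_eq_sum_Icc] at h
  push_cast at h
  refine le_trans ?_ h
  simp only [one_div]
  refine Finset.sum_le_sum_of_subset_of_nonneg (fun n hn => ?_) fun n _ _ => by positivity
  rw [Finset.mem_Ioc] at hn
  rw [Finset.mem_Icc]
  omega

/-- A Dirichlet polynomial is small in a half-plane when a weighted mean square of its partial
sums on the boundary is small. -/
lemma norm_sum_mul_cpow_le_of_sum_sq_le (b : ℕ → ℂ) {z P : ℕ} (hzP : z < P) {v : ℂ}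
    (hv : 0 ≤ v.re) (hv1 : ‖v‖ ≤ 1) {η : ℝ} (hη : 0 < η)
    (hQ : ∑ n ∈ Finset.Ioc z P, (1 / (n : ℝ) + if n = P then 1 else 0) *
      ‖∑ m ∈ Finset.Ioc z n, b m‖ ^ 2 ≤ η ^ 2) :
    ‖∑ m ∈ Finset.Ioc z P, b m * (m : ℂ) ^ (-v)‖ ≤ η * (5 + 2 * Real.log P) := by
  simp only [add_mul, Finset.sum_add_distrib] at hQ
  have h1 : ∑ n ∈ Finset.Ioc z P, (if n = P then (1 : ℝ) else 0) *
      ‖∑ m ∈ Finset.Ioc z n, b m‖ ^ 2 = ‖∑ m ∈ Finset.Ioc z P, b m‖ ^ 2 := by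
    simp only [ite_mul, one_mul, zero_mul]
    rw [Finset.sum_ite_eq', if_pos (Finset.mem_Ioc.mpr ⟨hzP, le_rfl⟩)]
  have h2 : 0 ≤ ∑ n ∈ Finset.Ioc z P, 1 / (n : ℝ) * ‖∑ m ∈ Finset.Ioc z n, b m‖ ^ 2 :=
    Finset.sum_nonneg fun n _ => by positivity
  rw [h1] at hQ
  have h3 : ‖∑ m ∈ Finset.Ioc z P, b m‖ ≤ η :=
    abs_le_of_sq_le_sq' (by linarith) hη.le |>.2
  have h4 : ∑ n ∈ Finset.Ioc z P, 1 / (n : ℝ) * ‖∑ m ∈ Finset.Ioc z n, b m‖ ≤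
      ∑ n ∈ Finset.Ioc z P, (η * (1 / (n : ℝ)) +
        1 / (n : ℝ) * ‖∑ m ∈ Finset.Ioc z n, b m‖ ^ 2 / η) := by
    refine Finset.sum_le_sum fun n _ => ?_
    rw [mul_comm η, mul_div_assoc, ← mul_add]
    refine mul_le_mul_of_nonneg_left ?_ (by positivity)
    generalize ‖∑ m ∈ Finset.Ioc z n, b m‖ = x
    rw [← sub_le_iff_le_add', le_div_iff₀ hη]
    nlinarith [sq_nonneg (x - η)]
  rw [Finset.sum_add_distrib, ← Finset.mul_sum, ← Finset.sum_div] at h4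
  have h5 : (∑ n ∈ Finset.Ioc z P, 1 / (n : ℝ) * ‖∑ m ∈ Finset.Ioc z n, b m‖ ^ 2) / η ≤ η := by
    rw [div_le_iff₀ hη]
    nlinarith [sq_nonneg ‖∑ m ∈ Finset.Ioc z P, b m‖]
  have h6 := mul_le_mul_of_nonneg_left (sum_Ioc_one_div_le z P) hη.le
  have h7 := norm_sum_mul_cpow_le b hzP hv hv1
  linarith

end PartialSummation

section SimultaneousApproximation

lemma log_natCast_le_half (n : ℕ) : Real.log n ≤ n / 2 := by
  rcases Nat.eq_zero_or_pos n with rfl | hn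
  · simp
  have h0 : (0 : ℝ) < n := by exact_mod_cast hn
  have h1 := Real.log_le_sub_one_of_pos (show 0 < (n : ℝ) / 2 by positivity)
  rw [Real.log_div h0.ne' two_ne_zero] at h1
  have := Real.log_two_lt_d9
  linarith

lemma two_mul_logPrimeDiv_le_one (n : ℕ) : 2 * logPrimeDiv n ≤ 1 := by
  unfold logPrimeDiv
  split_ifs with h
  · have h0 : (0 : ℝ) < n := by exact_mod_cast h.pos
    have := log_natCast_le_half n
    rw [← mul_div_assoc, div_le_one h0]
    linarith
  · norm_num

lemma logPrimeDiv_sq_le (n : ℕ) : logPrimeDiv n ^ 2 ≤ 16 * (n : ℝ) ^ (-(3 / 2) : ℝ) := by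
  unfold logPrimeDiv
  split_ifs with h
  · have h0 : (0 : ℝ) < n := by exact_mod_cast h.pos
    have h1 := Real.log_le_rpow_div h0.le (show (0 : ℝ) < 1 / 4 by norm_num)
    have h2 : Real.log n ^ 2 ≤ 16 * (n : ℝ) ^ (1 / 2 : ℝ) := by
      calc Real.log n ^ 2 ≤ ((n : ℝ) ^ (1 / 4 : ℝ) / (1 / 4)) ^ 2 :=
            pow_le_pow_left₀ (Real.log_natCast_nonneg n) h1 2
        _ = 16 * ((n : ℝ) ^ (1 / 4 : ℝ)) ^ 2 := by ring
        _ = _ := by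
            rw [← Real.rpow_natCast, ← Real.rpow_mul h0.le]
            norm_num
    rw [div_pow, div_le_iff₀ (by positivity), mul_assoc, ← Real.rpow_natCast (n : ℝ) 2,
      ← Real.rpow_add h0]
    norm_num at h2 ⊢
    exact h2
  · rw [zero_pow two_ne_zero]
    positivity

/-- A simultaneous approximation theorem, in mean square form. -/
lemma exists_sum_sq_le {θ : ℕ → ℂ} (hθ : ∀ p, ‖θ p‖ = 1) {N : ℕ} (hN : 1 ≤ N) {z P : ℕ}
    (hP : 1 ≤ P) {M : ℕ} (hM : primorial z ^ N * P ≤ M) (a : Bool → ℕ → ℂ)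
    (ha : ∀ k n, ‖a k n‖ ≤ 2 * logPrimeDiv n) {T : ℝ} (hT : 4 * (M : ℝ) ^ 4 ≤ T) :
    ∃ t ∈ Set.Icc T (2 * T), ∃ V : ℝ,
      V = (∑ p ∈ Finset.Ioc 0 z, logPrimeDiv p) * (12 / N) +
        2 * (∑ n ∈ Finset.Ioc z P, (1 / (n : ℝ) + if n = P then 1 else 0)) *
          (8 * (∑ m ∈ Finset.Ioc z P, logPrimeDiv m ^ 2) + 1 / M) ∧
      ∑ p ∈ Finset.Ioc 0 z, logPrimeDiv p * ‖θ p * twist t p - 1‖ ^ 2 ≤ V ∧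
      ∀ k, ∑ n ∈ Finset.Ioc z P, (1 / (n : ℝ) + if n = P then 1 else 0) *
        ‖∑ m ∈ Finset.Ioc z n, a k m * twist t m‖ ^ 2 ≤ V := by
  classical
  set c : ℕ → ℝ := fun n => 1 / (n : ℝ) + if n = P then 1 else 0 with hc
  have hc0 : ∀ n, 0 ≤ c n := fun n => by
    simp only [hc]
    split_ifs <;> positivity
  set F := (Finset.Ioc 0 z).filter Nat.Prime with hF
  have hFprod : ∏ p ∈ F, p = primorial z := by
    rw [primorial]
    refine Finset.prod_congr ?_ fun _ _ => rfl
    ext n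
    simp only [hF, Finset.mem_filter, Finset.mem_Ioc, Finset.mem_range]
    constructor
    · rintro ⟨h, h'⟩; exact ⟨by omega, h'⟩
    · rintro ⟨h, h'⟩; exact ⟨⟨h'.pos, by omega⟩, h'⟩
  obtain ⟨t, ht, hsum⟩ := exists_weighted_sum_le hθ hN (F := F)
    (fun p hp => (Finset.mem_filter.mp hp).2) hP (hFprod ▸ hM) logPrimeDiv
    (fun p _ => logPrimeDiv_nonneg p) (Finset.univ ×ˢ Finset.Ioc z P : Finset (Bool × ℕ))
    (fun j => (Finset.Ioc z j.2).filter Nat.Prime) (fun j => a j.1) (fun j => c j.2)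
    (fun j _ => hc0 _) (fun j hj p hp => by
      rw [Finset.mem_product, Finset.mem_Ioc] at hj
      rw [Finset.mem_filter, Finset.mem_Ioc] at hp
      exact ⟨hp.2, hp.1.2.trans hj.2.2, (ha _ _).trans (two_mul_logPrimeDiv_le_one p)⟩)
    (fun j _ => by
      rw [Finset.disjoint_left]
      intro p hp hp'
      have h1 := (Finset.mem_Ioc.mp (Finset.mem_filter.mp hp).1).2
      have h2 := (Finset.mem_Ioc.mp (Finset.mem_filter.mp hp').1).1
      omega) hT
  have hfil : ∀ (s : Finset ℕ) (f : ℕ → ℝ), ∑ p ∈ s.filter Nat.Prime, logPrimeDiv p * f p =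
      ∑ p ∈ s, logPrimeDiv p * f p := fun s f => by
    rw [Finset.sum_filter]
    refine Finset.sum_congr rfl fun p _ => ?_
    split_ifs with h
    · rfl
    · simp [logPrimeDiv, h]
  have hfil2 : ∀ (s : Finset ℕ) (k : Bool), ∑ p ∈ s.filter Nat.Prime, a k p * twist t p =
      ∑ p ∈ s, a k p * twist t p := fun s k => by
    rw [Finset.sum_filter]
    refine Finset.sum_congr rfl fun p _ => ?_
    split_ifs with h
    · rfl
    · have := ha k p
      simp only [logPrimeDiv, h, if_false, mul_zero, norm_le_zero_iff] at this
      simp [this]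
  have hw1 := hfil (Finset.Ioc 0 z) fun p => ‖θ p * twist t p - 1‖ ^ 2
  have hw2 := hfil (Finset.Ioc 0 z) fun _ => 12 / (N : ℝ)
  simp only [← hF] at hw1 hw2
  rw [hw1, hw2, ← Finset.sum_mul] at hsum
  simp only [hfil2] at hsum
  have hR : ∑ j ∈ (Finset.univ ×ˢ Finset.Ioc z P : Finset (Bool × ℕ)), c j.2 *
      (2 * ∑ m ∈ (Finset.Ioc z j.2).filter Nat.Prime, ‖a j.1 m‖ ^ 2 + 1 / M) ≤
      2 * (∑ n ∈ Finset.Ioc z P, c n) *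
          (8 * (∑ m ∈ Finset.Ioc z P, logPrimeDiv m ^ 2) + 1 / M) := by
    have h1 : 2 * (∑ n ∈ Finset.Ioc z P, c n) *
          (8 * (∑ m ∈ Finset.Ioc z P, logPrimeDiv m ^ 2) + 1 / M) =
        ∑ j ∈ (Finset.univ ×ˢ Finset.Ioc z P : Finset (Bool × ℕ)), c j.2 *
          (8 * (∑ m ∈ Finset.Ioc z P, logPrimeDiv m ^ 2) + 1 / M) := by
      rw [Finset.sum_product, Fintype.sum_bool, ← Finset.sum_mul]
      ring
    rw [h1]
    refine Finset.sum_le_sum fun j hj => mul_le_mul_of_nonneg_left ?_ (hc0 _)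
    rw [Finset.mem_product, Finset.mem_Ioc] at hj
    have h2 : ∑ m ∈ (Finset.Ioc z j.2).filter Nat.Prime, ‖a j.1 m‖ ^ 2 ≤
        ∑ m ∈ Finset.Ioc z P, 4 * logPrimeDiv m ^ 2 := by
      refine (Finset.sum_le_sum fun m _ => ?_).trans (Finset.sum_le_sum_of_subset_of_nonneg
        ((Finset.filter_subset _ _).trans (Finset.Ioc_subset_Ioc_right hj.2.2))
        fun m _ _ => by positivity)
      calc ‖a j.1 m‖ ^ 2 ≤ (2 * logPrimeDiv m) ^ 2 := pow_le_pow_left₀ (norm_nonneg _) (ha _ _) 2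
        _ = _ := by ring
    rw [← Finset.mul_sum] at h2
    linarith
  have hL : ∑ j ∈ (Finset.univ ×ˢ Finset.Ioc z P : Finset (Bool × ℕ)), c j.2 *
      ‖∑ m ∈ Finset.Ioc z j.2, a j.1 m * twist t m‖ ^ 2 = ∑ k, ∑ n ∈ Finset.Ioc z P, c n *
        ‖∑ m ∈ Finset.Ioc z n, a k m * twist t m‖ ^ 2 := by
    rw [Finset.sum_product]
  have hQ0 : ∀ k, 0 ≤ ∑ n ∈ Finset.Ioc z P, c n *
      ‖∑ m ∈ Finset.Ioc z n, a k m * twist t m‖ ^ 2 := fun k =>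
    Finset.sum_nonneg fun n _ => mul_nonneg (hc0 n) (by positivity)
  have hw0 : 0 ≤ ∑ p ∈ Finset.Ioc 0 z, logPrimeDiv p * ‖θ p * twist t p - 1‖ ^ 2 :=
    Finset.sum_nonneg fun p _ => mul_nonneg (logPrimeDiv_nonneg p) (by positivity)
  rw [hL] at hsum
  refine ⟨t, ht, _, rfl, ?_, fun k => ?_⟩
  · have := Finset.sum_nonneg fun k (_ : k ∈ Finset.univ) => hQ0 k
    linarith
  · have := Finset.single_le_sum (fun k _ => hQ0 k) (Finset.mem_univ k)
    linarith

end SimultaneousApproximation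

section SimultaneousApproximation

lemma eventually_mul_pow_le_exp (K : ℝ) (k : ℕ) {b : ℝ} (hb : 0 < b) :
    ∀ᶠ Y : ℝ in Filter.atTop, K * Y ^ k ≤ Real.exp (b * Y) := by
  have h := (isLittleO_pow_exp_pos_mul_atTop k hb).bound
    (show 0 < 1 / (|K| + 1) by positivity)
  filter_upwards [h, Filter.eventually_ge_atTop 0] with Y hY hY0
  rw [Real.norm_of_nonneg (by positivity), Real.norm_of_nonneg (by positivity), one_div_mul_eq_div,
    le_div_iff₀ (by positivity)] at hY
  have h1 : K * Y ^ k ≤ |K| * Y ^ k := mul_le_mul_of_nonneg_right (le_abs_self K) (by positivity)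
  have h2 : 0 ≤ Y ^ k := by positivity
  linarith

lemma sum_Ioc_logPrimeDiv_sq_le : ∃ S : ℝ, 0 ≤ S ∧ ∀ Y : ℝ, ∀ z P : ℕ, Real.exp Y ≤ z + 1 →
    ∑ m ∈ Finset.Ioc z P, logPrimeDiv m ^ 2 ≤ S * Real.exp (-(1 / 4 * Y)) := by
  have hs : Summable fun n : ℕ => 16 * (n : ℝ) ^ (-(5 / 4) : ℝ) :=
    (Real.summable_nat_rpow.mpr (by norm_num)).mul_left 16
  refine ⟨∑' n : ℕ, 16 * (n : ℝ) ^ (-(5 / 4) : ℝ), tsum_nonneg fun n => by positivity,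
    fun Y z P hz => ?_⟩
  calc _ ≤ ∑ m ∈ Finset.Ioc z P, 16 * (m : ℝ) ^ (-(5 / 4) : ℝ) * Real.exp (-(1 / 4 * Y)) := by
        refine Finset.sum_le_sum fun m hm => (logPrimeDiv_sq_le m).trans ?_
        have hm1 : z + 1 ≤ m := (Finset.mem_Ioc.mp hm).1
        have hm2 : Real.exp Y ≤ m := hz.trans (by exact_mod_cast hm1)
        have hm0 : (0 : ℝ) < m := (Real.exp_pos Y).trans_le hm2
        rw [show (-(3 / 2) : ℝ) = -(5 / 4) + -(1 / 4) by norm_num, Real.rpow_add hm0, ← mul_assoc]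
        refine mul_le_mul_of_nonneg_left ?_ (by positivity)
        calc (m : ℝ) ^ (-(1 / 4) : ℝ) ≤ Real.exp Y ^ (-(1 / 4) : ℝ) :=
              Real.rpow_le_rpow_of_nonpos (Real.exp_pos Y) hm2 (by norm_num)
          _ = _ := by
              rw [← Real.exp_mul]
              ring_nf
    _ ≤ _ := by
        rw [← Finset.sum_mul]
        exact mul_le_mul_of_nonneg_right (hs.sum_le_tsum _ fun n _ => by positivity)
          (Real.exp_pos _).le

lemma log_log_le_of_le {z N P M : ℕ} (hM : M = primorial z ^ N * P) (hM8 : (8 : ℝ) ≤ M)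
    {κ h Y t : ℝ} (hz : (z : ℝ) ≤ Real.exp (κ * Y)) (hN : (N : ℝ) ≤ Real.exp (h * Y) + 1)
    (hP : Real.log P ≤ Real.exp Y) (ht0 : 0 ≤ t) (ht : t ≤ 2 * (4 * (M : ℝ) ^ 4)) (hκ : 1 ≤ κ)
    (hh : 0 ≤ h) (hY : 40 ≤ Real.exp (h * Y)) (hY0 : 0 ≤ Y) :
    Real.log (Real.log (t + 1)) ≤ (κ + 2 * h) * Y := by
  rcases ht0.eq_or_lt with rfl | ht0
  · simp only [zero_add, Real.log_one, Real.log_zero]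
    positivity
  have hM0 : (0 : ℝ) < M := by linarith
  have hP0 : (P : ℝ) ≠ 0 := by
    rintro h
    have : P = 0 := by exact_mod_cast h
    rw [hM, this] at hM0
    simp at hM0
  have h1 : Real.log (t + 1) ≤ 8 * Real.log M := by
    have h2 : t + 1 ≤ (M : ℝ) ^ 8 := by
      have h3 : (8 : ℝ) ^ 4 ≤ (M : ℝ) ^ 4 := pow_le_pow_left₀ (by norm_num) hM8 4
      have h4 : (M : ℝ) ^ 8 = (M : ℝ) ^ 4 * (M : ℝ) ^ 4 := by ring
      nlinarith
    calc _ ≤ Real.log ((M : ℝ) ^ 8) := Real.log_le_log (by linarith) h2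
      _ = _ := by rw [Real.log_pow]; norm_num
  have h2 : Real.log M = N * Real.log (primorial z) + Real.log P := by
    have h3 : (primorial z : ℝ) ≠ 0 := by exact_mod_cast (primorial_pos z).ne'
    rw [hM]
    push_cast
    rw [Real.log_mul (pow_ne_zero _ h3) hP0, Real.log_pow]
  have h3 : Real.log (primorial z) ≤ z * 2 := by
    have h4 : (primorial z : ℝ) ≤ 4 ^ z := by exact_mod_cast primorial_le_four_pow z
    calc _ ≤ Real.log (4 ^ z) := Real.log_le_log (by exact_mod_cast primorial_pos z) h4
      _ = z * Real.log 4 := Real.log_pow _ _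
      _ ≤ _ := by
          refine mul_le_mul_of_nonneg_left ?_ (Nat.cast_nonneg z)
          rw [show (4 : ℝ) = 2 ^ 2 by norm_num, Real.log_pow]
          have := Real.log_two_lt_d9
          push_cast
          linarith
  have h4 : (N : ℝ) * Real.log (primorial z) ≤
      (2 * Real.exp (h * Y)) * (Real.exp (κ * Y) * 2) := by
    refine mul_le_mul (by linarith) (by linarith) ?_ (by positivity)
    exact Real.log_natCast_nonneg _
  have h5 : Real.exp Y ≤ Real.exp (h * Y) * Real.exp (κ * Y) := by
    rw [← Real.exp_add]
    exact Real.exp_le_exp.mpr (by nlinarith [mul_nonneg hh hY0])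
  have h6 : Real.log (t + 1) ≤ Real.exp ((κ + 2 * h) * Y) := by
    have h7 : Real.exp ((κ + 2 * h) * Y) =
        Real.exp (h * Y) * (Real.exp (h * Y) * Real.exp (κ * Y)) := by
      rw [← Real.exp_add, ← Real.exp_add]
      ring_nf
    have h8 := mul_le_mul_of_nonneg_right hY
      (show 0 ≤ Real.exp (h * Y) * Real.exp (κ * Y) by positivity)
    linarith
  calc _ ≤ Real.log (Real.exp ((κ + 2 * h) * Y)) :=
        Real.log_le_log (Real.log_pos (by linarith)) h6
    _ = _ := Real.log_exp _

set_option maxHeartbeats 1000000 in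
/-- Given unimodular targets `θ p`, there is a `t` of controlled size such that the `p ^ (-it)` are
close to the conjugates of `θ p` for `log p ≤ κ Y`, while the Dirichlet polynomials with
coefficients `a k` over the following range are small. -/
lemma eventually_exists_twist (a : Bool → ℕ → ℂ) (ha : ∀ k n, ‖a k n‖ ≤ 2 * logPrimeDiv n)
    {κ h : ℝ} (hκ1 : 1 ≤ κ) (hκ2 : κ ≤ 2) (hh : 0 < h) (T : ℝ) :
    ∀ᶠ Y : ℝ in Filter.atTop, ∀ θ : ℕ → ℂ, (∀ p, ‖θ p‖ = 1) → ∃ t : ℝ, T < t ∧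
      Real.log (Real.log (t + 1)) ≤ (κ + 2 * h) * Y ∧
      expSum (fun p => logPrimeDiv p * ‖θ p * twist t p - 1‖) (κ * Y) ≤ 2 / Y ∧
      ∃ P : ℕ, Real.exp (Y ^ 3) ≤ P ∧ ∀ k, ∀ v : ℂ, 0 ≤ v.re → ‖v‖ ≤ 1 →
        ‖∑ m ∈ Finset.Ioc ⌊Real.exp (κ * Y)⌋₊ P, a k m * twist t m * (m : ℂ) ^ (-v)‖ ≤
          3 / Y := by
  obtain ⟨C, hC0, hC⟩ := abs_sum_logPrimeDiv_exp_sub_le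
  obtain ⟨S, hS0, hS⟩ := sum_Ioc_logPrimeDiv_sq_le
  filter_upwards [Filter.eventually_ge_atTop 7, Filter.eventually_gt_atTop T,
    Filter.eventually_ge_atTop C,
    eventually_mul_pow_le_exp 2 3 zero_lt_one, eventually_mul_pow_le_exp 72 9 hh,
    eventually_mul_pow_le_exp (16 * (8 * S + 1)) 11 (show (0 : ℝ) < 1 / 4 by norm_num)]
    with Y hY7 hYT hYC hYe3 hY1 hY2 θ hθ
  have hY0 : 0 < Y := by linarith
  have hκY : Y ≤ κ * Y := by nlinarith
  have hκY2 : κ * Y ≤ 2 * Y := by nlinarith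
  set z := ⌊Real.exp (κ * Y)⌋₊ with hz
  have hz1 : Real.exp Y ≤ z + 1 :=
    (Real.exp_le_exp.mpr hκY).trans (Nat.lt_floor_add_one _).le
  have hz2 : (z : ℝ) ≤ Real.exp (κ * Y) := Nat.floor_le (Real.exp_pos _).le
  set P := ⌈Real.exp (Y ^ 3)⌉₊ with hP
  have hPle : Real.exp (Y ^ 3) ≤ P := Nat.le_ceil _
  have hP0 : (0 : ℝ) < P := (Real.exp_pos _).trans_le hPle
  have hPnat : 1 ≤ P := by exact_mod_cast hP0
  have hY2' : 49 ≤ Y ^ 2 := by nlinarith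
  have hY3' : 49 * Y ≤ Y ^ 3 := by
    calc 49 * Y ≤ Y ^ 2 * Y := mul_le_mul_of_nonneg_right hY2' hY0.le
      _ = Y ^ 3 := by ring
  have hY3 : 2 * Y ≤ Y ^ 3 := by linarith
  have hY3e : (1 : ℝ) ≤ Real.exp (Y ^ 3) := Real.one_le_exp (by positivity)
  have hPlog : Real.log P ≤ Y ^ 3 + 1 := by
    have h1 : (P : ℝ) ≤ 2 * Real.exp (Y ^ 3) := by
      have := Nat.ceil_lt_add_one (Real.exp_pos (Y ^ 3)).le
      linarith
    have h2 := Real.log_le_log hP0 h1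
    rw [Real.log_mul two_ne_zero (Real.exp_pos _).ne', Real.log_exp] at h2
    have := Real.log_two_lt_d9
    linarith
  have hzP : z < P := by
    have h1 : (z : ℝ) < P := by
      refine hz2.trans_lt (lt_of_lt_of_le (Real.exp_lt_exp.mpr ?_) hPle)
      linarith
    exact_mod_cast h1
  set N := ⌈Real.exp (h * Y)⌉₊ with hN
  have hNle : Real.exp (h * Y) ≤ N := Nat.le_ceil _
  have hN0 : (0 : ℝ) < N := (Real.exp_pos _).trans_le hNle
  have hN1 : 1 ≤ N := by exact_mod_cast hN0
  have hNup : (N : ℝ) ≤ Real.exp (h * Y) + 1 := (Nat.ceil_lt_add_one (Real.exp_pos _).le).le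
  obtain ⟨M, hM⟩ : ∃ M, M = primorial z ^ N * P := ⟨_, rfl⟩
  have hprim : 1 ≤ primorial z ^ N := Nat.one_le_pow _ _ (primorial_pos z)
  have hPM : P ≤ M := hM ▸ Nat.le_mul_of_pos_left P hprim
  have hPM' : (P : ℝ) ≤ M := by exact_mod_cast hPM
  have hYP : Real.exp Y ≤ P := (Real.exp_le_exp.mpr (by linarith)).trans hPle
  have hYe : Y + 1 ≤ Real.exp Y := Real.add_one_le_exp Y
  have hM8 : (8 : ℝ) ≤ M := by linarith
  have hM0 : (0 : ℝ) < M := by linarith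
  obtain ⟨t, ⟨ht1, ht2⟩, V, hV, hVw, hVQ⟩ := exists_sum_sq_le hθ hN1 hPnat hM.ge a ha le_rfl
  -- the bound for the mean square
  have hW : ∑ p ∈ Finset.Ioc 0 z, logPrimeDiv p ≤ 3 * Y := by
    have := (abs_le.mp (hC (κ * Y) (by linarith))).2
    linarith
  have hVY : V ≤ (1 / Y ^ 4) ^ 2 := by
    have h1 : (∑ p ∈ Finset.Ioc 0 z, logPrimeDiv p) * (12 / N) ≤ 1 / (2 * Y ^ 8) := by
      calc _ ≤ 3 * Y * (12 / (72 * Y ^ 9)) := by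
            refine mul_le_mul hW ?_ (by positivity) (by positivity)
            exact div_le_div_of_nonneg_left (by norm_num) (by positivity) (hY1.trans hNle)
        _ = _ := by
            field_simp
            norm_num
    have h2 : ∑ n ∈ Finset.Ioc z P, (1 / (n : ℝ) + if n = P then 1 else 0) ≤ 2 * Y ^ 3 := by
      rw [Finset.sum_add_distrib, Finset.sum_ite_eq', if_pos (Finset.mem_Ioc.mpr ⟨hzP, le_rfl⟩)]
      have := sum_Ioc_one_div_le z P
      nlinarith
    have hE : Real.exp (-(1 / 4 * Y)) ≤ 1 / (16 * (8 * S + 1) * Y ^ 11) := by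
      rw [Real.exp_neg, ← one_div]
      exact one_div_le_one_div_of_le (by positivity) hY2
    have h3 : 8 * (∑ m ∈ Finset.Ioc z P, logPrimeDiv m ^ 2) + 1 / (M : ℝ) ≤
        (8 * S + 1) * Real.exp (-(1 / 4 * Y)) := by
      have h4 := hS Y z P hz1
      have h5 : 1 / (M : ℝ) ≤ Real.exp (-(1 / 4 * Y)) := by
        rw [Real.exp_neg, ← one_div]
        refine one_div_le_one_div_of_le (Real.exp_pos _) ?_
        exact (Real.exp_le_exp.mpr (by linarith)).trans (hYP.trans hPM')
      linarith
    have h6 : 0 ≤ 8 * (∑ m ∈ Finset.Ioc z P, logPrimeDiv m ^ 2) + 1 / (M : ℝ) :=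
      add_nonneg (mul_nonneg (by norm_num) (Finset.sum_nonneg fun m _ => sq_nonneg _))
        (by positivity)
    have h7 : 2 * (∑ n ∈ Finset.Ioc z P, (1 / (n : ℝ) + if n = P then 1 else 0)) *
        (8 * (∑ m ∈ Finset.Ioc z P, logPrimeDiv m ^ 2) + 1 / M) ≤ 1 / (2 * Y ^ 8) := by
      calc _ ≤ 2 * (2 * Y ^ 3) * ((8 * S + 1) * (1 / (16 * (8 * S + 1) * Y ^ 11))) :=
            mul_le_mul (by linarith) (h3.trans (mul_le_mul_of_nonneg_left hE (by positivity)))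
              h6 (by positivity)
        _ = 1 / (4 * Y ^ 8) := by
            field_simp
            norm_num
        _ ≤ _ := one_div_le_one_div_of_le (by positivity) (by nlinarith [pow_pos hY0 8])
    calc V ≤ 1 / (2 * Y ^ 8) + 1 / (2 * Y ^ 8) := by rw [hV]; exact add_le_add h1 h7
      _ = _ := by
          field_simp
          norm_num
  refine ⟨t, ?_, ?_, ?_, P, hPle, fun k v hv hv1 => ?_⟩
  · have : (M : ℝ) ≤ 4 * (M : ℝ) ^ 4 := by
      nlinarith [pow_le_pow_right₀ (show (1 : ℝ) ≤ M by linarith) (show 1 ≤ 4 by norm_num)]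
    linarith
  · have hY31 : 1 ≤ Y ^ 3 := by linarith
    rw [one_mul] at hYe3
    have hY9 : 1 ≤ Y ^ 9 := one_le_pow₀ (by linarith)
    have hlog := log_log_le_of_le hM hM8 hz2 hNup (hPlog.trans (by linarith)) (ht1.trans' (by positivity)) ht2
      hκ1 hh.le (by linarith) hY0.le
    exact hlog
  · have hη : 0 < 1 / Y ^ 4 := by positivity
    calc _ ≤ ∑ p ∈ Finset.Ioc 0 z, (1 / Y ^ 4 * logPrimeDiv p +
          logPrimeDiv p * ‖θ p * twist t p - 1‖ ^ 2 / (1 / Y ^ 4)) := by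
          refine Finset.sum_le_sum fun p _ => ?_
          rw [mul_comm (1 / Y ^ 4), mul_div_assoc, ← mul_add]
          refine mul_le_mul_of_nonneg_left ?_ (logPrimeDiv_nonneg p)
          generalize ‖θ p * twist t p - 1‖ = x
          rw [← sub_le_iff_le_add', le_div_iff₀ hη]
          nlinarith [sq_nonneg (x - 1 / Y ^ 4)]
      _ ≤ 1 / Y ^ 4 * (3 * Y) + (1 / Y ^ 4) ^ 2 / (1 / Y ^ 4) := by
          rw [Finset.sum_add_distrib, ← Finset.mul_sum, ← Finset.sum_div]
          refine add_le_add (mul_le_mul_of_nonneg_left hW hη.le) ?_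
          exact div_le_div_of_nonneg_right (hVw.trans hVY) hη.le
      _ = (3 * Y + 1) / Y ^ 4 := by
          field_simp
      _ ≤ 2 / Y := by
          rw [div_le_div_iff₀ (by positivity) hY0]
          nlinarith [pow_pos hY0 2, pow_pos hY0 3]
  · have h1 := norm_sum_mul_cpow_le_of_sum_sq_le (fun m => a k m * twist t m) hzP hv hv1
      (show 0 < 1 / Y ^ 4 by positivity) ((hVQ k).trans hVY)
    refine h1.trans ?_
    rw [one_div_mul_eq_div, div_le_div_iff₀ (by positivity) hY0]
    have h2 : 5 + 2 * Real.log P ≤ 3 * Y ^ 3 := by nlinarith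
    calc _ ≤ 3 * Y ^ 3 * Y := mul_le_mul_of_nonneg_right h2 hY0.le
      _ = _ := by ring

end SimultaneousApproximation

section MainSums

/-- The sign `1` for `log n ≤ U` and `-1` afterwards. -/
noncomputable def cutSign (U : ℝ) (n : ℕ) : ℝ := if Real.log n ≤ U then 1 else -1

lemma abs_cutSign (U : ℝ) (n : ℕ) : |cutSign U n| = 1 := by
  unfold cutSign
  split_ifs <;> simp

lemma sum_Ioc_mul_cutSign (f : ℕ → ℝ) {U V W : ℝ} (hUV : U ≤ V) (hVW : V ≤ W) :
    ∑ n ∈ Finset.Ioc ⌊Real.exp U⌋₊ ⌊Real.exp W⌋₊, f n * cutSign V n =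
      ∑ n ∈ Finset.Ioc ⌊Real.exp U⌋₊ ⌊Real.exp V⌋₊, f n -
        ∑ n ∈ Finset.Ioc ⌊Real.exp V⌋₊ ⌊Real.exp W⌋₊, f n := by
  rw [← Finset.sum_Ioc_consecutive _ (Nat.floor_mono (Real.exp_le_exp.mpr hUV))
    (Nat.floor_mono (Real.exp_le_exp.mpr hVW)), sub_eq_add_neg, ← Finset.sum_neg_distrib]
  congr 1
  · refine Finset.sum_congr rfl fun n hn => ?_
    rw [mem_Ioc_floor_exp] at hn
    rw [cutSign, if_pos hn.2.2, mul_one]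
  · refine Finset.sum_congr rfl fun n hn => ?_
    rw [mem_Ioc_floor_exp] at hn
    rw [cutSign, if_neg hn.2.1.not_ge, mul_neg_one]

lemma abs_sum_Ioc_logPrimeDiv_sub_le : ∃ C : ℝ, 0 ≤ C ∧ ∀ U V : ℝ, 0 ≤ U → U ≤ V →
    |∑ n ∈ Finset.Ioc ⌊Real.exp U⌋₊ ⌊Real.exp V⌋₊, logPrimeDiv n - (V - U)| ≤ C := by
  obtain ⟨C, hC0, hC⟩ := abs_sum_logPrimeDiv_exp_sub_le
  refine ⟨2 * C, by positivity, fun U V hU hUV => ?_⟩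
  rw [← expSum_sub hUV]
  have h1 := abs_le.mp (hC U hU)
  have h2 := abs_le.mp (hC V (hU.trans hUV))
  rw [expSum, expSum, abs_le]
  constructor <;> linarith

lemma sum_Ioc_logPrimeDiv_mul_log_le {U V : ℝ} :
    ∑ n ∈ Finset.Ioc ⌊Real.exp U⌋₊ ⌊Real.exp V⌋₊, logPrimeDiv n * Real.log n ≤
      V * ∑ n ∈ Finset.Ioc ⌊Real.exp U⌋₊ ⌊Real.exp V⌋₊, logPrimeDiv n := by
  rw [Finset.mul_sum]
  refine Finset.sum_le_sum fun n hn => ?_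
  rw [mem_Ioc_floor_exp] at hn
  rw [mul_comm]
  exact mul_le_mul_of_nonneg_right hn.2.2 (logPrimeDiv_nonneg n)

lemma le_sum_Ioc_logPrimeDiv_mul_log {U V : ℝ} :
    U * ∑ n ∈ Finset.Ioc ⌊Real.exp U⌋₊ ⌊Real.exp V⌋₊, logPrimeDiv n ≤
    ∑ n ∈ Finset.Ioc ⌊Real.exp U⌋₊ ⌊Real.exp V⌋₊, logPrimeDiv n * Real.log n := by
  rw [Finset.mul_sum]
  refine Finset.sum_le_sum fun n hn => ?_
  rw [mem_Ioc_floor_exp] at hn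
  rw [mul_comm]
  exact mul_le_mul_of_nonneg_left hn.2.1.le (logPrimeDiv_nonneg n)

/-- Sizes of the first two moments of the signed weights. -/
lemma eventually_signed_moments {h g : ℝ} (hh : 0 < h) (hh4 : h ≤ 1 / 4) (hg : 0 < g)
    (hgh : g ≤ h) : ∀ᶠ Y : ℝ in Filter.atTop, ∀ S₁ S₂ : ℝ,
      S₁ = ∑ n ∈ Finset.Ioc ⌊Real.exp Y⌋₊ ⌊Real.exp ((1 + 2 * h + g) * Y)⌋₊,
        logPrimeDiv n * cutSign ((1 + h) * Y) n →
      S₂ = ∑ n ∈ Finset.Ioc ⌊Real.exp Y⌋₊ ⌊Real.exp ((1 + 2 * h + g) * Y)⌋₊,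
        logPrimeDiv n * Real.log n * cutSign ((1 + h) * Y) n →
      (-(2 * g * Y) ≤ S₁ ∧ S₁ ≤ -(g * Y / 2)) ∧
        (-(6 * Y ^ 2) ≤ S₂ ∧ S₂ ≤ -(h ^ 2 * Y ^ 2 / 8)) := by
  obtain ⟨C, hC0, hC⟩ := abs_sum_Ioc_logPrimeDiv_sub_le
  filter_upwards [Filter.eventually_ge_atTop 1, Filter.eventually_ge_atTop C,
    Filter.eventually_ge_atTop (4 * C / g), Filter.eventually_ge_atTop (80 * C / h ^ 2)]
    with Y hY1 hYC hYg hYh S₁ S₂ hS₁ hS₂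
  rw [div_le_iff₀ hg] at hYg
  rw [div_le_iff₀ (by positivity)] at hYh
  have hY0 : 0 < Y := by linarith
  have hhY : 0 < h * Y := by positivity
  have hgY : 0 < g * Y := by positivity
  have h1 : Y ≤ (1 + h) * Y := by linarith
  have h2 : (1 + h) * Y ≤ (1 + 2 * h + g) * Y := by nlinarith
  have h3 : Y ≤ (1 + h / 2) * Y := by linarith
  have h4 : (1 + h / 2) * Y ≤ (1 + h) * Y := by linarith
  have hA := abs_le.mp (hC Y _ hY0.le h1)
  have hB := abs_le.mp (hC _ _ (by positivity) h2)
  have hA1 := abs_le.mp (hC Y _ hY0.le h3)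
  have hF := abs_le.mp (hC Y _ hY0.le (h1.trans h2))
  rw [sum_Ioc_mul_cutSign _ h1 h2] at hS₁
  refine ⟨⟨by linarith, by linarith⟩, ?_, ?_⟩
  · have h5 : -S₂ ≤ ∑ n ∈ Finset.Ioc ⌊Real.exp Y⌋₊ ⌊Real.exp ((1 + 2 * h + g) * Y)⌋₊,
        logPrimeDiv n * Real.log n := by
      rw [hS₂, ← Finset.sum_neg_distrib]
      refine Finset.sum_le_sum fun n _ => ?_
      rw [← mul_neg]
      refine mul_le_of_le_one_right
        (mul_nonneg (logPrimeDiv_nonneg n) (Real.log_natCast_nonneg n)) ?_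
      exact (neg_le_abs _).trans (abs_cutSign _ _).le
    have h6 := h5.trans sum_Ioc_logPrimeDiv_mul_log_le
    have h7 : (1 + 2 * h + g) * Y ≤ 2 * Y := by nlinarith
    have h8 : (1 + 2 * h + g) * Y * ∑ n ∈ Finset.Ioc ⌊Real.exp Y⌋₊
        ⌊Real.exp ((1 + 2 * h + g) * Y)⌋₊, logPrimeDiv n ≤ 2 * Y * (2 * Y) :=
      mul_le_mul h7 (by linarith) (Finset.sum_nonneg fun n _ => logPrimeDiv_nonneg n)
        (by positivity)
    nlinarith
  · rw [sum_Ioc_mul_cutSign _ h1 h2, ← Finset.sum_Ioc_consecutive _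
      (Nat.floor_mono (Real.exp_le_exp.mpr h3)) (Nat.floor_mono (Real.exp_le_exp.mpr h4))] at hS₂
    rw [← Finset.sum_Ioc_consecutive _
      (Nat.floor_mono (Real.exp_le_exp.mpr h3)) (Nat.floor_mono (Real.exp_le_exp.mpr h4))] at hA
    have hm1 := @sum_Ioc_logPrimeDiv_mul_log_le Y ((1 + h / 2) * Y)
    have hm2 := @sum_Ioc_logPrimeDiv_mul_log_le ((1 + h / 2) * Y) ((1 + h) * Y)
    have hm3 := @le_sum_Ioc_logPrimeDiv_mul_log ((1 + h) * Y) ((1 + 2 * h + g) * Y)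
    generalize ∑ n ∈ Finset.Ioc ⌊Real.exp Y⌋₊ ⌊Real.exp ((1 + h / 2) * Y)⌋₊,
      logPrimeDiv n = a₁ at *
    generalize ∑ n ∈ Finset.Ioc ⌊Real.exp ((1 + h / 2) * Y)⌋₊ ⌊Real.exp ((1 + h) * Y)⌋₊,
      logPrimeDiv n = a₂ at *
    generalize ∑ n ∈ Finset.Ioc ⌊Real.exp ((1 + h) * Y)⌋₊ ⌊Real.exp ((1 + 2 * h + g) * Y)⌋₊,
      logPrimeDiv n = b at *
    have h5 : S₂ ≤ (1 + h) * Y * (a₁ + a₂ - b) - h * Y / 2 * a₁ := by linarith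
    have h6 : (1 + h) * Y * (a₁ + a₂ - b) ≤ 2 * Y * (2 * C) := by
      have h7 : a₁ + a₂ - b ≤ 2 * C := by linarith
      calc _ ≤ (1 + h) * Y * (2 * C) := mul_le_mul_of_nonneg_left h7 (by positivity)
        _ ≤ _ := mul_le_mul_of_nonneg_right (by nlinarith) (by positivity)
    have h8 : h * Y / 2 * (h * Y / 2 - C) ≤ h * Y / 2 * a₁ :=
      mul_le_mul_of_nonneg_left (by linarith) (by positivity)
    have h9 : 80 * C * Y ≤ Y * h ^ 2 * Y := mul_le_mul_of_nonneg_right hYh hY0.le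
    have h10 : h * (C * Y) ≤ 1 / 4 * (C * Y) := mul_le_mul_of_nonneg_right hh4 (by positivity)
    nlinarith

end MainSums

section Target

lemma dirichletCharacter_prime_eq_zero_iff {q : ℕ} (χ : DirichletCharacter ℂ q) {p : ℕ} (hp : p.Prime) :
    χ p = 0 ↔ p ∣ q := by
  rw [← not_iff_not]
  constructor
  · intro h hpq
    refine h (χ.map_nonunit fun hu => ?_)
    rw [ZMod.isUnit_iff_coprime] at hu
    exact (hp.coprime_iff_not_dvd.mp hu) hpq
  · intro h h0
    have hu : IsUnit (p : ZMod q) := (ZMod.isUnit_iff_coprime p q).mpr (hp.coprime_iff_not_dvd.mpr h)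
    have := χ.unit_norm_eq_one hu.unit
    rw [hu.unit_spec, h0, norm_zero] at this
    exact zero_ne_one this

variable {q : ℕ} [NeZero q]

/-- The unimodular target for the twist: the value minimizing the Euler factors of `χ` for
`log n ≤ U`, and a sign beyond. -/
noncomputable def target (χ : DirichletCharacter ℂ q) (U V : ℝ) (n : ℕ) : ℂ :=
  open Classical in
  if Real.log n ≤ U then (if χ n = 0 then 1 else -(starRingEnd ℂ) (χ n)) else (cutSign V n : ℂ)

lemma norm_dirichletCharacter_eq_one {χ : DirichletCharacter ℂ q} {a : ZMod q} (h : χ a ≠ 0) :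
    ‖χ a‖ = 1 := by
  have hu : IsUnit a := by
    by_contra hu
    exact h (χ.map_nonunit hu)
  exact χ.unit_norm_eq_one hu.unit

lemma norm_target (χ : DirichletCharacter ℂ q) (U V : ℝ) (n : ℕ) : ‖target χ U V n‖ = 1 := by
  unfold target
  split_ifs with h1 h2
  · exact norm_one
  · rw [norm_neg, RCLike.norm_conj, norm_dirichletCharacter_eq_one h2]
  · rw [Complex.norm_real, Real.norm_eq_abs, abs_cutSign]

lemma exists_norm_sum_logPrimeDiv_mul_target_le {χ : DirichletCharacter ℂ q} (hχ : χ ≠ 1) :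
    ∃ C : ℝ, 0 ≤ C ∧ ∀ U V : ℝ, ∀ N ≤ ⌊Real.exp U⌋₊,
      ‖∑ n ∈ Finset.Ioc 0 N, (logPrimeDiv n : ℂ) * target χ U V n‖ ≤ C := by
  classical
  obtain ⟨C, hC0, hC⟩ := exists_norm_sum_dirichletCharacter_mul_logPrimeDiv_le hχ
  refine ⟨∑ p ∈ q.primeFactors, logPrimeDiv p + C,
    add_nonneg (Finset.sum_nonneg fun p _ => logPrimeDiv_nonneg p) hC0, fun U V N hN => ?_⟩
  have h1 : ∀ n ∈ Finset.Ioc 0 N, (logPrimeDiv n : ℂ) * target χ U V n =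
      ((if n ∈ q.primeFactors then logPrimeDiv n else 0 : ℝ) : ℂ) -
        (starRingEnd ℂ) (χ n * logPrimeDiv n) := fun n hn => by
    have h2 := (mem_Ioc_zero_floor_exp.mp (Finset.Ioc_subset_Ioc_right hN hn)).2
    rw [target, if_pos h2]
    by_cases hp : n.Prime
    · have h3 := dirichletCharacter_prime_eq_zero_iff χ hp
      by_cases h4 : n ∣ q
      · rw [if_pos (h3.mpr h4), if_pos (Nat.mem_primeFactors.mpr ⟨hp, h4, NeZero.ne q⟩), h3.mpr h4]
        simp
      · rw [if_neg (mt h3.mp h4), if_neg fun h => h4 (Nat.dvd_of_mem_primeFactors h)]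
        simp [mul_comm]
    · simp [logPrimeDiv, hp]
  rw [Finset.sum_congr rfl h1, Finset.sum_sub_distrib, ← map_sum, ← Complex.ofReal_sum]
  refine (norm_sub_le _ _).trans (add_le_add ?_ ?_)
  · have h2 : ∀ n, 0 ≤ (if n ∈ q.primeFactors then logPrimeDiv n else 0 : ℝ) := fun n => by
      split_ifs
      · exact logPrimeDiv_nonneg n
      · exact le_rfl
    rw [Complex.norm_real, Real.norm_of_nonneg (Finset.sum_nonneg fun n _ => h2 n),
      ← Finset.sum_filter]
    exact Finset.sum_le_sum_of_subset_of_nonneg (fun n hn => (Finset.mem_filter.mp hn).2)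
      fun n _ _ => logPrimeDiv_nonneg n
  · rw [RCLike.norm_conj]
    exact hC N

lemma norm_sum_mul_log_le {c : ℕ → ℂ} {C : ℝ} {N : ℕ}
    (hc : ∀ m ≤ N, ‖∑ n ∈ Finset.Ioc 0 m, c n‖ ≤ C) :
    ‖∑ n ∈ Finset.Ioc 0 N, c n * (Real.log n : ℂ)‖ ≤ 2 * C * Real.log N := by
  rcases Nat.eq_zero_or_pos N with rfl | hN
  · simp
  have hI : ∀ m, Finset.Ico 1 (m + 1) = Finset.Ioc 0 m := fun m => by ext; simp; omega
  have hC0 : 0 ≤ C := (norm_nonneg _).trans (hc N le_rfl)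
  have h1 := norm_sum_Ico_mul_le (fun n => Real.log N - Real.log n) c (C := C) (a := 1)
    (b := N + 1) (by omega) (fun n hn _ => by
      have : Real.log n ≤ Real.log ((n + 1 : ℕ) : ℝ) :=
        Real.log_le_log (by exact_mod_cast hn) (by push_cast; linarith)
      linarith) (by simp) (fun m hm => by
      rcases m with _ | m
      · simpa using hC0
      · rw [hI]
        exact hc m (by omega))
  rw [hI] at h1
  simp only [Nat.cast_one, Real.log_one, sub_zero] at h1
  have h2 : ∑ n ∈ Finset.Ioc 0 N, c n * (Real.log n : ℂ) =
      Real.log N * ∑ n ∈ Finset.Ioc 0 N, c n -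
        ∑ n ∈ Finset.Ioc 0 N, ((Real.log N - Real.log n : ℝ) : ℂ) * c n := by
    rw [Finset.mul_sum, ← Finset.sum_sub_distrib]
    refine Finset.sum_congr rfl fun n _ => ?_
    push_cast
    ring
  rw [h2]
  refine (norm_sub_le _ _).trans ?_
  rw [norm_mul, Complex.norm_real, Real.norm_of_nonneg (Real.log_natCast_nonneg N)]
  have h3 := mul_le_mul_of_nonneg_left (hc N le_rfl) (Real.log_natCast_nonneg N)
  linarith

lemma norm_sum_mul_cpow_sub_le {s : Finset ℕ} {c : ℕ → ℂ} {w : ℕ → ℝ} {K : ℝ}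
    (hs : ∀ n ∈ s, n ≠ 0 ∧ Real.log n ≤ K) (hc : ∀ n, ‖c n‖ ≤ w n) {v : ℂ} (hv : ‖v‖ * K ≤ 1) :
    ‖∑ n ∈ s, c n * (n : ℂ) ^ (-v) - (∑ n ∈ s, c n - v * ∑ n ∈ s, c n * (Real.log n : ℂ))‖ ≤
      (‖v‖ * K) ^ 2 * ∑ n ∈ s, w n := by
  have h1 : ∑ n ∈ s, c n * (n : ℂ) ^ (-v) - (∑ n ∈ s, c n - v * ∑ n ∈ s, c n * (Real.log n : ℂ)) =
      ∑ n ∈ s, c n * ((n : ℂ) ^ (-v) - 1 - (-(v * Real.log n))) := by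
    rw [Finset.mul_sum, ← Finset.sum_sub_distrib, ← Finset.sum_sub_distrib]
    exact Finset.sum_congr rfl fun n _ => by ring
  rw [h1, Finset.mul_sum]
  refine norm_sum_le_of_le _ fun n hn => ?_
  obtain ⟨hn0, hnK⟩ := hs n hn
  have h2 : ‖-(v * (Real.log n : ℂ))‖ ≤ ‖v‖ * K := by
    rw [norm_neg, norm_mul, Complex.norm_real, Real.norm_of_nonneg (Real.log_natCast_nonneg n)]
    exact mul_le_mul_of_nonneg_left hnK (norm_nonneg _)
  rw [norm_mul, natCast_cpow_neg_eq_exp hn0, mul_comm]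
  exact mul_le_mul ((Complex.norm_exp_sub_one_sub_id_le (h2.trans hv)).trans
    (pow_le_pow_left₀ (norm_nonneg _) h2 2)) (hc n) (norm_nonneg _) (by positivity)

lemma exists_norm_sum_target_sub_le {χ : DirichletCharacter ℂ q} (hχ : χ ≠ 1) :
    ∃ C : ℝ, 0 ≤ C ∧ ∀ Y V W : ℝ, 0 ≤ Y → Y ≤ W → ∀ v : ℂ, ‖v‖ * W ≤ 1 →
      ‖∑ n ∈ Finset.Ioc 0 ⌊Real.exp W⌋₊, (logPrimeDiv n : ℂ) * target χ Y V n * (n : ℂ) ^ (-v) -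
        (((∑ n ∈ Finset.Ioc ⌊Real.exp Y⌋₊ ⌊Real.exp W⌋₊, logPrimeDiv n * cutSign V n : ℝ) : ℂ) -
          v * ((∑ n ∈ Finset.Ioc ⌊Real.exp Y⌋₊ ⌊Real.exp W⌋₊,
            logPrimeDiv n * Real.log n * cutSign V n : ℝ) : ℂ))‖ ≤
        C + (‖v‖ * W) ^ 2 * expSum logPrimeDiv W := by
  obtain ⟨C, hC0, hC⟩ := exists_norm_sum_logPrimeDiv_mul_target_le hχ
  refine ⟨3 * C, by positivity, fun Y V W hY hYW v hv => ?_⟩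
  set c : ℕ → ℂ := fun n => (logPrimeDiv n : ℂ) * target χ Y V n with hcdef
  have h1 := norm_sum_mul_cpow_sub_le (s := Finset.Ioc 0 ⌊Real.exp W⌋₊) (c := c)
    (w := logPrimeDiv) (K := W) (fun n hn => mem_Ioc_zero_floor_exp.mp hn) (fun n => by
      rw [hcdef, norm_mul, norm_target, Complex.norm_real,
        Real.norm_of_nonneg (logPrimeDiv_nonneg n), mul_one]) hv
  have hsplit : ∀ f : ℕ → ℂ, ∑ n ∈ Finset.Ioc 0 ⌊Real.exp W⌋₊, c n * f n =
      ∑ n ∈ Finset.Ioc 0 ⌊Real.exp Y⌋₊, c n * f n +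
        ∑ n ∈ Finset.Ioc ⌊Real.exp Y⌋₊ ⌊Real.exp W⌋₊, (logPrimeDiv n * cutSign V n : ℂ) * f n :=
    fun f => by
      rw [← Finset.sum_Ioc_consecutive _ (Nat.zero_le _) (Nat.floor_mono (Real.exp_le_exp.mpr hYW))]
      congr 1
      refine Finset.sum_congr rfl fun n hn => ?_
      rw [hcdef]
      simp only [target, if_neg (mem_Ioc_floor_exp.mp hn).2.1.not_ge]
  have h2 := hsplit fun _ => 1
  have h3 := hsplit fun n => (Real.log n : ℂ)
  simp only [mul_one] at h2
  have h4 := hC Y V ⌊Real.exp Y⌋₊ le_rfl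
  have h5 := norm_sum_mul_log_le (c := c) (hC Y V) (N := ⌊Real.exp Y⌋₊)
  have h6 : Real.log ⌊Real.exp Y⌋₊ ≤ Y := by
    have h7 : (⌊Real.exp Y⌋₊ : ℝ) ≤ Real.exp Y := Nat.floor_le (Real.exp_pos Y).le
    have h8 : (0 : ℝ) < ⌊Real.exp Y⌋₊ := by
      exact_mod_cast Nat.floor_pos.mpr (Real.one_le_exp hY)
    exact (Real.log_le_log h8 h7).trans (Real.log_exp Y).le
  have h9 : ‖v‖ * ‖∑ n ∈ Finset.Ioc 0 ⌊Real.exp Y⌋₊, c n * (Real.log n : ℂ)‖ ≤ 2 * C := by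
    calc _ ≤ ‖v‖ * (2 * C * W) := by
          refine mul_le_mul_of_nonneg_left (h5.trans ?_) (norm_nonneg _)
          exact mul_le_mul_of_nonneg_left (h6.trans hYW) (by positivity)
      _ = 2 * C * (‖v‖ * W) := by ring
      _ ≤ _ := mul_le_of_le_one_right (by positivity) hv
  rw [h2, h3] at h1
  simp only [Complex.ofReal_sum, Complex.ofReal_mul]
  have h10 : ∀ n : ℕ, (logPrimeDiv n : ℂ) * (Real.log n : ℂ) * (cutSign V n : ℂ) =
      logPrimeDiv n * cutSign V n * (Real.log n : ℂ) := fun n => by ring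
  simp only [h10]
  generalize ∑ n ∈ Finset.Ioc 0 ⌊Real.exp W⌋₊, c n * (n : ℂ) ^ (-v) = A at *
  generalize ∑ n ∈ Finset.Ioc 0 ⌊Real.exp Y⌋₊, c n * (Real.log n : ℂ) = B₂ at *
  have h4' : ‖∑ n ∈ Finset.Ioc 0 ⌊Real.exp Y⌋₊, c n‖ ≤ C := h4
  generalize ∑ n ∈ Finset.Ioc 0 ⌊Real.exp Y⌋₊, c n = B₁ at *
  generalize ∑ n ∈ Finset.Ioc ⌊Real.exp Y⌋₊ ⌊Real.exp W⌋₊,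
    (logPrimeDiv n * cutSign V n : ℂ) = D₁ at *
  generalize ∑ n ∈ Finset.Ioc ⌊Real.exp Y⌋₊ ⌊Real.exp W⌋₊,
    (logPrimeDiv n * cutSign V n * (Real.log n : ℂ) : ℂ) = D₂ at *
  calc ‖A - (D₁ - v * D₂)‖ = ‖A - (B₁ + D₁ - v * (B₂ + D₂)) + B₁ - v * B₂‖ := by
        congr 1; ring
    _ ≤ ‖A - (B₁ + D₁ - v * (B₂ + D₂))‖ + ‖B₁‖ + ‖v * B₂‖ :=
        (norm_sub_le _ _).trans (add_le_add (norm_add_le _ _) le_rfl)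
    _ ≤ _ := by
        rw [norm_mul, expSum]
        linarith

end Target

section PrimeSum

lemma sum_Ioc_rpow_neg_one_sub_le {s : ℝ} (hs : 0 < s) {a b : ℕ} (ha : 1 ≤ a) (hab : a ≤ b) :
    ∑ n ∈ Finset.Ioc a b, (n : ℝ) ^ (-1 - s) ≤ (a : ℝ) ^ (-s) / s - (b : ℝ) ^ (-s) / s := by
  induction b, hab using Nat.le_induction with
  | base => simp
  | succ b hab ih =>
    rw [Finset.sum_Ioc_succ_top (by omega)]
    have hb0 : (0 : ℝ) < b := by exact_mod_cast (by omega : 0 < b)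
    have hb1 : (0 : ℝ) < ((b + 1 : ℕ) : ℝ) := by positivity
    have h1 : ((b + 1 : ℕ) : ℝ) ^ (-1 - s) ≤
        ((b : ℝ) ^ (-s) - ((b + 1 : ℕ) : ℝ) ^ (-s)) / s := by
      rw [le_div_iff₀ hs]
      set l := Real.log ((b + 1 : ℕ) : ℝ) - Real.log b with hl
      have h2 : 1 / ((b + 1 : ℕ) : ℝ) ≤ l := by
        rw [hl, ← Real.log_div hb1.ne' hb0.ne']
        refine le_trans (le_of_eq ?_) (Real.one_sub_inv_le_log_of_pos (by positivity))
        push_cast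
        field_simp
        ring
      have h3 : (b : ℝ) ^ (-s) = ((b + 1 : ℕ) : ℝ) ^ (-s) * Real.exp (s * l) := by
        rw [Real.rpow_def_of_pos hb0, Real.rpow_def_of_pos hb1, ← Real.exp_add, hl]
        ring_nf
      have h4 := Real.add_one_le_exp (s * l)
      have h5 : ((b + 1 : ℕ) : ℝ) ^ (-1 - s) =
          ((b + 1 : ℕ) : ℝ) ^ (-s) * (1 / ((b + 1 : ℕ) : ℝ)) := by
        rw [show -1 - s = -s + -1 by ring, Real.rpow_add hb1, Real.rpow_neg_one, one_div]
      rw [h3, h5]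
      have h6 : 0 < ((b + 1 : ℕ) : ℝ) ^ (-s) := Real.rpow_pos_of_pos hb1 _
      have h7 : s * (1 / ((b + 1 : ℕ) : ℝ)) ≤ s * l := mul_le_mul_of_nonneg_left h2 hs.le
      nlinarith
    rw [sub_div] at h1
    linarith

lemma sum_Ioc_logPrimeDiv_mul_rpow_le {σ : ℝ} (hσ : 0 < σ) {a : ℕ} (ha : 1 ≤ a) (b : ℕ) :
    ∑ n ∈ Finset.Ioc a b, logPrimeDiv n * (n : ℝ) ^ (-σ) ≤ 4 / σ ^ 2 * (a : ℝ) ^ (-(σ / 2)) := by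
  rcases lt_or_ge b a with hab | hab
  · rw [Finset.Ioc_eq_empty (by omega), Finset.sum_empty]
    positivity
  have h1 := sum_Ioc_rpow_neg_one_sub_le (half_pos hσ) ha hab
  calc _ ≤ ∑ n ∈ Finset.Ioc a b, 2 / σ * (n : ℝ) ^ (-1 - σ / 2) := by
        refine Finset.sum_le_sum fun n hn => ?_
        have hn0 : (0 : ℝ) < n := by
          have := (Finset.mem_Ioc.mp hn).1
          exact_mod_cast (by omega : 0 < n)
        have h2 : logPrimeDiv n ≤ 2 / σ * (n : ℝ) ^ (σ / 2 - 1) := by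
          unfold logPrimeDiv
          split_ifs
          · rw [Real.rpow_sub_one hn0.ne', ← mul_div_assoc]
            refine div_le_div_of_nonneg_right ?_ hn0.le
            refine (Real.log_le_rpow_div hn0.le (half_pos hσ)).trans (le_of_eq ?_)
            field_simp
          · positivity
        calc _ ≤ 2 / σ * (n : ℝ) ^ (σ / 2 - 1) * (n : ℝ) ^ (-σ) :=
              mul_le_mul_of_nonneg_right h2 (by positivity)
          _ = _ := by
              rw [mul_assoc, ← Real.rpow_add hn0]
              ring_nf
    _ ≤ 2 / σ * ((a : ℝ) ^ (-(σ / 2)) / (σ / 2)) := by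
        rw [← Finset.mul_sum]
        refine mul_le_mul_of_nonneg_left ?_ (by positivity)
        have : 0 ≤ (b : ℝ) ^ (-(σ / 2)) / (σ / 2) := by positivity
        linarith
    _ = _ := by
        field_simp
        norm_num

/-- The tail bound becomes negligible in the ranges under consideration. -/
lemma eventually_tail_le {c : ℝ} (hc : 0 < c) : ∀ᶠ Y : ℝ in Filter.atTop, ∀ σ : ℝ, ∀ P : ℕ,
    c / Y ≤ σ → Real.exp (Y ^ 3) ≤ P → ∀ b : ℕ,
      ∑ n ∈ Finset.Ioc P b, logPrimeDiv n * (n : ℝ) ^ (-σ) ≤ 1 / Y := by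
  filter_upwards [Filter.eventually_ge_atTop 1,
    eventually_mul_pow_le_exp (4 / c ^ 2) 3 (half_pos hc)] with Y hY1 hY σ P hσ hP b
  have hY0 : 0 < Y := by linarith
  have hσ0 : 0 < σ := lt_of_lt_of_le (by positivity) hσ
  have hP0 : (0 : ℝ) < P := (Real.exp_pos _).trans_le hP
  refine (sum_Ioc_logPrimeDiv_mul_rpow_le hσ0 (by exact_mod_cast hP0) b).trans ?_
  have h1 : 4 / σ ^ 2 ≤ 4 / (c / Y) ^ 2 :=
    div_le_div_of_nonneg_left (by norm_num) (by positivity)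
      (pow_le_pow_left₀ (by positivity) hσ 2)
  have h2 : (P : ℝ) ^ (-(σ / 2)) ≤ 1 / (4 / c ^ 2 * Y ^ 3) := by
    calc (P : ℝ) ^ (-(σ / 2)) ≤ Real.exp (Y ^ 3) ^ (-(σ / 2)) :=
          Real.rpow_le_rpow_of_nonpos (Real.exp_pos _) hP (by linarith)
      _ = Real.exp (-(Y ^ 3 * (σ / 2))) := by
          rw [← Real.exp_mul]
          ring_nf
      _ ≤ Real.exp (-(c / 2 * Y)) := by
          refine Real.exp_le_exp.mpr (neg_le_neg ?_)
          have h3 : c ≤ σ * Y := by rwa [div_le_iff₀ hY0] at hσ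
          calc c / 2 * Y ≤ σ * Y / 2 * Y * Y :=
                (mul_le_mul_of_nonneg_right (by linarith) hY0.le).trans
                  (le_mul_of_one_le_right (by positivity) hY1)
            _ = _ := by ring
      _ ≤ _ := by
          rw [Real.exp_neg, ← one_div]
          exact one_div_le_one_div_of_le (by positivity) hY
  calc _ ≤ 4 / (c / Y) ^ 2 * (1 / (4 / c ^ 2 * Y ^ 3)) :=
        mul_le_mul h1 h2 (by positivity) (by positivity)
    _ = _ := by field_simp

variable {q : ℕ} [NeZero q]

/-- `1 / p` at primes `p`. -/
noncomputable def primeInv (n : ℕ) : ℝ := if n.Prime then 1 / n else 0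

lemma primeInv_nonneg (n : ℕ) : 0 ≤ primeInv n := by
  unfold primeInv
  split_ifs <;> positivity

lemma primeInv_le (n : ℕ) : primeInv n ≤ 2 * logPrimeDiv n := by
  unfold primeInv logPrimeDiv
  split_ifs with h
  · have h1 : Real.log 2 ≤ Real.log n := Real.log_le_log two_pos (by exact_mod_cast h.two_le)
    have := Real.log_two_gt_d9
    rw [← mul_div_assoc]
    exact div_le_div_of_nonneg_right (by linarith) (Nat.cast_nonneg n)
  · norm_num

/-- The properties of the shift `t` used in the construction. -/
structure IsGoodShift (χ : DirichletCharacter ℂ q) (Y V W t : ℝ) (P : ℕ) : Prop where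
  le_cube : W ≤ Y ^ 3
  exp_le : Real.exp (Y ^ 3) ≤ P
  sum_near_le : expSum (fun p => logPrimeDiv p * ‖twist t p - target χ Y V p‖) W ≤ 2 / Y
  tail_log_le : ∀ v : ℂ, 0 ≤ v.re → ‖v‖ ≤ 1 →
    ‖∑ m ∈ Finset.Ioc ⌊Real.exp W⌋₊ P, (logPrimeDiv m : ℂ) * twist t m * (m : ℂ) ^ (-v)‖ ≤ 3 / Y
  tail_char_le : ∀ v : ℂ, 0 ≤ v.re → ‖v‖ ≤ 1 →
    ‖∑ m ∈ Finset.Ioc ⌊Real.exp W⌋₊ P, χ m * (primeInv m : ℂ) * twist t m * (m : ℂ) ^ (-v)‖ ≤ 3 / Y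

lemma eventually_exists_isGoodShift (χ : DirichletCharacter ℂ q) {κ h : ℝ} (hκ1 : 1 ≤ κ)
    (hκ2 : κ ≤ 2) (hh : 0 < h) (T : ℝ) : ∀ᶠ Y : ℝ in Filter.atTop, ∀ V : ℝ, ∃ t : ℝ, ∃ P : ℕ,
      T < t ∧ Real.log (Real.log (t + 1)) ≤ (κ + 2 * h) * Y ∧
      IsGoodShift χ Y V (κ * Y) t P := by
  filter_upwards [Filter.eventually_ge_atTop 2, eventually_exists_twist
    (fun k n => if k then χ n * (primeInv n : ℂ) else (logPrimeDiv n : ℂ)) (fun k n => by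
      rcases k with _ | _
      · simp only [Bool.false_eq_true, if_false, Complex.norm_real, Real.norm_of_nonneg
          (logPrimeDiv_nonneg n)]
        have := logPrimeDiv_nonneg n
        linarith
      · simp only [if_true, norm_mul, Complex.norm_real, Real.norm_of_nonneg (primeInv_nonneg n)]
        exact (mul_le_of_le_one_left (primeInv_nonneg n) (χ.norm_le_one n)).trans (primeInv_le n))
    hκ1 hκ2 hh T] with Y hY2 hY V
  obtain ⟨t, ht, hlog, hsum, P, hP, htail⟩ := hY (fun p => (starRingEnd ℂ) (target χ Y V p))
    fun p => by rw [RCLike.norm_conj, norm_target]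
  refine ⟨t, P, ht, hlog, ?_, hP, ?_, fun v hv hv1 => ?_, fun v hv hv1 => ?_⟩
  · calc κ * Y ≤ 2 * Y := mul_le_mul_of_nonneg_right hκ2 (by linarith)
      _ ≤ Y ^ 2 * Y := mul_le_mul_of_nonneg_right (by nlinarith) (by linarith)
      _ = Y ^ 3 := by ring
  · convert hsum using 4 with p
    have h1 : twist t p - target χ Y V p =
        target χ Y V p * ((starRingEnd ℂ) (target χ Y V p) * twist t p - 1) := by
      have h2 : target χ Y V p * (starRingEnd ℂ) (target χ Y V p) = 1 := by
        rw [Complex.mul_conj, Complex.normSq_eq_norm_sq, norm_target]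
        norm_num
      rw [mul_sub, ← mul_assoc, h2]
      ring
    rw [h1, norm_mul, norm_target, one_mul]
  · simpa using htail false v hv hv1
  · simpa using htail true v hv hv1

/-- The prime sum close to the line `Re s = 1` is approximated by a linear function. -/
lemma exists_norm_sum_twist_sub_le {χ : DirichletCharacter ℂ q} (hχ : χ ≠ 1) :
    ∃ C : ℝ, 0 ≤ C ∧ ∀ c : ℝ, 0 < c → ∀ᶠ Y : ℝ in Filter.atTop, ∀ V W t : ℝ, ∀ P : ℕ, Y ≤ W →
      IsGoodShift χ Y V W t P → ∀ v : ℂ, c / Y ≤ v.re → ‖v‖ * W ≤ 1 →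
      ∀ b : ℕ, P ≤ b →
      ‖∑ n ∈ Finset.Ioc 0 b, (logPrimeDiv n : ℂ) * twist t n * (n : ℂ) ^ (-v) -
        (((∑ n ∈ Finset.Ioc ⌊Real.exp Y⌋₊ ⌊Real.exp W⌋₊, logPrimeDiv n * cutSign V n : ℝ) : ℂ) -
          v * ((∑ n ∈ Finset.Ioc ⌊Real.exp Y⌋₊ ⌊Real.exp W⌋₊,
            logPrimeDiv n * Real.log n * cutSign V n : ℝ) : ℂ))‖ ≤
        C + (‖v‖ * W) ^ 2 * expSum logPrimeDiv W := by
  obtain ⟨C, hC0, hC⟩ := exists_norm_sum_target_sub_le hχ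
  refine ⟨C + 6, by positivity, fun c hc => ?_⟩
  filter_upwards [Filter.eventually_ge_atTop 1, eventually_tail_le hc]
    with Y hY1 htail V W t P hYW ht v hv hvW b hb
  have hY0 : 0 < Y := by linarith
  have hW0 : 0 < W := by linarith
  have hv0 : 0 < v.re := lt_of_lt_of_le (by positivity) hv
  have hv1 : ‖v‖ ≤ 1 := by nlinarith [norm_nonneg v]
  have hmain := hC Y V W hY0.le hYW v hvW
  set A := ((∑ n ∈ Finset.Ioc ⌊Real.exp Y⌋₊ ⌊Real.exp W⌋₊, logPrimeDiv n * cutSign V n : ℝ) : ℂ) -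
          v * ((∑ n ∈ Finset.Ioc ⌊Real.exp Y⌋₊ ⌊Real.exp W⌋₊,
            logPrimeDiv n * Real.log n * cutSign V n : ℝ) : ℂ)
  have hzP : ⌊Real.exp W⌋₊ ≤ P := by
    have h1 : (⌊Real.exp W⌋₊ : ℝ) ≤ P := (Nat.floor_le (Real.exp_pos W).le).trans
      ((Real.exp_le_exp.mpr ht.le_cube).trans ht.exp_le)
    exact_mod_cast h1
  rw [← Finset.sum_Ioc_consecutive _ (Nat.zero_le _) (hzP.trans hb),
    ← Finset.sum_Ioc_consecutive _ hzP hb]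
  have h1 : ‖∑ n ∈ Finset.Ioc 0 ⌊Real.exp W⌋₊,
      (logPrimeDiv n : ℂ) * twist t n * (n : ℂ) ^ (-v) - ∑ n ∈ Finset.Ioc 0 ⌊Real.exp W⌋₊,
      (logPrimeDiv n : ℂ) * target χ Y V n * (n : ℂ) ^ (-v)‖ ≤ 2 / Y := by
    rw [← Finset.sum_sub_distrib]
    refine le_trans (norm_sum_le_of_le _ fun n hn => ?_) ht.sum_near_le
    rw [← sub_mul, ← mul_sub, norm_mul, norm_mul, Complex.norm_real,
      Real.norm_of_nonneg (logPrimeDiv_nonneg n)]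
    exact mul_le_of_le_one_right (mul_nonneg (logPrimeDiv_nonneg n) (norm_nonneg _))
      (norm_natCast_cpow_neg_le_one (mem_Ioc_zero_floor_exp.mp hn).1 hv0.le)
  have h2 := ht.tail_log_le v hv0.le hv1
  have h3 : ‖∑ n ∈ Finset.Ioc P b, (logPrimeDiv n : ℂ) * twist t n * (n : ℂ) ^ (-v)‖ ≤ 1 / Y := by
    refine le_trans (norm_sum_le_of_le _ fun n hn => ?_) (htail v.re P hv ht.exp_le b)
    have hn0 : n ≠ 0 := by
      have := (Finset.mem_Ioc.mp hn).1
      omega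
    rw [norm_mul, norm_mul, Complex.norm_real, Real.norm_of_nonneg (logPrimeDiv_nonneg n),
      norm_twist t hn0, mul_one, Complex.norm_natCast_cpow_of_pos (Nat.pos_of_ne_zero hn0),
      Complex.neg_re]
  have h4 : 2 / Y + 3 / Y + 1 / Y ≤ 6 := by
    rw [← add_div, ← add_div, div_le_iff₀ hY0]
    linarith
  generalize ∑ n ∈ Finset.Ioc 0 ⌊Real.exp W⌋₊,
    (logPrimeDiv n : ℂ) * twist t n * (n : ℂ) ^ (-v) = B₁ at *
  generalize ∑ n ∈ Finset.Ioc 0 ⌊Real.exp W⌋₊,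
    (logPrimeDiv n : ℂ) * target χ Y V n * (n : ℂ) ^ (-v) = B₂ at *
  generalize ∑ n ∈ Finset.Ioc ⌊Real.exp W⌋₊ P,
    (logPrimeDiv n : ℂ) * twist t n * (n : ℂ) ^ (-v) = B₃ at *
  generalize ∑ n ∈ Finset.Ioc P b,
    (logPrimeDiv n : ℂ) * twist t n * (n : ℂ) ^ (-v) = B₄ at *
  calc ‖B₁ + (B₃ + B₄) - A‖ = ‖B₁ - B₂ + (B₂ - A) + B₃ + B₄‖ := by congr 1; ring
    _ ≤ ‖B₁ - B₂‖ + ‖B₂ - A‖ + ‖B₃‖ + ‖B₄‖ :=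
        (norm_add_le _ _).trans (add_le_add ((norm_add_le _ _).trans
          (add_le_add (norm_add_le _ _) le_rfl)) le_rfl)
    _ ≤ _ := by linarith

end PrimeSum

section LogDeriv

lemma natCast_cpow_neg_one_add {n : ℕ} (hn : n ≠ 0) (v : ℂ) (t : ℝ) :
    (n : ℂ) ^ (-(1 + v + t * Complex.I)) = 1 / n * twist t n * (n : ℂ) ^ (-v) := by
  have h0 : (n : ℂ) ≠ 0 := by exact_mod_cast hn
  rw [twist, show -(1 + v + t * Complex.I) = -1 + -(t * Complex.I) + -v by ring,
    Complex.cpow_add _ _ h0, Complex.cpow_add _ _ h0, Complex.cpow_neg_one, one_div]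

lemma norm_LSeries_sub_le {f : ℕ → ℂ} {s A : ℂ} {E : ℝ} {P : ℕ} (hs : LSeriesSummable f s)
    (h : ∀ b, P ≤ b → ‖∑ n ∈ Finset.Ioc 0 b, f n * (n : ℂ) ^ (-s) - A‖ ≤ E) :
    ‖LSeries f s - A‖ ≤ E := by
  have h1 := (hs.hasSum.tendsto_sum_nat.sub_const A).norm
  refine le_of_tendsto h1 (Filter.eventually_atTop.mpr ⟨P + 1, fun b hb => ?_⟩)
  obtain ⟨b, rfl⟩ : ∃ b', b = b' + 1 := ⟨b - 1, by omega⟩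
  have h2 : Finset.Ioc 0 b = (Finset.range (b + 1)).erase 0 := by
    ext n
    simp only [Finset.mem_Ioc, Finset.mem_erase, Finset.mem_range]
    omega
  have hsum : ∑ n ∈ Finset.range (b + 1), LSeries.term f s n =
      ∑ n ∈ Finset.Ioc 0 b, f n * (n : ℂ) ^ (-s) := by
    rw [h2, ← Finset.sum_erase (Finset.range (b + 1)) (a := 0) (by simp)]
    refine Finset.sum_congr rfl fun n hn => ?_
    rw [LSeries.term_of_ne_zero (Finset.ne_of_mem_erase hn), Complex.cpow_neg, div_eq_mul_inv]
  show ‖∑ n ∈ Finset.range (b + 1), LSeries.term f s n - A‖ ≤ E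
  rw [hsum]
  exact h b (by omega)

variable {q : ℕ} [NeZero q]

lemma exists_norm_LSeries_vonMangoldt_sub_le {χ : DirichletCharacter ℂ q} (hχ : χ ≠ 1) :
    ∃ C : ℝ, 0 ≤ C ∧ ∀ c : ℝ, 0 < c → ∀ᶠ Y : ℝ in Filter.atTop, ∀ V W t : ℝ, ∀ P : ℕ, Y ≤ W →
      IsGoodShift χ Y V W t P → ∀ v : ℂ, c / Y ≤ v.re → ‖v‖ * W ≤ 1 →
      ‖LSeries (fun n => (ArithmeticFunction.vonMangoldt n : ℂ)) (1 + v + t * Complex.I) -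
        (((∑ n ∈ Finset.Ioc ⌊Real.exp Y⌋₊ ⌊Real.exp W⌋₊, logPrimeDiv n * cutSign V n : ℝ) : ℂ) -
          v * ((∑ n ∈ Finset.Ioc ⌊Real.exp Y⌋₊ ⌊Real.exp W⌋₊,
            logPrimeDiv n * Real.log n * cutSign V n : ℝ) : ℂ))‖ ≤
        C + (‖v‖ * W) ^ 2 * expSum logPrimeDiv W := by
  obtain ⟨C, hC0, hC⟩ := exists_norm_sum_twist_sub_le hχ
  obtain ⟨C', hC0', hC'⟩ := exists_sum_vonMangoldt_not_prime_le
  refine ⟨C + C', by positivity, fun c hc => ?_⟩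
  filter_upwards [Filter.eventually_ge_atTop 1, hC c hc] with Y hY1 hY V W t P hYW ht v hv hvW
  have hv0 : 0 < v.re := lt_of_lt_of_le (by positivity) hv
  refine norm_LSeries_sub_le (P := P) (ArithmeticFunction.LSeriesSummable_vonMangoldt (by simpa))
    fun b hb => ?_
  have h1 := hY V W t P hYW ht v hv hvW b hb
  set r : ℕ → ℝ := fun n => (if n.Prime then 0 else ArithmeticFunction.vonMangoldt n) / (n : ℝ)
  have hr : ∀ n, 0 ≤ r n := fun n => by
    simp only [r]
    split_ifs <;> positivity [ArithmeticFunction.vonMangoldt_nonneg (n := n)]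
  have h2 : ∑ n ∈ Finset.Ioc 0 b, (ArithmeticFunction.vonMangoldt n : ℂ) *
      (n : ℂ) ^ (-(1 + v + t * Complex.I)) =
      ∑ n ∈ Finset.Ioc 0 b, (logPrimeDiv n : ℂ) * twist t n * (n : ℂ) ^ (-v) +
      ∑ n ∈ Finset.Ioc 0 b, (r n : ℂ) * twist t n * (n : ℂ) ^ (-v) := by
    rw [← Finset.sum_add_distrib]
    refine Finset.sum_congr rfl fun n hn => ?_
    have hn0 : n ≠ 0 := (Finset.mem_Ioc.mp hn).1.ne'
    have h3 : ((ArithmeticFunction.vonMangoldt n / (n : ℝ) : ℝ) : ℂ) = logPrimeDiv n + r n := by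
      rw [vonMangoldt_div_eq, Complex.ofReal_add]
    push_cast at h3
    rw [natCast_cpow_neg_one_add hn0, ← add_mul, ← add_mul, ← h3]
    ring
  have h4 : ‖∑ n ∈ Finset.Ioc 0 b, (r n : ℂ) * twist t n * (n : ℂ) ^ (-v)‖ ≤ C' := by
    refine le_trans (norm_sum_le_of_le _ fun n hn => ?_) (hC' (Finset.Ioc 0 b))
    have hn0 : n ≠ 0 := (Finset.mem_Ioc.mp hn).1.ne'
    rw [norm_mul, norm_mul, Complex.norm_real, Real.norm_of_nonneg (hr n), norm_twist t hn0,
      mul_one]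
    exact mul_le_of_le_one_right (hr n) (norm_natCast_cpow_neg_le_one hn0 hv0.le)
  rw [h2, add_sub_right_comm]
  refine (norm_add_le _ _).trans ?_
  linarith

/-- A function close to a linear one on a disc has a zero in it. -/
lemma exists_eq_zero_of_norm_sub_le {f : ℂ → ℂ} (hf : AnalyticOnNhd ℂ f {v | 0 < v.re})
    {S₁ S₂ d E : ℝ} (hd : 0 < d) (hS : S₁ = d * S₂) (hE : 8 * E < |S₁|)
    (h : ∀ v ∈ Metric.closedBall (d : ℂ) (d / 2), ‖f v - (S₁ - v * S₂)‖ ≤ E) :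
    ∃ v ∈ Metric.closedBall (d : ℂ) (d / 2), f v = 0 := by
  have hre : ∀ v ∈ Metric.closedBall (d : ℂ) (d / 2), 0 < v.re := fun v hv => by
    rw [Metric.mem_closedBall, dist_eq_norm] at hv
    have h1 := (abs_le.mp ((Complex.abs_re_le_norm (v - d)).trans hv)).1
    rw [Complex.sub_re, Complex.ofReal_re] at h1
    linarith
  have hc := h d (Metric.mem_closedBall_self (by positivity))
  have hS' : (S₁ : ℂ) = d * S₂ := by rw [hS]; push_cast; rfl
  rw [hS', sub_self, sub_zero] at hc
  have hE0 : 0 ≤ E := (norm_nonneg _).trans hc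
  have hsph : ∀ v ∈ Metric.sphere (d : ℂ) (d / 2), 2 * E < ‖f v - f d‖ ∧
      |S₁| / 2 - 2 * E ≤ ‖f v - f d‖ := fun v hv => by
    have h1 := h v (Metric.sphere_subset_closedBall hv)
    rw [mem_sphere_iff_norm] at hv
    have h2 : ‖(S₁ : ℂ) - v * S₂‖ = |S₁| / 2 := by
      rw [hS', ← sub_mul, norm_mul, norm_sub_rev, hv, Complex.norm_real, Real.norm_eq_abs, hS,
        abs_mul, abs_of_pos hd]
      ring
    have h3 : ‖(S₁ : ℂ) - v * S₂‖ ≤ ‖f v - (S₁ - v * S₂)‖ + ‖f v - f d‖ + ‖f d‖ := by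
      calc _ = ‖-(f v - (S₁ - v * S₂)) + (f v - f d) + f d‖ := by congr 1; ring
        _ ≤ _ := (norm_add_le _ _).trans (add_le_add ((norm_add_le _ _).trans
            (by rw [norm_neg])) le_rfl)
    constructor <;> linarith
  have hdiff : DiffContOnCl ℂ f (Metric.ball (d : ℂ) (d / 2)) := by
    refine DifferentiableOn.diffContOnCl fun v hv => ?_
    rw [closure_ball _ (by positivity)] at hv
    exact (hf v (hre v hv)).differentiableAt.differentiableWithinAt
  have hfreq : ∃ᶠ v in nhds (d : ℂ), f v ≠ f d := by
    intro hev
    have hev' : f =ᶠ[nhds (d : ℂ)] fun _ => f d := by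
      filter_upwards [hev] with v hv
      simpa using hv
    have hconv : IsPreconnected {v : ℂ | 0 < v.re} := (convex_halfSpace_re_gt 0).isPreconnected
    have heq := hf.eqOn_of_preconnected_of_eventuallyEq analyticOnNhd_const hconv
      (show (d : ℂ) ∈ {v : ℂ | 0 < v.re} by simpa) hev'
    have hmem : (d : ℂ) + (d / 2 : ℝ) ∈ Metric.sphere (d : ℂ) (d / 2) := by
      rw [mem_sphere_iff_norm, add_sub_cancel_left, Complex.norm_real, Real.norm_of_nonneg]
      positivity
    have h1 := (hsph _ hmem).1
    rw [heq (hre _ (Metric.sphere_subset_closedBall hmem)), sub_self, norm_zero] at h1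
    linarith
  have hball := hdiff.ball_subset_image_closedBall (by positivity) (fun v hv => (hsph v hv).2) hfreq
  have h0 : (0 : ℂ) ∈ Metric.ball (f d) ((|S₁| / 2 - 2 * E) / 2) := by
    rw [mem_ball_iff_norm, zero_sub, norm_neg]
    linarith
  exact hball h0

end LogDeriv

section Zero

lemma deriv_riemannZeta_eq_zero_of_LSeries_eq_zero {s : ℂ} (hs : 1 < s.re)
    (h : LSeries (fun n => (ArithmeticFunction.vonMangoldt n : ℂ)) s = 0) :
    deriv riemannZeta s = 0 := by
  have h1 := ArithmeticFunction.LSeries_vonMangoldt_eq_deriv_riemannZeta_div hs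
  rw [h] at h1
  rcases div_eq_zero_iff.mp h1.symm with h2 | h2
  · exact neg_eq_zero.mp h2
  · exact absurd h2 (riemannZeta_ne_zero_of_one_le_re hs.le)

lemma analyticOnNhd_LSeries_vonMangoldt (t : ℝ) : AnalyticOnNhd ℂ
    (fun v => LSeries (fun n => (ArithmeticFunction.vonMangoldt n : ℂ)) (1 + v + t * Complex.I))
    {v | 0 < v.re} := by
  have habs : LSeries.abscissaOfAbsConv
      (fun n => (ArithmeticFunction.vonMangoldt n : ℂ)) ≤ (1 : ℝ) :=
    LSeries.abscissaOfAbsConv_le_of_forall_lt_LSeriesSummable fun y hy =>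
      ArithmeticFunction.LSeriesSummable_vonMangoldt (by simpa using hy)
  intro v hv
  have h1 := LSeries_analyticOnNhd (fun n => (ArithmeticFunction.vonMangoldt n : ℂ))
    (1 + v + t * Complex.I) (lt_of_le_of_lt habs (EReal.coe_lt_coe_iff.mpr (by simpa using hv)))
  exact AnalyticAt.comp (f := fun v : ℂ => 1 + v + t * Complex.I) h1 (by fun_prop)

variable {q : ℕ} [NeZero q]

/-- A critical point of the zeta function close to `1 + t * I`. -/
lemma eventually_exists_deriv_riemannZeta_eq_zero {χ : DirichletCharacter ℂ q} (hχ : χ ≠ 1)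
    {h g : ℝ} (hh : 0 < h) (hh4 : h ≤ 1 / 4) (hg : g = h ^ 4 / 2000000) :
    ∀ᶠ Y : ℝ in Filter.atTop, ∀ t : ℝ, ∀ P : ℕ,
      IsGoodShift χ Y ((1 + h) * Y) ((1 + 2 * h + g) * Y) t P →
      ∃ v : ℂ, g / 24 / Y ≤ v.re ∧ ‖v‖ * Y ≤ 24 * g / h ^ 2 ∧
        deriv riemannZeta (1 + v + t * Complex.I) = 0 := by
  have hg0 : 0 < g := by rw [hg]; positivity
  have hh2 : h ^ 2 ≤ 1 / 16 := by nlinarith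
  have hgh2 : g ≤ h ^ 2 / 2000000 := by
    rw [hg, show h ^ 4 = h ^ 2 * h ^ 2 by ring]
    nlinarith [sq_nonneg h]
  have hgh : g ≤ h := by nlinarith
  obtain ⟨C, hC0, hC⟩ := exists_norm_LSeries_vonMangoldt_sub_le hχ
  obtain ⟨C', hC0', hC'⟩ := abs_sum_logPrimeDiv_exp_sub_le
  filter_upwards [Filter.eventually_ge_atTop 1, Filter.eventually_ge_atTop C',
    Filter.eventually_ge_atTop (64 * C / g), hC (g / 24) (by positivity),
    eventually_signed_moments hh hh4 hg0 hgh] with Y hY1 hYC' hYC hY hS t P ht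
  rw [div_le_iff₀ hg0] at hYC
  have hY0 : 0 < Y := by linarith
  obtain ⟨S₁, hS₁⟩ : ∃ S₁ : ℝ, S₁ = ∑ n ∈ Finset.Ioc ⌊Real.exp Y⌋₊
    ⌊Real.exp ((1 + 2 * h + g) * Y)⌋₊, logPrimeDiv n * cutSign ((1 + h) * Y) n := ⟨_, rfl⟩
  obtain ⟨S₂, hS₂⟩ : ∃ S₂ : ℝ, S₂ = ∑ n ∈ Finset.Ioc ⌊Real.exp Y⌋₊
    ⌊Real.exp ((1 + 2 * h + g) * Y)⌋₊, logPrimeDiv n * Real.log n * cutSign ((1 + h) * Y) n :=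
      ⟨_, rfl⟩
  obtain ⟨⟨hS₁l, hS₁u⟩, hS₂l, hS₂u⟩ := hS S₁ S₂ hS₁ hS₂
  have hgY : 0 < g * Y := by positivity
  have hhY : 0 < h ^ 2 * Y ^ 2 := by positivity
  have hS₁0 : S₁ < 0 := by linarith
  have hS₂0 : S₂ < 0 := by linarith
  obtain ⟨d, hd⟩ : ∃ d, d = S₁ / S₂ := ⟨_, rfl⟩
  have hd0 : 0 < d := by rw [hd]; exact div_pos_of_neg_of_neg hS₁0 hS₂0
  have hdS : S₁ = d * S₂ := by rw [hd, div_mul_cancel₀ _ hS₂0.ne]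
  have hdl : g / 12 ≤ d * Y := by
    have h1 : g * Y / 2 ≤ d * (6 * Y ^ 2) := by nlinarith
    have h2 : g / 2 * Y ≤ 6 * (d * Y) * Y := by linarith
    have := le_of_mul_le_mul_right h2 hY0
    linarith
  have hdu : d * Y ≤ 16 * g / h ^ 2 := by
    rw [le_div_iff₀ (by positivity)]
    have h1 : d * (h ^ 2 * Y ^ 2 / 8) ≤ 2 * g * Y := by nlinarith
    have h2 : d * Y * h ^ 2 * Y ≤ 16 * g * Y := by linarith
    exact le_of_mul_le_mul_right h2 hY0
  have hball : ∀ v ∈ Metric.closedBall (d : ℂ) (d / 2),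
      g / 24 / Y ≤ v.re ∧ ‖v‖ * Y ≤ 24 * g / h ^ 2 := fun v hv => by
    rw [Metric.mem_closedBall, dist_eq_norm] at hv
    constructor
    · have h1 := (abs_le.mp ((Complex.abs_re_le_norm (v - d)).trans hv)).1
      rw [Complex.sub_re, Complex.ofReal_re] at h1
      rw [div_le_iff₀ hY0]
      nlinarith
    · have h1 : ‖v‖ ≤ 3 / 2 * d := by
        calc ‖v‖ = ‖(v - d) + d‖ := by rw [sub_add_cancel]
          _ ≤ ‖v - d‖ + ‖(d : ℂ)‖ := norm_add_le _ _
          _ ≤ d / 2 + d := add_le_add hv (by rw [Complex.norm_real, Real.norm_of_nonneg hd0.le])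
          _ = _ := by ring
      calc ‖v‖ * Y ≤ 3 / 2 * d * Y := mul_le_mul_of_nonneg_right h1 hY0.le
        _ ≤ 3 / 2 * (16 * g / h ^ 2) := by linarith
        _ = _ := by ring
  have hκ : 1 + 2 * h + g ≤ 2 := by linarith
  have hW2 : (1 + 2 * h + g) * Y ≤ 2 * Y := mul_le_mul_of_nonneg_right hκ hY0.le
  have hW1 : Y ≤ (1 + 2 * h + g) * Y := le_mul_of_one_le_left hY0.le (by linarith)
  have hexp : expSum logPrimeDiv ((1 + 2 * h + g) * Y) ≤ 3 * Y := by
    have h1 := (abs_le.mp (hC' ((1 + 2 * h + g) * Y) (by positivity))).2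
    rw [expSum]
    linarith
  have hvW : ∀ v ∈ Metric.closedBall (d : ℂ) (d / 2),
      ‖v‖ * ((1 + 2 * h + g) * Y) ≤ 48 * g / h ^ 2 := fun v hv =>
    calc ‖v‖ * ((1 + 2 * h + g) * Y) ≤ ‖v‖ * (2 * Y) :=
          mul_le_mul_of_nonneg_left hW2 (norm_nonneg _)
      _ = 2 * (‖v‖ * Y) := by ring
      _ ≤ 2 * (24 * g / h ^ 2) := by linarith [(hball v hv).2]
      _ = _ := by ring
  have hone : 48 * g / h ^ 2 ≤ 1 := by
    rw [div_le_one (by positivity)]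
    nlinarith [sq_nonneg h]
  obtain ⟨v, hv, hv0⟩ := exists_eq_zero_of_norm_sub_le (analyticOnNhd_LSeries_vonMangoldt t)
    (E := g * Y / 32) hd0 hdS (by rw [abs_of_neg hS₁0]; linarith) fun v hv => by
      have h1 := hY ((1 + h) * Y) _ t P hW1 ht v (hball v hv).1 ((hvW v hv).trans hone)
      rw [← hS₁, ← hS₂] at h1
      refine h1.trans ?_
      have h2 : (‖v‖ * ((1 + 2 * h + g) * Y)) ^ 2 ≤ (48 * g / h ^ 2) ^ 2 :=
        pow_le_pow_left₀ (by positivity) (hvW v hv) 2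
      have h3 : (48 * g / h ^ 2) ^ 2 * (3 * Y) = 6912 / 2000000 * (g * Y) := by
        have h4 : g ^ 2 = g * (h ^ 4 / 2000000) := by rw [sq, ← hg]
        field_simp
        nlinarith [h4]
      have h5 := mul_le_mul h2 hexp (Finset.sum_nonneg fun n _ => logPrimeDiv_nonneg n)
        (by positivity)
      rw [h3] at h5
      linarith
  refine ⟨v, (hball v hv).1, (hball v hv).2, deriv_riemannZeta_eq_zero_of_LSeries_eq_zero ?_ hv0⟩
  have : 0 < v.re := lt_of_lt_of_le (by positivity) (hball v hv).1
  simpa using this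

end Zero

section EulerFactor

lemma neg_log_norm_one_sub_le {u : ℂ} (hu : ‖u‖ ≤ 1 / 2) :
    -Real.log ‖1 - u‖ ≤ u.re + ‖u‖ ^ 2 := by
  have h1 := Complex.norm_log_one_add_sub_self_le (z := -u) (by rw [norm_neg]; linarith)
  have h2 := (abs_le.mp ((Complex.abs_re_le_norm _).trans h1)).1
  rw [Complex.sub_re, Complex.log_re, Complex.neg_re, norm_neg, ← sub_eq_add_neg] at h2
  have h3 : (1 - ‖u‖)⁻¹ ≤ 2 := by
    rw [inv_le_comm₀ (by linarith) two_pos]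
    linarith
  have h4 : ‖u‖ ^ 2 * (1 - ‖u‖)⁻¹ ≤ ‖u‖ ^ 2 * 2 := mul_le_mul_of_nonneg_left h3 (sq_nonneg _)
  linarith

lemma neg_log_norm_one_sub_le_two_mul {u : ℂ} (hu : ‖u‖ ≤ 1 / 2) :
    -Real.log ‖1 - u‖ ≤ 2 * ‖u‖ := by
  have h1 := neg_log_norm_one_sub_le hu
  have h2 := Complex.re_le_norm u
  nlinarith [norm_nonneg u]

lemma neg_log_norm_one_sub_le_add {u u' : ℂ} (hu : ‖u‖ ≤ 1 / 2) (hu' : ‖u'‖ ≤ 1 / 2) :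
    -Real.log ‖1 - u‖ ≤ -Real.log ‖1 - u'‖ + 2 * ‖u - u'‖ := by
  have hpos : ∀ w : ℂ, ‖w‖ ≤ 1 / 2 → 1 / 2 ≤ ‖1 - w‖ := fun w hw => by
    have := norm_sub_norm_le (1 : ℂ) w
    rw [norm_one] at this
    linarith
  have ha := hpos u hu
  have hb := hpos u' hu'
  have h1 : Real.log ‖1 - u'‖ - Real.log ‖1 - u‖ ≤ ‖1 - u'‖ / ‖1 - u‖ - 1 := by
    rw [← Real.log_div (by linarith) (by linarith)]
    exact Real.log_le_sub_one_of_pos (div_pos (by linarith) (by linarith))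
  have h2 : ‖1 - u'‖ / ‖1 - u‖ - 1 ≤ 2 * ‖u - u'‖ := by
    rw [div_sub_one (by linarith), div_le_iff₀ (by linarith)]
    have h3 : ‖1 - u'‖ - ‖1 - u‖ ≤ ‖u - u'‖ := by
      have := norm_sub_norm_le (1 - u') (1 - u)
      rwa [sub_sub_sub_cancel_left] at this
    nlinarith [norm_nonneg (u - u')]
  linarith

lemma primeInv_le_half (n : ℕ) : primeInv n ≤ 1 / 2 := by
  unfold primeInv
  split_ifs with h
  · exact one_div_le_one_div_of_le two_pos (by exact_mod_cast h.two_le)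
  · norm_num

lemma primeInv_le_inv (n : ℕ) : primeInv n ≤ (n : ℝ)⁻¹ := by
  unfold primeInv
  split_ifs with h
  · rw [one_div]
  · positivity

lemma primeInv_mul_log (n : ℕ) : primeInv n * Real.log n = logPrimeDiv n := by
  unfold primeInv logPrimeDiv
  split_ifs
  · ring
  · ring

variable {q : ℕ}

/-- The local parameter at `p` of the Euler product of `χ` at `1 + v + t * I`. -/
noncomputable def eulerParam (χ : DirichletCharacter ℂ q) (t : ℝ) (v : ℂ) (n : ℕ) : ℂ :=
  χ n * (primeInv n : ℂ) * twist t n * (n : ℂ) ^ (-v)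

lemma norm_eulerParam_le_mul (χ : DirichletCharacter ℂ q) (t : ℝ) (v : ℂ) {n : ℕ} (hn : n ≠ 0) :
    ‖eulerParam χ t v n‖ ≤ primeInv n * (n : ℝ) ^ (-v.re) := by
  rw [eulerParam, norm_mul, norm_mul, norm_mul, norm_twist t hn, mul_one, Complex.norm_real,
    Real.norm_of_nonneg (primeInv_nonneg n),
    Complex.norm_natCast_cpow_of_pos (Nat.pos_of_ne_zero hn), Complex.neg_re]
  refine mul_le_mul_of_nonneg_right ?_ (by positivity)
  exact mul_le_of_le_one_left (primeInv_nonneg n) (χ.norm_le_one n)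

lemma norm_eulerParam_le (χ : DirichletCharacter ℂ q) (t : ℝ) {v : ℂ} (hv : 0 ≤ v.re) {n : ℕ}
    (hn : n ≠ 0) : ‖eulerParam χ t v n‖ ≤ primeInv n := by
  refine (norm_eulerParam_le_mul χ t v hn).trans (mul_le_of_le_one_right (primeInv_nonneg n) ?_)
  exact Real.rpow_le_one_of_one_le_of_nonpos (by exact_mod_cast Nat.one_le_iff_ne_zero.mpr hn)
    (by linarith)

variable [NeZero q]

/-- The Euler factors at primes up to `exp Y`. -/
lemma neg_log_norm_one_sub_eulerParam_le (χ : DirichletCharacter ℂ q) {Y : ℝ} (V t : ℝ) {v : ℂ}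
    (hv : 0 ≤ v.re) (hvY : ‖v‖ * Y ≤ 1) {n : ℕ} (hn : n ≠ 0) (hnY : Real.log n ≤ Y) :
    -Real.log ‖1 - eulerParam χ t v n‖ ≤
      -(if n.Prime ∧ ¬ n ∣ q then Real.log (1 + 1 / n) else 0) +
        4 * (logPrimeDiv n * ‖twist t n - target χ Y V n‖) + 4 * ‖v‖ * logPrimeDiv n := by
  have hnn : 0 ≤ 4 * (logPrimeDiv n * ‖twist t n - target χ Y V n‖) + 4 * ‖v‖ * logPrimeDiv n := by
    have := logPrimeDiv_nonneg n
    positivity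
  by_cases hp : n.Prime ∧ ¬ n ∣ q
  · rw [if_pos hp]
    have hχ0 : χ n ≠ 0 := mt (dirichletCharacter_prime_eq_zero_iff χ hp.1).mp hp.2
    have hinv : primeInv n = 1 / n := if_pos hp.1
    have hn0 : (0 : ℝ) < n := by positivity
    have hu := (norm_eulerParam_le χ t hv hn).trans (primeInv_le_half n)
    have hu' : ‖(-(primeInv n : ℂ))‖ ≤ 1 / 2 := by
      rw [norm_neg, Complex.norm_real, Real.norm_of_nonneg (primeInv_nonneg n)]
      exact primeInv_le_half n
    have h1 := neg_log_norm_one_sub_le_add hu hu'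
    have h2 : ‖(1 : ℂ) - -(primeInv n : ℂ)‖ = 1 + 1 / n := by
      rw [sub_neg_eq_add, hinv, ← Complex.ofReal_one, ← Complex.ofReal_add, Complex.norm_real,
        Real.norm_of_nonneg (by positivity)]
    have h3 : -(primeInv n : ℂ) = χ n * primeInv n * target χ Y V n := by
      rw [target, if_pos hnY, if_neg hχ0]
      have h4 : χ n * (starRingEnd ℂ) (χ n) = 1 := by
        rw [Complex.mul_conj, Complex.normSq_eq_norm_sq, norm_dirichletCharacter_eq_one hχ0]
        simp
      calc -(primeInv n : ℂ) = -(χ n * (starRingEnd ℂ) (χ n)) * primeInv n := by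
            rw [h4]; ring
        _ = _ := by ring
    have h5 : ‖(n : ℂ) ^ (-v) - 1‖ ≤ 2 * (‖v‖ * Real.log n) := by
      have hlog : 0 ≤ Real.log n := Real.log_natCast_nonneg n
      have h6 : ‖-(v * (Real.log n : ℂ))‖ = ‖v‖ * Real.log n := by
        rw [norm_neg, norm_mul, Complex.norm_real, Real.norm_of_nonneg hlog]
      rw [natCast_cpow_neg_eq_exp hn, ← h6]
      refine Complex.norm_exp_sub_one_le ?_
      rw [h6]
      exact (mul_le_mul_of_nonneg_left hnY (norm_nonneg v)).trans hvY
    have h7 : ‖eulerParam χ t v n - -(primeInv n : ℂ)‖ ≤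
        primeInv n * (‖twist t n - target χ Y V n‖ + 2 * (‖v‖ * Real.log n)) := by
      rw [h3, eulerParam]
      calc _ = ‖χ n * (primeInv n : ℂ) * ((twist t n - target χ Y V n) +
              twist t n * ((n : ℂ) ^ (-v) - 1))‖ := by congr 1; ring
        _ = primeInv n * ‖(twist t n - target χ Y V n) + twist t n * ((n : ℂ) ^ (-v) - 1)‖ := by
            rw [norm_mul, norm_mul, norm_dirichletCharacter_eq_one hχ0, one_mul,
              Complex.norm_real, Real.norm_of_nonneg (primeInv_nonneg n)]
        _ ≤ _ := by
            refine mul_le_mul_of_nonneg_left ((norm_add_le _ _).trans ?_) (primeInv_nonneg n)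
            rw [norm_mul, norm_twist t hn, one_mul]
            linarith
    rw [h2] at h1
    have h8 := mul_le_mul_of_nonneg_right (primeInv_le n)
      (norm_nonneg (twist t n - target χ Y V n))
    have h9 := primeInv_mul_log n
    have h10 : primeInv n * (‖twist t n - target χ Y V n‖ + 2 * (‖v‖ * Real.log n)) =
        primeInv n * ‖twist t n - target χ Y V n‖ + 2 * ‖v‖ * logPrimeDiv n := by
      rw [← h9]; ring
    linarith
  · rw [if_neg hp, neg_zero, zero_add]
    have h1 : eulerParam χ t v n = 0 := by
      rw [eulerParam]
      by_cases hpr : n.Prime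
      · have : n ∣ q := by
          by_contra h
          exact hp ⟨hpr, h⟩
        rw [(dirichletCharacter_prime_eq_zero_iff χ hpr).mpr this]
        ring
      · rw [primeInv, if_neg hpr]
        simp
    rw [h1, sub_zero, norm_one, Real.log_one, neg_zero]
    exact hnn

/-- An upper bound for partial Euler products gives one for the `L`-function. -/
lemma norm_LFunction_le_exp (χ : DirichletCharacter ℂ q) (t : ℝ) {v : ℂ} (hv : 0 < v.re) {A : ℝ}
    {P : ℕ} (h : ∀ b, P ≤ b →
      ∑ n ∈ Finset.Ioc 0 b, -Real.log ‖1 - eulerParam χ t v n‖ ≤ A) :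
    ‖DirichletCharacter.LFunction χ (1 + v + t * Complex.I)‖ ≤ Real.exp A := by
  have hs : 1 < (1 + v + t * Complex.I).re := by simpa
  have h1 := (DirichletCharacter.LSeries_eulerProduct χ hs).norm
  rw [DirichletCharacter.LFunction_eq_LSeries χ hs]
  refine le_of_tendsto h1 (Filter.eventually_atTop.mpr ⟨P + 1, fun b hb => ?_⟩)
  obtain ⟨b, rfl⟩ : ∃ b', b = b' + 1 := ⟨b - 1, by omega⟩
  have hpos : ∀ n, n ≠ 0 → 0 < ‖1 - eulerParam χ t v n‖ := fun n hn => by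
    have h2 := norm_sub_norm_le (1 : ℂ) (eulerParam χ t v n)
    have h3 := (norm_eulerParam_le χ t hv.le hn).trans (primeInv_le_half n)
    rw [norm_one] at h2
    linarith
  have hsub : (b + 1).primesBelow ⊆ Finset.Ioc 0 b := fun p hp => by
    have h2 := Nat.lt_of_mem_primesBelow hp
    have h3 := (Nat.prime_of_mem_primesBelow hp).pos
    rw [Finset.mem_Ioc]
    omega
  have hprod : ∀ p ∈ (b + 1).primesBelow,
      ‖(1 - χ p * (p : ℂ) ^ (-(1 + v + t * Complex.I)))⁻¹‖ =
        Real.exp (-Real.log ‖1 - eulerParam χ t v p‖) := fun p hp => by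
    have hpp := Nat.prime_of_mem_primesBelow hp
    have h2 : χ p * (p : ℂ) ^ (-(1 + v + t * Complex.I)) = eulerParam χ t v p := by
      rw [natCast_cpow_neg_one_add hpp.ne_zero, eulerParam, primeInv, if_pos hpp]
      push_cast
      ring
    rw [h2, Real.exp_neg, Real.exp_log (hpos p hpp.ne_zero), norm_inv]
  rw [norm_prod, Finset.prod_congr rfl hprod, ← Real.exp_sum, Real.exp_le_exp]
  refine le_trans (le_of_eq (Finset.sum_subset hsub fun n hn hn' => ?_)) (h b (by omega))
  have hnp : ¬ n.Prime := fun hp => hn' (Nat.mem_primesBelow.mpr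
    ⟨by have := (Finset.mem_Ioc.mp hn).2; omega, hp⟩)
  rw [eulerParam, primeInv, if_neg hnp]
  simp

end EulerFactor

section SmallValue

variable {q : ℕ} [NeZero q]

/-- An upper bound for `L(s, χ)` at the points under consideration. -/
lemma eventually_norm_LFunction_le (χ : DirichletCharacter ℂ q) {h g : ℝ} (hh : 0 < h)
    (hh4 : h ≤ 1 / 4) (hg : g = h ^ 4 / 2000000) :
    ∀ᶠ Y : ℝ in Filter.atTop, ∀ t : ℝ, ∀ P : ℕ,
      IsGoodShift χ Y ((1 + h) * Y) ((1 + 2 * h + g) * Y) t P →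
      ∀ v : ℂ, g / 24 / Y ≤ v.re → ‖v‖ * Y ≤ 24 * g / h ^ 2 →
        ‖DirichletCharacter.LFunction χ (1 + v + t * Complex.I)‖ ≤
          (Real.pi ^ 2 * Real.exp (-Real.eulerMascheroniConstant) / 6) *
            (∏ p ∈ q.primeFactors, ((p : ℝ) + 1) / p) * Real.exp (10 * h) / Y := by
  have hg0 : 0 < g := by rw [hg]; positivity
  have hh2 : h ^ 2 ≤ 1 / 16 := by nlinarith
  have hgh2 : g ≤ h ^ 2 / 2000000 := by
    rw [hg, show h ^ 4 = h ^ 2 * h ^ 2 by ring]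
    nlinarith [sq_nonneg h]
  have hgh : g ≤ h / 2 := by nlinarith
  have hsmall : 24 * g / h ^ 2 ≤ h / 8 := by
    rw [div_le_iff₀ (by positivity), hg]
    have : h ^ 4 ≤ h ^ 3 := pow_le_pow_of_le_one hh.le (by linarith) (by norm_num)
    nlinarith [pow_pos hh 3]
  obtain ⟨C, hC0, hC⟩ := abs_sum_Ioc_logPrimeDiv_sub_le
  obtain ⟨C', hC0', hC'⟩ := abs_sum_logPrimeDiv_exp_sub_le
  filter_upwards [Filter.eventually_ge_atTop 1, Filter.eventually_ge_atTop C',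
    Filter.eventually_ge_atTop ((16 + 2 * C) / h),
    eventually_tail_le (c := g / 24) (by positivity),
    eventually_le_sum_log_one_add_inv (NeZero.ne q) hh] with Y hY1 hYC' hYC htail hmertens t P ht
      v hv hvY
  obtain ⟨K, hK⟩ : ∃ K, K = (Real.pi ^ 2 * Real.exp (-Real.eulerMascheroniConstant) / 6) *
    (∏ p ∈ q.primeFactors, ((p : ℝ) + 1) / p) := ⟨_, rfl⟩
  have hK0 : 0 < K := by
    rw [hK]
    refine mul_pos (by positivity) (Finset.prod_pos fun p hp => ?_)
    have : (0 : ℝ) < p := by exact_mod_cast (Nat.prime_of_mem_primeFactors hp).pos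
    positivity
  rw [← hK] at hmertens ⊢
  have hY0 : 0 < Y := by linarith
  rw [div_le_iff₀ hh] at hYC
  have hv0 : 0 < v.re := lt_of_lt_of_le (by positivity) hv
  have hvY1 : ‖v‖ * Y ≤ 1 := by linarith
  have hv1 : ‖v‖ ≤ 1 := (le_mul_of_one_le_right (norm_nonneg v) hY1).trans hvY1
  obtain ⟨W, hW⟩ : ∃ W, W = (1 + 2 * h + g) * Y := ⟨_, rfl⟩
  rw [← hW] at ht
  have hYW : Y ≤ W := by rw [hW]; exact le_mul_of_one_le_left hY0.le (by linarith)
  have hAB : ⌊Real.exp Y⌋₊ ≤ ⌊Real.exp W⌋₊ := Nat.floor_mono (Real.exp_le_exp.mpr hYW)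
  have hBP : ⌊Real.exp W⌋₊ ≤ P :=
    Nat.floor_le_of_le ((Real.exp_le_exp.mpr ht.le_cube).trans ht.exp_le)
  have hBY : Y ≤ (⌊Real.exp W⌋₊ : ℝ) := by
    have h1 := Nat.lt_floor_add_one (Real.exp W)
    have h2 := Real.add_one_le_exp W
    linarith
  obtain ⟨F, hF⟩ : ∃ F : ℕ → ℝ, F = fun n => -Real.log ‖1 - eulerParam χ t v n‖ := ⟨_, rfl⟩
  have hne : ∀ {a b n : ℕ}, n ∈ Finset.Ioc a b → n ≠ 0 := fun {a b n} hn => by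
    have := (Finset.mem_Ioc.mp hn).1
    omega
  have hF2 : ∀ n, n ≠ 0 → F n ≤ 2 * ‖eulerParam χ t v n‖ := fun n hn => by
    rw [hF]
    exact neg_log_norm_one_sub_le_two_mul
      ((norm_eulerParam_le χ t hv0.le hn).trans (primeInv_le_half n))
  have hnear : ∑ n ∈ Finset.Ioc 0 ⌊Real.exp Y⌋₊, F n ≤
      -(Real.log Y - Real.log K - h) + 4 * (2 / Y) + h := by
    have h1 : ∑ n ∈ Finset.Ioc 0 ⌊Real.exp Y⌋₊, F n ≤
        ∑ n ∈ Finset.Ioc 0 ⌊Real.exp Y⌋₊,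
          (-(if n.Prime ∧ ¬ n ∣ q then Real.log (1 + 1 / n) else 0) +
          4 * (logPrimeDiv n * ‖twist t n - target χ Y ((1 + h) * Y) n‖) +
            4 * ‖v‖ * logPrimeDiv n) := by
      refine Finset.sum_le_sum fun n hn => ?_
      rw [hF]
      exact neg_log_norm_one_sub_eulerParam_le χ ((1 + h) * Y) t hv0.le hvY1 (hne hn)
        (mem_Ioc_zero_floor_exp.mp hn).2
    rw [Finset.sum_add_distrib, Finset.sum_add_distrib, Finset.sum_neg_distrib,
      ← Finset.sum_filter, ← Finset.mul_sum, ← Finset.mul_sum] at h1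
    have h2 : ∑ n ∈ Finset.Ioc 0 ⌊Real.exp Y⌋₊,
        logPrimeDiv n * ‖twist t n - target χ Y ((1 + h) * Y) n‖ ≤ 2 / Y :=
      le_trans (Finset.sum_le_sum_of_subset_of_nonneg (Finset.Ioc_subset_Ioc_right hAB)
        fun n _ _ => mul_nonneg (logPrimeDiv_nonneg n) (norm_nonneg _)) ht.sum_near_le
    have h3 := (abs_le.mp (hC' Y hY0.le)).2
    have h4 : 4 * ‖v‖ * ∑ n ∈ Finset.Ioc 0 ⌊Real.exp Y⌋₊, logPrimeDiv n ≤ h := by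
      calc _ ≤ 4 * ‖v‖ * (2 * Y) := mul_le_mul_of_nonneg_left (by linarith) (by positivity)
        _ = 8 * (‖v‖ * Y) := by ring
        _ ≤ h := by linarith
    linarith
  have hmid : ∑ n ∈ Finset.Ioc ⌊Real.exp Y⌋₊ ⌊Real.exp W⌋₊, F n ≤ 5 * h + 2 * C / Y := by
    calc _ ≤ ∑ n ∈ Finset.Ioc ⌊Real.exp Y⌋₊ ⌊Real.exp W⌋₊, 2 / Y * logPrimeDiv n := by
          refine Finset.sum_le_sum fun n hn => (hF2 n (hne hn)).trans ?_
          have h1 := norm_eulerParam_le χ t hv0.le (hne hn)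
          have h2 := (mem_Ioc_floor_exp.mp hn).2.1
          rw [← primeInv_mul_log, div_mul_eq_mul_div, le_div_iff₀ hY0]
          have h3 := mul_le_mul h1 h2.le hY0.le (primeInv_nonneg n)
          linarith
      _ = 2 / Y * ∑ n ∈ Finset.Ioc ⌊Real.exp Y⌋₊ ⌊Real.exp W⌋₊, logPrimeDiv n := by
          rw [Finset.mul_sum]
      _ ≤ 2 / Y * ((2 * h + g) * Y + C) := by
          refine mul_le_mul_of_nonneg_left ?_ (by positivity)
          have h1 := (abs_le.mp (hC Y W hY0.le hYW)).2
          rw [hW] at h1 ⊢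
          linarith
      _ = 2 * (2 * h + g) + 2 * C / Y := by field_simp
      _ ≤ _ := by linarith
  have htl : ∑ n ∈ Finset.Ioc ⌊Real.exp W⌋₊ P, F n ≤ 3 / Y + 1 / Y := by
    calc _ ≤ ∑ n ∈ Finset.Ioc ⌊Real.exp W⌋₊ P,
          ((eulerParam χ t v n).re + ((n : ℝ) ^ 2)⁻¹) := by
          refine Finset.sum_le_sum fun n hn => ?_
          have h1 := norm_eulerParam_le χ t hv0.le (hne hn)
          rw [hF]
          refine (neg_log_norm_one_sub_le (h1.trans (primeInv_le_half n))).trans ?_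
          rw [← inv_pow]
          gcongr
          exact h1.trans (primeInv_le_inv n)
      _ ≤ _ := by
          rw [Finset.sum_add_distrib, ← Complex.re_sum]
          refine add_le_add ((Complex.re_le_norm _).trans (ht.tail_char_le v hv0.le hv1)) ?_
          have hB0 : (0 : ℝ) < ⌊Real.exp W⌋₊ := hY0.trans_le hBY
          have h1 := sum_Ioc_inv_sq_le_sub (α := ℝ) (k := ⌊Real.exp W⌋₊) (n := P)
            (by exact_mod_cast hB0.ne') hBP
          have h2 : (0 : ℝ) ≤ (P : ℝ)⁻¹ := by positivity
          have h3 := one_div_le_one_div_of_le hY0 hBY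
          rw [one_div (⌊Real.exp W⌋₊ : ℝ)] at h3
          linarith
  have hfar : ∀ b, ∑ n ∈ Finset.Ioc P b, F n ≤ 4 / Y := fun b => by
    calc _ ≤ ∑ n ∈ Finset.Ioc P b, 4 * (logPrimeDiv n * (n : ℝ) ^ (-v.re)) := by
          refine Finset.sum_le_sum fun n hn => (hF2 n (hne hn)).trans ?_
          have h1 := norm_eulerParam_le_mul χ t v (hne hn)
          have h2 := mul_le_mul_of_nonneg_right (primeInv_le n)
            (by positivity : 0 ≤ (n : ℝ) ^ (-v.re))
          linarith
      _ = 4 * ∑ n ∈ Finset.Ioc P b, logPrimeDiv n * (n : ℝ) ^ (-v.re) := by rw [Finset.mul_sum]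
      _ ≤ 4 * (1 / Y) := by
          linarith [htail v.re P hv ht.exp_le b]
      _ = _ := by ring
  have hfin : K * Real.exp (10 * h) / Y = Real.exp (-Real.log Y + Real.log K + 10 * h) := by
    rw [Real.exp_add, Real.exp_add, Real.exp_neg, Real.exp_log hY0, Real.exp_log hK0]
    ring
  rw [hfin]
  refine norm_LFunction_le_exp χ t hv0 (P := P) fun b hb => ?_
  have hsplit : ∑ n ∈ Finset.Ioc 0 b, F n = ∑ n ∈ Finset.Ioc 0 ⌊Real.exp Y⌋₊, F n +
      ∑ n ∈ Finset.Ioc ⌊Real.exp Y⌋₊ ⌊Real.exp W⌋₊, F n +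
      ∑ n ∈ Finset.Ioc ⌊Real.exp W⌋₊ P, F n + ∑ n ∈ Finset.Ioc P b, F n := by
    rw [Finset.sum_Ioc_consecutive _ (Nat.zero_le _) hAB,
      Finset.sum_Ioc_consecutive _ (Nat.zero_le _) hBP,
      Finset.sum_Ioc_consecutive _ (Nat.zero_le _) hb]
  have hsmall' : 4 * (2 / Y) + 2 * C / Y + (3 / Y + 1 / Y) + 4 / Y ≤ h := by
    rw [show 4 * (2 / Y) + 2 * C / Y + (3 / Y + 1 / Y) + 4 / Y = (16 + 2 * C) / Y by ring,
      div_le_iff₀ hY0]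
    linarith
  have := hfar b
  rw [hF] at hsplit hnear hmid htl this
  simp only at hsplit hnear hmid htl this
  rw [hsplit]
  linarith

lemma exists_small_parameter (K : ℝ) {ε : ℝ} (hε : 0 < ε) :
    ∃ h : ℝ, 0 < h ∧ h ≤ 1 / 4 ∧ K * Real.exp (10 * h) * (1 + 5 * h) ≤ K + ε := by
  have hc : Filter.Tendsto (fun h : ℝ => K * Real.exp (10 * h) * (1 + 5 * h)) (nhds 0)
      (nhds K) := by
    have : Continuous fun h : ℝ => K * Real.exp (10 * h) * (1 + 5 * h) := by fun_prop
    simpa using this.tendsto 0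
  have h1 := (hc.eventually (gt_mem_nhds (show K < K + ε by linarith))).filter_mono
    (nhdsWithin_le_nhds (s := Set.Ioi 0))
  have h2 : ∀ᶠ h : ℝ in nhdsWithin 0 (Set.Ioi 0), h ∈ Set.Ioc (0 : ℝ) (1 / 4) :=
    Ioc_mem_nhdsGT (by norm_num)
  obtain ⟨h, h3, h4⟩ := (h1.and h2).exists
  exact ⟨h, h4.1, h4.2, h3.le⟩

lemma exists_deriv_riemannZeta_eq_zero_and_norm_LFunction_le {χ : DirichletCharacter ℂ q}
    (hχ : χ ≠ 1) {ε : ℝ} (hε : 0 < ε) (T : ℝ) :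
    ∃ s : ℂ, deriv riemannZeta s = 0 ∧ 1 < s.re ∧ T < s.im ∧
      ‖DirichletCharacter.LFunction χ s‖ * Real.log (Real.log s.im) ≤
        (Real.pi ^ 2 * Real.exp (-Real.eulerMascheroniConstant) / 6) *
          (∏ p ∈ q.primeFactors, ((p : ℝ) + 1) / p) + ε := by
  obtain ⟨h, hh, hh4, hK⟩ := exists_small_parameter
    ((Real.pi ^ 2 * Real.exp (-Real.eulerMascheroniConstant) / 6) *
      (∏ p ∈ q.primeFactors, ((p : ℝ) + 1) / p)) hε
  obtain ⟨g, hg⟩ : ∃ g, g = h ^ 4 / 2000000 := ⟨_, rfl⟩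
  have hg0 : 0 < g := by rw [hg]; positivity
  have hh2 : h ^ 2 ≤ 1 / 16 := by nlinarith
  have hgh2 : g ≤ h ^ 2 / 2000000 := by
    rw [hg, show h ^ 4 = h ^ 2 * h ^ 2 by ring]
    nlinarith [sq_nonneg h]
  have hgh : g ≤ h / 2 := by nlinarith
  obtain ⟨Y, hY1, hzero, hL, hgood⟩ := ((Filter.eventually_ge_atTop (1 : ℝ)).and
    ((eventually_exists_deriv_riemannZeta_eq_zero hχ hh hh4 hg).and
    ((eventually_norm_LFunction_le χ hh hh4 hg).and
    (eventually_exists_isGoodShift χ (κ := 1 + 2 * h + g) (by linarith) (by linarith) hh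
      (max T 10 + 1))))).exists
  have hY0 : 0 < Y := by linarith
  obtain ⟨t, P, hT, hlog, ht⟩ := hgood ((1 + h) * Y)
  obtain ⟨v, hv, hvY, hv0⟩ := hzero t P ht
  have hLv := hL t P ht v hv hvY
  have hvre : 0 < v.re := lt_of_lt_of_le (by positivity) hv
  have hv1 : ‖v‖ ≤ 1 := by
    refine ((le_mul_of_one_le_right (norm_nonneg v) hY1).trans hvY).trans ?_
    rw [div_le_one (by positivity)]
    linarith [sq_nonneg h]
  have him := abs_le.mp ((Complex.abs_im_le_norm v).trans hv1)
  have him' : (1 + v + t * Complex.I).im = v.im + t := by simp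
  have h10 := le_max_right T 10
  have hTm := le_max_left T 10
  refine ⟨1 + v + t * Complex.I, hv0, by simpa, by rw [him']; linarith, ?_⟩
  have h1 : Real.log (Real.log (1 + v + t * Complex.I).im) ≤ (1 + 5 * h) * Y := by
    have h2 : 0 < Real.log (v.im + t) := Real.log_pos (by linarith)
    have h3 : Real.log (v.im + t) ≤ Real.log (t + 1) :=
      Real.log_le_log (by linarith) (by linarith)
    rw [him']
    refine (Real.log_le_log h2 h3).trans (hlog.trans ?_)
    exact mul_le_mul_of_nonneg_right (by linarith) hY0.le
  refine le_trans ?_ hK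
  refine (mul_le_mul_of_nonneg_left h1 (norm_nonneg _)).trans
    ((mul_le_mul_of_nonneg_right hLv (by positivity)).trans (le_of_eq ?_))
  field_simp

end SmallValue

open Complex DirichletCharacter ArithmeticFunction Finset

/-- **Theorem 4.** Unconditionally, there are critical points `ρ'` of the Riemann zeta function
with `Re ρ' > 1` and arbitrarily large imaginary part at which
`|L(ρ',χ)| log log (Im ρ') ≤ (π² e^{−C₀}/6) ∏_{p ∣ q} (p+1)/p + ε`. -/
theorem small_values_upper_bound (q : ℕ) [NeZero q] (hq : 2 < q)
    (χ : DirichletCharacter ℂ q) (hχ : χ.IsPrimitive) :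
    ∀ ε : ℝ, 0 < ε → ∀ T : ℝ, 0 < T →
      ∃ ρ' : ℂ, deriv riemannZeta ρ' = 0 ∧ 1 < ρ'.re ∧ T < ρ'.im ∧
        ‖LFunction χ ρ'‖ * Real.log (Real.log ρ'.im) ≤
          (Real.pi ^ 2 * Real.exp (-Real.eulerMascheroniConstant) / 6) *
            (∏ p ∈ q.primeFactors, ((p : ℝ) + 1) / p) + ε := by
  intro ε hε T _
  have hχ1 : χ ≠ 1 := by
    rintro rfl
    rw [DirichletCharacter.isPrimitive_def, DirichletCharacter.conductor_one] at hχ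
    omega
  exact exists_deriv_riemannZeta_eq_zero_and_norm_LFunction_le hχ1 hε T
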